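/- arXiv:1901.09288 — 2 statements merged into one kernel-verified Lean document; each statement's English description precedes it below -/
import Mathlib

section
/- Let (V, ‖·‖_V) be a separable real Banach space, (W, ‖·‖_W) a real Banach space, T, χ ∈ (0,∞), and let J ⊆ [0,T] be a convex set with 0 ∈ J. Let F : V → W be continuous and define Ψ : [0,∞] → [0,∞] by Ψ(r) = sup({‖F(v)−F(w)‖_W / ‖v−w‖_V : v, w ∈ V, v ≠ w, ‖v‖_V + ‖w‖_V ≤ r} ∪ {0}); assume Ψ(r) < ∞ for every r ∈ [0,∞). Let S : (0,T) → L(W,V) be Borel measurable, α ∈ [0,1), and (P_n)_{n∈ℕ} ⊆ L(V) satisfy sup_{s∈(0,T)} s^α ‖S_s‖_{L(W,V)} < ∞, limsup_{m→∞} ‖P_m‖_{L(V)} < ∞, and lim_{m→∞} ∫₀ᵀ ‖(Id_V − P_m) S_s‖_{L(W,V)} ds = 0. Let O ∈ C([0,T], V) and 𝒪ⁿ : [0,T] → V (n ∈ ℕ) satisfy lim_{m→∞} sup_{s∈[0,T]} ‖O_s − 𝒪ᵐ_s‖_V = 0, and let (h_n)_{n∈ℕ} ⊆ (0,∞) with lim_{m→∞}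 h_m = 0. Let X ∈ C(J, V) and 𝒳ⁿ : [0,T] → V (n ∈ ℕ) satisfy: for all t ∈ J, X_t = ∫₀ᵗ S_{t−s} F(X_s) ds + O_t; for all n ∈ ℕ and t ∈ [0,T], 𝒳ⁿ_t = ∫₀ᵗ P_n S_{t−s} · 1_{[0, h_n^{−χ}]}(‖𝒳ⁿ_{⌊s⌋_{h_n}}‖_V + ‖𝒪ⁿ_{⌊s⌋_{h_n}}‖_V) · F(𝒳ⁿ_{⌊s⌋_{h_n}}) ds + 𝒪ⁿ_t; and liminf_{m→∞} sup_{s∈J} ‖𝒳ᵐ_s‖_V < ∞. Then: (i) for every t ∈ J, lim_{n→∞} sup_{s∈[0,t]} ‖X_s − 𝒳ⁿ_s‖_V = 0; and (ii) sup_{s∈J} ‖X_s‖_V < ∞. -/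
open MeasureTheory

/-- `⌊t⌋_h = max{kh : k ∈ ℤ, kh ≤ t}`. -/
noncomputable def fl (h t : ℝ) : ℝ := h * ⌊t / h⌋

lemma aux_refl_int (f : ℝ → ℝ) (s : ℝ) :
    ∫ r in Set.Ioo (0:ℝ) s, f (s - r) = ∫ u in Set.Ioo (0:ℝ) s, f u := by
  have h := (Measure.measurePreserving_sub_left (volume : Measure ℝ) s).setIntegral_preimage_emb
    (Homeomorph.subLeft s).measurableEmbedding f (Set.Ioo 0 s)
  simpa using h

lemma aux_refl_on (f : ℝ → ℝ) (s : ℝ) (hf : IntegrableOn f (Set.Ioo 0 s)) :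
    IntegrableOn (fun r => f (s - r)) (Set.Ioo 0 s) := by
  have h := ((Measure.measurePreserving_sub_left (volume : Measure ℝ) s).integrableOn_comp_preimage
    (Homeomorph.subLeft s).measurableEmbedding (f := f) (s := Set.Ioo 0 s)).2 hf
  simpa [Function.comp_def] using h

lemma aux_intg (α : ℝ) (hα : α ∈ Set.Ico (0:ℝ) 1) (l : ℝ) (hl : 0 < l) :
    IntegrableOn (fun u : ℝ => u ^ (-α) * Real.exp (-(l * u))) (Set.Ioi 0) := by
  have := integrableOn_rpow_mul_exp_neg_mul_rpow (p := 1) (s := -α) (b := l)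
    (by linarith [hα.2]) zero_lt_one hl
  simpa using this

lemma aux_kernel (α K : ℝ) (hα : α ∈ Set.Ico (0:ℝ) 1) (hK : 0 ≤ K) :
    ∃ l : ℝ, 0 < l ∧ ∀ s : ℝ,
      IntegrableOn (fun r => (s - r) ^ (-α) * Real.exp (l * r)) (Set.Ioo 0 s) ∧
      K * ∫ r in Set.Ioo (0:ℝ) s, (s - r) ^ (-α) * Real.exp (l * r) ≤ Real.exp (l * s) := by
  have h1 : Filter.Tendsto (fun l : ℝ => K * (l ^ (-(1 - α)) * Real.Gamma (1 - α)))
      Filter.atTop (nhds 0) := by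
    have := ((tendsto_rpow_neg_atTop (y := 1 - α) (by linarith [hα.2])).mul_const
      (Real.Gamma (1 - α))).const_mul K
    simpa using this
  obtain ⟨l, hl1, hl0⟩ := ((h1.eventually (gt_mem_nhds zero_lt_one)).and
    (Filter.eventually_gt_atTop 0)).exists
  refine ⟨l, hl0, fun s => ?_⟩
  have hI := aux_intg α hα l hl0
  have hfe : (fun r => (s - r) ^ (-α) * Real.exp (l * r)) =
      fun r => (fun u : ℝ => Real.exp (l * s) * (u ^ (-α) * Real.exp (-(l * u)))) (s - r) := by
    funext r
    have : Real.exp (l * r) = Real.exp (l * s) * Real.exp (-(l * (s - r))) := by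
      rw [← Real.exp_add]; congr 1; ring
    simp only [this]; ring
  have hI2 : IntegrableOn (fun u : ℝ => u ^ (-α) * Real.exp (-(l * u))) (Set.Ioo 0 s) :=
    hI.mono_set Set.Ioo_subset_Ioi_self
  rw [hfe]
  refine ⟨aux_refl_on _ s (hI2.const_mul _), ?_⟩
  rw [aux_refl_int (fun u : ℝ => Real.exp (l * s) * (u ^ (-α) * Real.exp (-(l * u)))) s,
    integral_const_mul]
  have hle : ∫ u in Set.Ioo (0:ℝ) s, u ^ (-α) * Real.exp (-(l * u)) ≤
      l ^ (-(1 - α)) * Real.Gamma (1 - α) := by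
    have e := Real.integral_rpow_mul_exp_neg_mul_Ioi (a := 1 - α) (r := l)
      (by linarith [hα.2]) hl0
    have e2 : (1 / l) ^ (1 - α) = l ^ (-(1 - α)) := by
      rw [one_div, Real.inv_rpow hl0.le, Real.rpow_neg hl0.le]
    rw [e2] at e
    rw [← e, show (1 - α - 1 : ℝ) = -α by ring]
    refine setIntegral_mono_set hI ?_ (Set.Ioo_subset_Ioi_self.eventuallyLE)
    filter_upwards [ae_restrict_mem measurableSet_Ioi] with u hu
    exact mul_nonneg (Real.rpow_nonneg (le_of_lt hu) _) (Real.exp_pos _).le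
  have hE := Real.exp_pos (l * s)
  calc _ = Real.exp (l * s) * (K * ∫ u in Set.Ioo (0:ℝ) s, u ^ (-α) * Real.exp (-(l * u))) := by
        ring
    _ ≤ Real.exp (l * s) * (K * (l ^ (-(1 - α)) * Real.Gamma (1 - α))) := by gcongr
    _ ≤ Real.exp (l * s) * 1 := by gcongr
    _ = _ := mul_one _

lemma aux_fl {h : ℝ} (hh : 0 < h) (r : ℝ) : fl h r ≤ r ∧ r < fl h r + h := by
  unfold fl
  have h1 := Int.floor_le (r / h)
  have h2 := Int.lt_floor_add_one (r / h)
  rw [le_div_iff₀ hh] at h1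
  rw [div_lt_iff₀ hh] at h2
  constructor <;> linarith

lemma aux_fl_nonneg {h : ℝ} (hh : 0 < h) {r : ℝ} (hr : 0 ≤ r) : 0 ≤ fl h r := by
  unfold fl
  have : (0:ℤ) ≤ ⌊r / h⌋ := Int.floor_nonneg.2 (by positivity)
  have : (0:ℝ) ≤ ⌊r / h⌋ := by exact_mod_cast this
  positivity

lemma aux_ind {h : ℝ} (hh : 0 < h) (t : ℝ) (Q : ℝ → Prop)
    (step : ∀ s ∈ Set.Icc 0 t, (∀ r ∈ Set.Ioo 0 s, Q (fl h r)) → Q s) :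
    ∀ s ∈ Set.Icc 0 t, Q s := by
  have key : ∀ k : ℕ, ∀ s ∈ Set.Icc 0 t, s ≤ k * h → Q s := by
    intro k
    induction k with
    | zero =>
      intro s hs hsk
      refine step s hs fun r hr => ?_
      simp at hsk
      linarith [hr.1, hr.2]
    | succ k ih =>
      intro s hs hsk
      refine step s hs fun r hr => ih _ ⟨aux_fl_nonneg hh hr.1.le, ?_⟩ ?_
      · linarith [(aux_fl hh r).1, hr.2, hs.2]
      · have h1 : r / h < (k + 1 : ℤ) := by
          rw [div_lt_iff₀ hh]; push_cast at hsk ⊢; linarith [hr.2]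
        have h2 : ⌊r / h⌋ < (k + 1 : ℤ) := Int.floor_lt.2 h1
        have h3 : (⌊r / h⌋ : ℝ) ≤ k := by exact_mod_cast Int.lt_add_one_iff.1 h2
        unfold fl
        nlinarith
  intro s hs
  obtain ⟨k, hk⟩ := exists_nat_ge (s / h)
  exact key k s hs ((div_le_iff₀ hh).1 hk)

/-- pathwise convergence and non-explosion (Lemma 2.2 of the paper). -/
theorem stmt1 {V W : Type*}
    [NormedAddCommGroup V] [NormedSpace ℝ V] [CompleteSpace V]
    [TopologicalSpace.SeparableSpace V]
    [NormedAddCommGroup W] [NormedSpace ℝ W] [CompleteSpace W]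
    (T χ : ℝ) (hT : 0 < T) (hχ : 0 < χ)
    (J : Set ℝ) (hJ : J ⊆ Set.Icc 0 T) (hJconv : Convex ℝ J) (hJ0 : (0:ℝ) ∈ J)
    (F : V → W) (hFc : Continuous F)
    -- `Ψ(r) < ∞` for every `r ∈ [0,∞)`:
    (hΨ : ∀ r : ℝ, 0 ≤ r → ∃ L : ℝ, ∀ v w : V, ‖v‖ + ‖w‖ ≤ r → ‖F v - F w‖ ≤ L * ‖v - w‖)
    (S : ℝ → W →L[ℝ] V)
    (hSmeas : Measurable fun s : Set.Ioo (0:ℝ) T => S ↑s)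
    (α : ℝ) (hα : α ∈ Set.Ico (0:ℝ) 1)
    (P : ℕ → V →L[ℝ] V)
    (hSbound : ∃ C : ℝ, ∀ s ∈ Set.Ioo (0:ℝ) T, s ^ α * ‖S s‖ ≤ C)
    (hPbound : ∃ C : ℝ, ∀ᶠ m in Filter.atTop, ‖P m‖ ≤ C)
    (hPS : Filter.Tendsto
      (fun m => ∫ s in Set.Ioo (0:ℝ) T, ‖(ContinuousLinearMap.id ℝ V - P m).comp (S s)‖)
      Filter.atTop (nhds 0))
    (O : ℝ → V) (hO : ContinuousOn O (Set.Icc 0 T))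
    (𝒪 : ℕ → ℝ → V)
    (h𝒪 : ∀ δ > (0:ℝ), ∀ᶠ m in Filter.atTop, ∀ s ∈ Set.Icc (0:ℝ) T, ‖O s - 𝒪 m s‖ ≤ δ)
    (h : ℕ → ℝ) (hpos : ∀ n, 0 < h n) (hh : Filter.Tendsto h Filter.atTop (nhds 0))
    (X : ℝ → V) (hXc : ContinuousOn X J)
    (𝒳 : ℕ → ℝ → V)
    (hXint : ∀ t ∈ J, IntegrableOn (fun s => S (t - s) (F (X s))) (Set.Ioo 0 t))
    (hX : ∀ t ∈ J, X t = (∫ s in Set.Ioo (0:ℝ) t, S (t - s) (F (X s))) + O t)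
    (h𝒳int : ∀ n : ℕ, ∀ t ∈ Set.Icc (0:ℝ) T,
      IntegrableOn
        (fun s => if ‖𝒳 n (fl (h n) s)‖ + ‖𝒪 n (fl (h n) s)‖ ≤ h n ^ (-χ)
          then P n (S (t - s) (F (𝒳 n (fl (h n) s)))) else 0)
        (Set.Ioo 0 t))
    (h𝒳 : ∀ n : ℕ, ∀ t ∈ Set.Icc (0:ℝ) T,
      𝒳 n t = (∫ s in Set.Ioo (0:ℝ) t,
          if ‖𝒳 n (fl (h n) s)‖ + ‖𝒪 n (fl (h n) s)‖ ≤ h n ^ (-χ)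
          then P n (S (t - s) (F (𝒳 n (fl (h n) s)))) else 0) + 𝒪 n t)
    (hbdd : ∃ C : ℝ, ∃ᶠ m in Filter.atTop, ∀ s ∈ J, ‖𝒳 m s‖ ≤ C) :
    (∀ t ∈ J, ∀ δ > (0:ℝ), ∀ᶠ n in Filter.atTop, ∀ s ∈ Set.Icc 0 t, ‖X s - 𝒳 n s‖ ≤ δ) ∧
    ∃ C : ℝ, ∀ s ∈ J, ‖X s‖ ≤ C := by
  have hA : ∀ t ∈ J, ∀ δ > (0:ℝ), ∀ᶠ n in Filter.atTop, ∀ s ∈ Set.Icc 0 t,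
      ‖X s - 𝒳 n s‖ ≤ δ := by
    intro t ht δ hδ
    have htT : t ≤ T := (hJ ht).2
    have hsub : Set.Icc 0 t ⊆ J := hJconv.ordConnected.out hJ0 ht
    have hXc' : ContinuousOn X (Set.Icc 0 t) := hXc.mono hsub
    obtain ⟨R, hR⟩ := isCompact_Icc.exists_bound_of_continuousOn hXc'
    obtain ⟨M, hM⟩ := isCompact_Icc.exists_bound_of_continuousOn
      (hFc.comp_continuousOn hXc')
    obtain ⟨RO, hRO⟩ := isCompact_Icc.exists_bound_of_continuousOn hO
    have h0t : (0:ℝ) ∈ Set.Icc 0 t := ⟨le_rfl, (hJ ht).1⟩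
    have hR0 : 0 ≤ R := (norm_nonneg _).trans (hR 0 h0t)
    have hM0 : 0 ≤ M := (norm_nonneg _).trans (hM 0 h0t)
    obtain ⟨L', hL'⟩ := hΨ (2 * R + 1) (by linarith)
    obtain ⟨L, hL0, hL⟩ : ∃ L : ℝ, 0 ≤ L ∧
        ∀ v w : V, ‖v‖ + ‖w‖ ≤ 2 * R + 1 → ‖F v - F w‖ ≤ L * ‖v - w‖ :=
      ⟨max L' 0, le_max_right _ _, fun v w hvw => (hL' v w hvw).trans
        (mul_le_mul_of_nonneg_right (le_max_left _ _) (norm_nonneg _))⟩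
    obtain ⟨C', hC'⟩ := hSbound
    obtain ⟨C, hC0, hC⟩ : ∃ C : ℝ, 0 ≤ C ∧ ∀ s ∈ Set.Ioo (0:ℝ) T, ‖S s‖ ≤ C * s ^ (-α) := by
      refine ⟨max C' 0, le_max_right _ _, fun s hs => ?_⟩
      have hp : 0 < s ^ α := Real.rpow_pos_of_pos hs.1 _
      rw [Real.rpow_neg hs.1.le, ← div_eq_mul_inv, le_div_iff₀ hp, mul_comm]
      exact (hC' s hs).trans (le_max_left _ _)
    obtain ⟨B', hB'⟩ := hPbound
    obtain ⟨B, hB0, hB⟩ : ∃ B : ℝ, 0 ≤ B ∧ ∀ᶠ m in Filter.atTop, ‖P m‖ ≤ B :=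
      ⟨max B' 0, le_max_right _ _, hB'.mono fun m hm => hm.trans (le_max_left _ _)⟩
    obtain ⟨l, hl0, hl⟩ := aux_kernel α (5 * (B * C * L)) hα (by positivity)
    obtain ⟨ε, hε0, hε1, hεδ⟩ : ∃ ε : ℝ, 0 < ε ∧ 4 * ε * Real.exp (l * T) ≤ 1 ∧
        4 * ε * Real.exp (l * T) ≤ δ := by
      have hE := Real.exp_pos (l * T)
      refine ⟨min δ 1 / (4 * Real.exp (l * T)), by positivity, ?_, ?_⟩
      · have : 4 * (min δ 1 / (4 * Real.exp (l * T))) * Real.exp (l * T) = min δ 1 := by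
          field_simp
        rw [this]; exact min_le_right _ _
      · have : 4 * (min δ 1 / (4 * Real.exp (l * T))) * Real.exp (l * T) = min δ 1 := by
          field_simp
        rw [this]; exact min_le_left _ _
    -- uniform continuity
    obtain ⟨η, hη0, hη⟩ := Metric.uniformContinuousOn_iff.1
      (isCompact_Icc.uniformContinuousOn_of_continuous hXc') ε hε0
    have hPS' : ∀ᶠ n in Filter.atTop, M * (∫ s in Set.Ioo (0:ℝ) T,
        ‖(ContinuousLinearMap.id ℝ V - P n).comp (S s)‖) < ε := by
      have := hPS.const_mul M
      rw [mul_zero] at this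
      exact this.eventually (gt_mem_nhds hε0)
    have hhχ : ∀ᶠ n in Filter.atTop, R + 1 + (RO + 1) ≤ h n ^ (-χ) := by
      have h1 : Filter.Tendsto h Filter.atTop (nhdsWithin 0 (Set.Ioi 0)) :=
        tendsto_nhdsWithin_iff.2 ⟨hh, Filter.Eventually.of_forall hpos⟩
      have h2 := (tendsto_rpow_atTop hχ).comp (tendsto_inv_nhdsGT_zero.comp h1)
      filter_upwards [h2.eventually_ge_atTop (R + 1 + (RO + 1))] with n hn
      simp only [Function.comp] at hn
      rwa [Real.inv_rpow (hpos n).le, ← Real.rpow_neg (hpos n).le] at hn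
    filter_upwards [hPS', hhχ, hB, h𝒪 ε hε0, h𝒪 1 one_pos, hh.eventually (gt_mem_nhds hη0)] with
      n hn1 hn2 hn3 hn4 hn5 hn6
    have hmain : ∀ s ∈ Set.Icc 0 t, ‖X s - 𝒳 n s‖ ≤ 4 * ε * Real.exp (l * s) := by
      refine aux_ind (hpos n) t _ fun s hs IH => ?_
      have hsT : s ∈ Set.Icc 0 T := ⟨hs.1, hs.2.trans htT⟩
      have hgint : IntegrableOn (fun u => ‖(ContinuousLinearMap.id ℝ V - P n).comp (S u)‖)
          (Set.Ioo 0 T) := by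
        have hk : IntegrableOn (fun u : ℝ => ‖ContinuousLinearMap.id ℝ V - P n‖ *
            (C * u ^ (-α))) (Set.Ioo 0 T) := by
          refine Integrable.const_mul (Integrable.const_mul ?_ _) _
          have : IntervalIntegrable (fun u : ℝ => u ^ (-α)) volume 0 T :=
            intervalIntegral.intervalIntegrable_rpow' (by linarith [hα.2])
          exact ((intervalIntegrable_iff_integrableOn_Ioo_of_le hT.le).1 this)
        refine Integrable.mono' hk ?_ ?_
        · have hm : Measurable fun s : Set.Ioo (0:ℝ) T =>
              ‖(ContinuousLinearMap.id ℝ V - P n).comp (S s)‖ := by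
            have hc : Continuous fun A : W →L[ℝ] V =>
                ‖(ContinuousLinearMap.id ℝ V - P n).comp A‖ :=
              (continuous_const.clm_comp continuous_id).norm
            exact hc.measurable.comp hSmeas
          have := (aemeasurable_restrict_iff_comap_subtype (μ := volume) measurableSet_Ioo
            (f := fun u => ‖(ContinuousLinearMap.id ℝ V - P n).comp (S u)‖)).2 hm.aemeasurable
          exact this.aestronglyMeasurable
        · filter_upwards [ae_restrict_mem measurableSet_Ioo] with u hu
          rw [norm_norm]
          exact (ContinuousLinearMap.opNorm_comp_le _ _).trans
            (mul_le_mul_of_nonneg_left (hC u hu) (norm_nonneg _))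
      have hgs : IntegrableOn (fun u => ‖(ContinuousLinearMap.id ℝ V - P n).comp (S u)‖)
          (Set.Ioo 0 s) := hgint.mono_set (Set.Ioo_subset_Ioo_right hsT.2)
      have hgr := aux_refl_on _ s hgs
      obtain ⟨hk1, hk2⟩ := hl s
      have hnorm : ‖∫ r in Set.Ioo (0:ℝ) s, (S (s - r) (F (X r)) -
          if ‖𝒳 n (fl (h n) r)‖ + ‖𝒪 n (fl (h n) r)‖ ≤ h n ^ (-χ)
          then P n (S (s - r) (F (𝒳 n (fl (h n) r)))) else 0)‖ ≤
          ∫ r in Set.Ioo (0:ℝ) s, (M * ‖(ContinuousLinearMap.id ℝ V - P n).comp (S (s - r))‖ +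
            ε * (5 * (B * C * L)) * ((s - r) ^ (-α) * Real.exp (l * r))) := by
        refine norm_integral_le_of_norm_le ((hgr.const_mul M).add (hk1.const_mul _)) ?_
        filter_upwards [ae_restrict_mem measurableSet_Ioo] with r hr
        have hfl := aux_fl (hpos n) r
        have hfl0 := aux_fl_nonneg (hpos n) hr.1.le
        have hrt : r ∈ Set.Icc 0 t := ⟨hr.1.le, hr.2.le.trans hs.2⟩
        have hft : fl (h n) r ∈ Set.Icc 0 t := ⟨hfl0, hfl.1.trans hrt.2⟩
        have hIH := IH r hr
        set q := fl (h n) r with hq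
        have hIH1 : ‖X q - 𝒳 n q‖ ≤ 4 * ε * Real.exp (l * r) := by
          refine hIH.trans ?_
          gcongr
          exact hfl.1
        have hIH2 : ‖X q - 𝒳 n q‖ ≤ 1 := by
          refine hIH.trans (le_trans ?_ hε1)
          gcongr
          exact hft.2.trans htT
        have hXq := hR q hft
        have h𝒳q : ‖𝒳 n q‖ ≤ R + 1 := by
          have : ‖𝒳 n q‖ ≤ ‖X q‖ + ‖X q - 𝒳 n q‖ := by
            have := norm_sub_le (X q) (X q - 𝒳 n q)
            simpa using this
          linarith
        have hqT : q ∈ Set.Icc 0 T := ⟨hft.1, hft.2.trans htT⟩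
        have h𝒪q : ‖𝒪 n q‖ ≤ RO + 1 := by
          have : ‖𝒪 n q‖ ≤ ‖O q‖ + ‖O q - 𝒪 n q‖ := by
            have := norm_sub_le (O q) (O q - 𝒪 n q)
            simpa using this
          linarith [hRO q hqT, hn5 q hqT]
        rw [if_pos (by linarith)]
        have hsplit : S (s - r) (F (X r)) - P n (S (s - r) (F (𝒳 n q))) =
            ((ContinuousLinearMap.id ℝ V - P n).comp (S (s - r))) (F (X r)) +
            P n (S (s - r) ((F (X r) - F (X q)) + (F (X q) - F (𝒳 n q)))) := by
          simp
        have hb1 : ‖((ContinuousLinearMap.id ℝ V - P n).comp (S (s - r))) (F (X r))‖ ≤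
            M * ‖(ContinuousLinearMap.id ℝ V - P n).comp (S (s - r))‖ := by
          refine (ContinuousLinearMap.le_opNorm _ _).trans ?_
          rw [mul_comm]
          exact mul_le_mul_of_nonneg_right (hM r hrt) (norm_nonneg _)
        have hE1 : 1 ≤ Real.exp (l * r) := Real.one_le_exp (mul_nonneg hl0.le hr.1.le)
        have hb2 : ‖F (X r) - F (X q)‖ ≤ L * (ε * Real.exp (l * r)) := by
          refine (hL _ _ (by linarith [hR r hrt])).trans ?_
          gcongr
          have hd : dist r q < η := by
            rw [Real.dist_eq, abs_of_nonneg (by linarith)]; linarith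
          have := hη r hrt q hft hd
          rw [dist_eq_norm] at this
          nlinarith
        have hb3 : ‖F (X q) - F (𝒳 n q)‖ ≤ L * (4 * ε * Real.exp (l * r)) := by
          refine (hL _ _ (by linarith)).trans ?_
          gcongr
        have hb4 : ‖(F (X r) - F (X q)) + (F (X q) - F (𝒳 n q))‖ ≤
            L * (5 * ε * Real.exp (l * r)) := by
          refine (norm_add_le _ _).trans ?_
          linarith
        have hSr := hC (s - r) ⟨by linarith [hr.2], by linarith [hr.1, hsT.2]⟩
        have hb5 : ‖P n (S (s - r) ((F (X r) - F (X q)) + (F (X q) - F (𝒳 n q))))‖ ≤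
            B * ((C * (s - r) ^ (-α)) * (L * (5 * ε * Real.exp (l * r)))) := by
          refine (ContinuousLinearMap.le_of_opNorm_le _ hn3 _).trans ?_
          refine mul_le_mul_of_nonneg_left ?_ hB0
          refine (ContinuousLinearMap.le_of_opNorm_le _ hSr _).trans ?_
          exact mul_le_mul_of_nonneg_left hb4 ((norm_nonneg _).trans hSr)
        rw [hsplit]
        refine (norm_add_le _ _).trans (add_le_add hb1 (hb5.trans (le_of_eq ?_)))
        ring
      have hI1 : ∫ r in Set.Ioo (0:ℝ) s, ‖(ContinuousLinearMap.id ℝ V - P n).comp (S (s - r))‖ ≤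
          ∫ u in Set.Ioo (0:ℝ) T, ‖(ContinuousLinearMap.id ℝ V - P n).comp (S u)‖ := by
        rw [aux_refl_int (fun u => ‖(ContinuousLinearMap.id ℝ V - P n).comp (S u)‖) s]
        refine setIntegral_mono_set hgint (Filter.Eventually.of_forall fun _ => norm_nonneg _)
          (Set.Ioo_subset_Ioo_right hsT.2).eventuallyLE
      rw [integral_add (hgr.const_mul M) (hk1.const_mul _), integral_const_mul,
        integral_const_mul] at hnorm
      have hE1 : 1 ≤ Real.exp (l * s) := Real.one_le_exp (mul_nonneg hl0.le hs.1)
      have hdiff : X s - 𝒳 n s = (∫ r in Set.Ioo (0:ℝ) s, (S (s - r) (F (X r)) -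
          if ‖𝒳 n (fl (h n) r)‖ + ‖𝒪 n (fl (h n) r)‖ ≤ h n ^ (-χ)
          then P n (S (s - r) (F (𝒳 n (fl (h n) r)))) else 0)) + (O s - 𝒪 n s) := by
        rw [integral_sub (hXint s (hsub hs)) (h𝒳int n s hsT), hX s (hsub hs), h𝒳 n s hsT]
        abel
      rw [hdiff]
      refine (norm_add_le _ _).trans ?_
      have a1 := hn4 s hsT
      have a2 := mul_le_mul_of_nonneg_left hI1 hM0
      have a3 := mul_le_mul_of_nonneg_left hk2 hε0.le
      have a4 : ε ≤ ε * Real.exp (l * s) := le_mul_of_one_le_right hε0.le hE1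
      linarith
    intro s hs
    refine (hmain s hs).trans (le_trans ?_ hεδ)
    gcongr
    exact hs.2.trans htT
  refine ⟨hA, ?_⟩
  obtain ⟨C, hC⟩ := hbdd
  refine ⟨C + 1, fun s hs => ?_⟩
  obtain ⟨n, hn1, hn2⟩ := (hC.and_eventually (hA s hs 1 one_pos)).exists
  have h1 := hn1 s hs
  have h2 := hn2 s ⟨(hJ hs).1, le_rfl⟩
  have h3 := norm_add_le (X s - 𝒳 n s) (𝒳 n s)
  rw [sub_add_cancel] at h3
  linarith
end

section
/- Let T, ϑ, c ∈ (0,∞), θ, ε ∈ [0,∞), α ∈ [0,1/2], φ ∈ [0,1), γ ∈ (0,1), ρ ∈ [−α, 1−max{α,γ}), ϱ ∈ (ρ, 1−max{α,γ}), χ ∈ (0, min{(ϱ−ρ)/(1+ϑ), (1−α−ρ)/(1+2ϑ)}]. Let F : H_ϱ → H_{−α} be continuous; let (ℍ_n)_{n∈ℕ} be finite subsets of I with liminf_{m→∞} inf({λ_i : i ∈ I∖ℍ_m} ∪ {∞}) = ∞, and P_n := P_{ℍ_n}; let φ̂, Φ : H_1 → [0,∞) be functions such that for all n ∈ ℕ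 and all v, w ∈ P_n(H): F(v) ∈ H, ‖F(v)‖_{H_{−γ}} ≤ c(2ε + ‖v‖_H²), ⟨v, P_n F(v+w)⟩_H ≤ φ̂(w)·‖v‖_H² + φ·‖(η−A)^{1/2} v‖_H² + Φ(w), and ‖F(v)−F(w)‖_{H_{−α}} ≤ θ·(1 + ‖v‖_{H_ρ}^{ϑ} + ‖w‖_{H_ρ}^{ϑ})·‖v−w‖_{H_ρ}. Let (h_n)_{n∈ℕ} ⊆ (0,T] with lim_{m→∞} h_m = 0. Let (Ω, 𝓕, P) be a probability space, let 𝒳ⁿ : [0,T] × Ω → H_ϱ (n ∈ ℕ) be stochastic processes, let 𝒪ⁿ : [0,T] × Ω → H_ϱ (n ∈ ℕ) and O : [0,T] × Ω → H_ϱ be stochastic processes with continuous sample paths, and let 𝕏ⁿ, 𝕆ⁿ : [0,T] × Ω → H_ϱ (n ∈ ℕ) be functions such that for all n ∈ ℕ, t ∈ [0,T], ω ∈ Ω: 𝕏ⁿ_t(ω) = ∫₀ᵗ P_n e^{(t−s)A} · 1_{{‖𝒳ⁿ_{⌊s⌋_{h_n}}(ω)‖_{H_ϱ} + ‖𝒪ⁿ_{⌊s⌋_{h_n}}(ω)‖_{H_ϱ}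 ≤ h_n^{−χ}}} · F(𝒳ⁿ_{⌊s⌋_{h_n}}(ω)) ds + 𝒪ⁿ_t(ω); 𝒪ⁿ([0,T] × Ω) ⊆ P_n(H); 𝕆ⁿ_t(ω) = 𝒪ⁿ_t(ω) − ∫₀ᵗ e^{(t−s)(A−η)} (η 𝒪ⁿ_s(ω)) ds; and P(𝕏ⁿ_t = 𝒳ⁿ_t) = 1. Assume there exists Ω₀ ∈ 𝓕 with P(Ω₀) = 1 such that for every ω ∈ Ω₀: liminf_{m→∞} ∫₀ᵀ exp(∫_r^T 2·φ̂(𝕆ᵐ_{⌊u⌋_{h_m}}(ω)) du) · [1 + Φ(𝕆ᵐ_{⌊r⌋_{h_m}}(ω)) + ∫₀ᵀ ‖𝒪ᵐ_u(ω)‖_{H_ϱ}^{4+4ϑ} du + ‖𝕆ᵐ_r(ω)‖_H²] dr < ∞ and limsup_{m→∞} sup_{t∈[0,T]} ‖O_t(ω) − 𝒪ᵐ_t(ω)‖_{H_ϱ} = 0. Then: (i) there exists a stochastic process X : [0,T] × Ω → H_ϱ with continuous sample paths, unique up to indistinguishability, such that for every t ∈ [0,T] it holds P-a.s. that X_t =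 ∫₀ᵗ e^{(t−s)A} F(X_s) ds + O_t; and (ii) there exists Ω₁ ∈ 𝓕 with P(Ω₁) = 1 such that for every ω ∈ Ω₁: limsup_{n→∞} sup_{t∈[0,T]} ‖X_t(ω) − 𝕏ⁿ_t(ω)‖_{H_ϱ} = 0. -/
open MeasureTheory

/-- The norm of the weighted `ℓ²`-space `H_r` associated to `κ - A`,
`‖f‖_{H_r} = (Σ_i (κ+λ_i)^{2r} f(i)²)^{1/2}`. -/
noncomputable def wnorm {I : Type*} (κ : ℝ) (lam : I → ℝ) (r : ℝ) (f : I → ℝ) : ℝ :=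
  Real.sqrt (∑' i, (κ + lam i) ^ (2 * r) * f i ^ 2)

/-- Membership `f ∈ H_r`. -/
def memW {I : Type*} (κ : ℝ) (lam : I → ℝ) (r : ℝ) (f : I → ℝ) : Prop :=
  Summable fun i => (κ + lam i) ^ (2 * r) * f i ^ 2

/-- `X ∈ C([0,T], H_r)`. -/
def ContPathW {I : Type*} (κ : ℝ) (lam : I → ℝ) (r T : ℝ) (X : ℝ → I → ℝ) : Prop :=
  (∀ t ∈ Set.Icc (0:ℝ) T, memW κ lam r (X t)) ∧
  ∀ t ∈ Set.Icc (0:ℝ) T, ∀ ε > (0:ℝ), ∃ δ > (0:ℝ), ∀ s ∈ Set.Icc (0:ℝ) T,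
    |s - t| ≤ δ → wnorm κ lam r (X s - X t) ≤ ε

/-- `X` is a stochastic process with values in `H_r` (coordinatewise measurability
in `ω`). -/
def IsProcW {I Ω : Type*} [MeasurableSpace Ω] (T : ℝ) (X : ℝ → Ω → I → ℝ) : Prop :=
  ∀ t ∈ Set.Icc (0:ℝ) T, ∀ i, Measurable fun ω => X t ω i

/-- `X` is a stochastic process with continuous sample paths in `H_ϱ` which
satisfies, for every `t ∈ [0,T]`, `P`-a.s. the mild equation
`X_t = ∫₀ᵗ e^{(t-s)A} F(X_s) ds + O_t` (coordinatewise in the diagonal setting). -/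
def IsMildSolP {I Ω : Type*} [MeasurableSpace Ω] (P : Measure Ω)
    (κ : ℝ) (lam : I → ℝ) (ϱ T : ℝ)
    (F : (I → ℝ) → I → ℝ) (O : ℝ → Ω → I → ℝ) (X : ℝ → Ω → I → ℝ) : Prop :=
  IsProcW T X ∧
  (∀ ω, ContPathW κ lam ϱ T fun t => X t ω) ∧
  ∀ t ∈ Set.Icc (0:ℝ) T,
    P {ω | ∀ i, X t ω i =
      (∫ s in (0:ℝ)..t, Real.exp (-((t - s) * lam i)) * F (X s ω) i) + O t ω i} = 1



/-- `f ∈ H_r` with norm at most `K`. -/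
def wle {I : Type*} (κ : ℝ) (lam : I → ℝ) (r : ℝ) (f : I → ℝ) (K : ℝ) : Prop :=
  memW κ lam r f ∧ wnorm κ lam r f ≤ K

section basics
variable {I : Type*} {κ : ℝ} {lam : I → ℝ}

lemma wnorm_nonneg' (r : ℝ) (f : I → ℝ) : 0 ≤ wnorm κ lam r f := Real.sqrt_nonneg _

lemma wle.nonneg {r : ℝ} {f : I → ℝ} {K : ℝ} (h : wle κ lam r f K) : 0 ≤ K :=
  (wnorm_nonneg' r f).trans h.2

lemma wterm (hμ : ∀ i, 0 < κ + lam i) (r : ℝ) (f : I → ℝ) (i : I) :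
    (κ + lam i) ^ (2 * r) * f i ^ 2 = ((κ + lam i) ^ r * f i) ^ 2 := by
  rw [mul_pow, ← Real.rpow_natCast ((κ + lam i) ^ r) 2, ← Real.rpow_mul (hμ i).le]
  congr 2; push_cast; ring

lemma wle_iff (hμ : ∀ i, 0 < κ + lam i) {r : ℝ} {f : I → ℝ} {K : ℝ} (hK : 0 ≤ K) :
    wle κ lam r f K ↔ ∀ S : Finset I, ∑ i ∈ S, ((κ + lam i) ^ r * f i) ^ 2 ≤ K ^ 2 := by
  unfold wle memW wnorm
  simp only [wterm hμ]
  constructor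
  · rintro ⟨h1, h2⟩ S
    have h3 := h1.sum_le_tsum S (fun i _ => sq_nonneg _)
    refine h3.trans ?_
    rwa [Real.sqrt_le_left hK] at h2
  · intro h
    have h0 : (0 : I → ℝ) ≤ fun i => ((κ + lam i) ^ r * f i) ^ 2 := fun i => sq_nonneg _
    refine ⟨summable_of_sum_le h0 h, ?_⟩
    rw [Real.sqrt_le_left hK]
    exact Real.tsum_le_of_sum_le h0 h

lemma memW.wle {r : ℝ} {f : I → ℝ} (h : memW κ lam r f) : wle κ lam r f (wnorm κ lam r f) :=
  ⟨h, le_rfl⟩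

lemma wle.mono {r : ℝ} {f : I → ℝ} {K K' : ℝ} (h : wle κ lam r f K) (hK : K ≤ K') :
    wle κ lam r f K' := ⟨h.1, h.2.trans hK⟩

lemma wle.fin (hμ : ∀ i, 0 < κ + lam i) {r : ℝ} {f : I → ℝ} {K : ℝ} (h : wle κ lam r f K)
    (S : Finset I) : ∑ i ∈ S, ((κ + lam i) ^ r * f i) ^ 2 ≤ K ^ 2 :=
  (wle_iff hμ h.nonneg).1 h S

lemma wle.coord (hμ : ∀ i, 0 < κ + lam i) {r : ℝ} {f : I → ℝ} {K : ℝ} (h : wle κ lam r f K)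
    (i : I) : (κ + lam i) ^ r * |f i| ≤ K := by
  have := h.fin hμ {i}
  rw [Finset.sum_singleton] at this
  have h2 := abs_le_of_sq_le_sq this h.nonneg
  have h3 : (κ + lam i) ^ r * |f i| = |(κ + lam i) ^ r * f i| := by
    rw [abs_mul, abs_of_nonneg (Real.rpow_nonneg (hμ i).le r)]
  rw [h3]; exact h2

lemma wle.coord' (hμ : ∀ i, 0 < κ + lam i) {r : ℝ} {f : I → ℝ} {K : ℝ} (h : wle κ lam r f K)
    (i : I) : |f i| ≤ (κ + lam i) ^ (-r) * K := by
  have h1 := h.coord hμ i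
  have h2 : 0 < (κ + lam i) ^ r := Real.rpow_pos_of_pos (hμ i) r
  rw [Real.rpow_neg (hμ i).le]
  rw [inv_mul_eq_div, le_div_iff₀ h2]; linarith

lemma wle.zero_of (hμ : ∀ i, 0 < κ + lam i) {r : ℝ} {f : I → ℝ} (h : wle κ lam r f 0) : f = 0 := by
  funext i
  have := h.coord' hμ i
  simpa using this

lemma wle.add (hμ : ∀ i, 0 < κ + lam i) {r : ℝ} {f g : I → ℝ} {K K' : ℝ}
    (h : wle κ lam r f K) (h' : wle κ lam r g K') : wle κ lam r (f + g) (K + K') := by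
  have hK := h.nonneg
  have hK' := h'.nonneg
  rw [wle_iff hμ (by positivity)]
  intro S
  have h1 := h.fin hμ S
  have h2 := h'.fin hμ S
  have h3 := Finset.sum_mul_sq_le_sq_mul_sq S (fun i => (κ + lam i) ^ r * f i)
    (fun i => (κ + lam i) ^ r * g i)
  have h4 : ∑ i ∈ S, ((κ + lam i) ^ r * f i) * ((κ + lam i) ^ r * g i) ≤ K * K' := by
    refine (le_abs_self _).trans (abs_le_of_sq_le_sq ?_ (by positivity))
    refine h3.trans ?_
    rw [mul_pow]
    exact mul_le_mul h1 h2 (Finset.sum_nonneg fun i _ => sq_nonneg _) (by positivity)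
  have h5 : ∑ i ∈ S, ((κ + lam i) ^ r * (f + g) i) ^ 2
      = ∑ i ∈ S, ((κ + lam i) ^ r * f i) ^ 2 + ∑ i ∈ S, ((κ + lam i) ^ r * g i) ^ 2
        + 2 * ∑ i ∈ S, ((κ + lam i) ^ r * f i) * ((κ + lam i) ^ r * g i) := by
    rw [Finset.mul_sum, ← Finset.sum_add_distrib, ← Finset.sum_add_distrib]
    refine Finset.sum_congr rfl fun i _ => ?_
    simp only [Pi.add_apply]; ring
  rw [h5]; nlinarith

/-- pointwise domination -/
lemma wle.of_abs (hμ : ∀ i, 0 < κ + lam i) {r r' : ℝ} {f g : I → ℝ} {K D : ℝ}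
    (h : wle κ lam r g K) (hD : 0 ≤ D)
    (hfg : ∀ i, (κ + lam i) ^ r' * |f i| ≤ D * ((κ + lam i) ^ r * |g i|)) :
    wle κ lam r' f (D * K) := by
  have hK := h.nonneg
  rw [wle_iff hμ (by positivity)]
  intro S
  have h1 := h.fin hμ S
  calc ∑ i ∈ S, ((κ + lam i) ^ r' * f i) ^ 2
      ≤ ∑ i ∈ S, D ^ 2 * ((κ + lam i) ^ r * g i) ^ 2 := by
        refine Finset.sum_le_sum fun i _ => ?_
        have e1 : ((κ + lam i) ^ r' * f i) ^ 2 = ((κ + lam i) ^ r' * |f i|) ^ 2 := by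
          rw [mul_pow, mul_pow, sq_abs]
        have e2 : D ^ 2 * ((κ + lam i) ^ r * g i) ^ 2 = (D * ((κ + lam i) ^ r * |g i|)) ^ 2 := by
          rw [mul_pow, mul_pow, mul_pow, sq_abs]
        rw [e1, e2]
        exact pow_le_pow_left₀ (mul_nonneg (Real.rpow_nonneg (hμ i).le _) (abs_nonneg _)) (hfg i) 2
    _ = D ^ 2 * ∑ i ∈ S, ((κ + lam i) ^ r * g i) ^ 2 := by rw [Finset.mul_sum]
    _ ≤ (D * K) ^ 2 := by rw [mul_pow]; gcongr

lemma wle.dom (hμ : ∀ i, 0 < κ + lam i) {r : ℝ} {f g : I → ℝ} {K : ℝ}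
    (h : wle κ lam r g K) (hfg : ∀ i, |f i| ≤ |g i|) : wle κ lam r f K := by
  have := h.of_abs hμ (r' := r) (f := f) (D := 1) zero_le_one (fun i => by
    rw [one_mul]; exact mul_le_mul_of_nonneg_left (hfg i) (Real.rpow_nonneg (hμ i).le _))
  simpa using this

lemma wle.neg (hμ : ∀ i, 0 < κ + lam i) {r : ℝ} {f : I → ℝ} {K : ℝ}
    (h : wle κ lam r f K) : wle κ lam r (-f) K := h.dom hμ (fun i => by simp)

lemma wle.sub (hμ : ∀ i, 0 < κ + lam i) {r : ℝ} {f g : I → ℝ} {K K' : ℝ}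
    (h : wle κ lam r f K) (h' : wle κ lam r g K') : wle κ lam r (f - g) (K + K') := by
  rw [sub_eq_add_neg]; exact h.add hμ (h'.neg hμ)

lemma wle.symm (hμ : ∀ i, 0 < κ + lam i) {r : ℝ} {f g : I → ℝ} {K : ℝ}
    (h : wle κ lam r (f - g) K) : wle κ lam r (g - f) K := by
  have := h.neg hμ; rwa [neg_sub] at this

lemma wle.smul (hμ : ∀ i, 0 < κ + lam i) {r : ℝ} {f : I → ℝ} {K : ℝ} (a : ℝ)
    (h : wle κ lam r f K) : wle κ lam r (fun i => a * f i) (|a| * K) :=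
  h.of_abs hμ (abs_nonneg a) (fun i => by rw [abs_mul]; apply le_of_eq; ring)

lemma wle_zero (hμ : ∀ i, 0 < κ + lam i) (r : ℝ) {K : ℝ} (hK : 0 ≤ K) :
    wle κ lam r (0 : I → ℝ) K := by
  rw [wle_iff hμ hK]; intro S; simpa using sq_nonneg K

/-- change of regularity -/
lemma wle.embed {δ : ℝ} (hδ : 0 < δ) (hμ : ∀ i, δ ≤ κ + lam i) {r r' : ℝ} (hr : r' ≤ r)
    {f : I → ℝ} {K : ℝ} (h : wle κ lam r f K) : wle κ lam r' f (δ ^ (r' - r) * K) := by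
  have hμ' : ∀ i, 0 < κ + lam i := fun i => hδ.trans_le (hμ i)
  refine h.of_abs hμ' (Real.rpow_nonneg hδ.le _) (fun i => ?_)
  have h1 : (κ + lam i) ^ r' = (κ + lam i) ^ (r' - r) * (κ + lam i) ^ r := by
    rw [← Real.rpow_add (hμ' i)]; congr 1; ring
  have h2 : (κ + lam i) ^ (r' - r) ≤ δ ^ (r' - r) :=
    Real.rpow_le_rpow_of_nonpos hδ (hμ i) (by linarith)
  rw [h1, mul_assoc]
  exact mul_le_mul_of_nonneg_right h2
    (mul_nonneg (Real.rpow_nonneg (hμ' i).le _) (abs_nonneg _))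

/-- limits -/
lemma wle.lim (hμ : ∀ i, 0 < κ + lam i) {r : ℝ} {f : ℕ → I → ℝ} {g : I → ℝ} {K : ℝ}
    (h : ∀ᶠ n in Filter.atTop, wle κ lam r (f n) K)
    (hl : ∀ i, Filter.Tendsto (fun n => f n i) Filter.atTop (nhds (g i))) : wle κ lam r g K := by
  obtain ⟨n, hn⟩ := h.exists
  rw [wle_iff hμ hn.nonneg]
  intro S
  have : Filter.Tendsto (fun n => ∑ i ∈ S, ((κ + lam i) ^ r * f n i) ^ 2) Filter.atTop
      (nhds (∑ i ∈ S, ((κ + lam i) ^ r * g i) ^ 2)) :=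
    tendsto_finsetSum _ fun i _ => ((hl i).const_mul _).pow 2
  exact le_of_tendsto this (h.mono fun n hn => hn.fin hμ S)

lemma wle.of_forall (_hμ : ∀ i, 0 < κ + lam i) {r : ℝ} {f : I → ℝ} {K : ℝ}
    (h : ∀ e > (0:ℝ), wle κ lam r f (K + e)) : wle κ lam r f K :=
  ⟨(h 1 one_pos).1, le_of_forall_pos_le_add fun e he => (h e he).2⟩

lemma memW_fin (r : ℝ) {f : I → ℝ} (S : Finset I) (hf : ∀ i ∉ S, f i = 0) : memW κ lam r f := by
  refine summable_of_ne_finset_zero (s := S) (fun i hi => ?_)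
  rw [hf i hi]; simp

lemma wnorm_fin (r : ℝ) {f : I → ℝ} (S : Finset I) (hf : ∀ i ∉ S, f i = 0) :
    wnorm κ lam r f = Real.sqrt (∑ i ∈ S, (κ + lam i) ^ (2 * r) * f i ^ 2) := by
  unfold wnorm
  rw [tsum_eq_sum (s := S) (fun i hi => by rw [hf i hi]; simp)]

lemma wnorm_fin_zero {f : I → ℝ} (S : Finset I) (hf : ∀ i ∉ S, f i = 0) :
    wnorm κ lam 0 f ^ 2 = ∑ i ∈ S, f i ^ 2 := by
  rw [wnorm_fin 0 S hf, Real.sq_sqrt (Finset.sum_nonneg fun i _ => by simp; positivity)]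
  simp

lemma memW.sub (hμ : ∀ i, 0 < κ + lam i) {r : ℝ} {f g : I → ℝ} (hf : memW κ lam r f)
    (hg : memW κ lam r g) : memW κ lam r (f - g) := (hf.wle.sub hμ hg.wle).1

lemma wnorm_triangle (hμ : ∀ i, 0 < κ + lam i) {r : ℝ} {f g : I → ℝ} (hf : memW κ lam r f)
    (hg : memW κ lam r g) : |wnorm κ lam r f - wnorm κ lam r g| ≤ wnorm κ lam r (f - g) := by
  have h1 := ((hf.sub hμ hg).wle.add hμ hg.wle).2
  have h2 := ((hg.sub hμ hf).wle.add hμ hf.wle).2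
  have h3 := ((hf.sub hμ hg).wle.symm hμ).2
  rw [sub_add_cancel] at h1 h2
  rw [abs_le]; constructor <;> linarith

/-- Minkowski's integral inequality. -/
lemma wle.integral (hμ : ∀ i, 0 < κ + lam i) {r a b : ℝ} (hab : a ≤ b) {G : ℝ → I → ℝ}
    {B : ℝ → ℝ} (hG : ∀ i, IntervalIntegrable (fun s => G s i) volume a b)
    (hB : IntervalIntegrable B volume a b)
    (h : ∀ s ∈ Set.Ioo a b, wle κ lam r (G s) (B s)) :
    wle κ lam r (fun i => ∫ s in a..b, G s i) (∫ s in a..b, B s) := by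
  have hB0 : 0 ≤ ∫ s in a..b, B s := by
    rw [intervalIntegral.integral_of_le hab, integral_Ioc_eq_integral_Ioo]
    exact setIntegral_nonneg measurableSet_Ioo fun s hs => (h s hs).nonneg
  rw [wle_iff hμ hB0]
  intro S
  set w : I → ℝ := fun i => (κ + lam i) ^ r
  set u : I → ℝ := fun i => ∫ s in a..b, G s i
  set N := ∑ i ∈ S, (w i * u i) ^ 2 with hN
  have hN0 : 0 ≤ N := Finset.sum_nonneg fun i _ => sq_nonneg _
  have key : N ≤ Real.sqrt N * ∫ s in a..b, B s := by
    have e1 : N = ∫ s in a..b, ∑ i ∈ S, (w i * u i) * (w i * G s i) := by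
      rw [intervalIntegral.integral_finsetSum
        (fun i _ => ((hG i).const_mul (w i)).const_mul (w i * u i))]
      refine Finset.sum_congr rfl fun i _ => ?_
      rw [intervalIntegral.integral_const_mul, intervalIntegral.integral_const_mul]
      ring
    rw [← intervalIntegral.integral_const_mul]
    conv_lhs => rw [e1]
    refine intervalIntegral.integral_mono_on_of_le_Ioo hab ?_ (hB.const_mul _) ?_
    · have := IntervalIntegrable.sum S (f := fun i s => (w i * u i) * (w i * G s i))
        (fun i _ => ((hG i).const_mul (w i)).const_mul (w i * u i))
      have e : (∑ i ∈ S, fun s => w i * u i * (w i * G s i))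
          = fun s => ∑ i ∈ S, w i * u i * (w i * G s i) := by funext s; simp
      rw [e] at this; exact this
    · intro s hs
      have h1 := (h s hs).fin hμ S
      have h3 := Finset.sum_mul_sq_le_sq_mul_sq S (fun i => w i * u i) (fun i => w i * G s i)
      refine (le_abs_self _).trans (abs_le_of_sq_le_sq ?_
        (mul_nonneg (Real.sqrt_nonneg _) (h s hs).nonneg))
      refine h3.trans ?_
      rw [mul_pow, Real.sq_sqrt hN0]
      gcongr
  have h2 : Real.sqrt N ≤ ∫ s in a..b, B s := by
    rcases eq_or_lt_of_le (Real.sqrt_nonneg N) with h0 | h0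
    · rw [← h0]; exact hB0
    · have : Real.sqrt N * Real.sqrt N ≤ Real.sqrt N * ∫ s in a..b, B s := by
        rw [Real.mul_self_sqrt hN0]; exact key
      exact le_of_mul_le_mul_left this h0
  have := pow_le_pow_left₀ (Real.sqrt_nonneg N) h2 2
  rwa [Real.sq_sqrt hN0] at this

end basics


/-- `∫_{t0}^t e^{-(t-s)ν} f_s ds` -/
noncomputable def conv {I : Type*} (ν : I → ℝ) (f : ℝ → I → ℝ) (t0 t : ℝ) : I → ℝ :=
  fun i => ∫ s in t0..t, Real.exp (-((t - s) * ν i)) * f s i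

section semigroup
variable {I : Type*} {κ : ℝ} {lam : I → ℝ}

lemma smooth_bd (hκ : 0 ≤ κ) {η : ℝ} (hη : 0 ≤ η) {T : ℝ}
    (hμ : ∀ i, 0 < κ + lam i) {u a : ℝ} (hu : 0 < u) (huT : u ≤ T) (ha : 0 ≤ a) (ha1 : a ≤ 1)
    (i : I) : (κ + lam i) ^ a * Real.exp (-(u * (lam i + η))) ≤ Real.exp (κ * T) * u ^ (-a) := by
  have hm := hμ i
  have h1 : (u * (κ + lam i)) ^ a ≤ Real.exp (u * (κ + lam i)) := by
    have hx : 0 ≤ u * (κ + lam i) := by positivity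
    have h2 : (u * (κ + lam i)) ^ a ≤ 1 + u * (κ + lam i) := by
      calc (u * (κ + lam i)) ^ a ≤ (1 + u * (κ + lam i)) ^ a :=
            Real.rpow_le_rpow hx (by linarith) ha
        _ ≤ (1 + u * (κ + lam i)) ^ (1:ℝ) :=
            Real.rpow_le_rpow_of_exponent_le (by linarith) ha1
        _ = _ := Real.rpow_one _
    have := Real.add_one_le_exp (u * (κ + lam i))
    linarith
  rw [Real.mul_rpow hu.le hm.le] at h1
  have h3 : Real.exp (-(u * (lam i + η))) ≤ Real.exp (κ * T) * Real.exp (-(u * (κ + lam i))) := by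
    rw [← Real.exp_add, Real.exp_le_exp]
    nlinarith [mul_nonneg hu.le hη, mul_nonneg hκ (sub_nonneg.2 huT)]
  have hua : 0 < u ^ a := Real.rpow_pos_of_pos hu a
  rw [Real.rpow_neg hu.le]
  have hma : 0 ≤ (κ + lam i) ^ a := Real.rpow_nonneg hm.le a
  calc (κ + lam i) ^ a * Real.exp (-(u * (lam i + η)))
      ≤ (κ + lam i) ^ a * (Real.exp (κ * T) * Real.exp (-(u * (κ + lam i)))) := by gcongr
    _ = Real.exp (κ * T) * ((u ^ a)⁻¹ * ((u ^ a * (κ + lam i) ^ a) *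
          Real.exp (-(u * (κ + lam i))))) := by field_simp
    _ ≤ Real.exp (κ * T) * ((u ^ a)⁻¹ * (Real.exp (u * (κ + lam i)) *
          Real.exp (-(u * (κ + lam i))))) := by gcongr
    _ = _ := by rw [← Real.exp_add]; simp

lemma abs_exp_sub_one_le' {x c : ℝ} (hc : 0 ≤ c) (hx : -c ≤ x) {σ : ℝ} (hσ : 0 ≤ σ) (hσ1 : σ ≤ 1) :
    |Real.exp (-x) - 1| ≤ Real.exp c * |x| ^ σ := by
  have hec : 1 ≤ Real.exp c := Real.one_le_exp hc
  have h1 : |Real.exp (-x) - 1| ≤ Real.exp c := by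
    have : Real.exp (-x) ≤ Real.exp c := Real.exp_le_exp.2 (by linarith)
    have := Real.exp_pos (-x)
    rw [abs_le]; constructor <;> linarith
  have h2 : |Real.exp (-x) - 1| ≤ Real.exp c * |x| := by
    rcases le_total 0 x with h0 | h0
    · have a1 := Real.add_one_le_exp (-x)
      have a2 : Real.exp (-x) ≤ 1 := Real.exp_le_one_iff.2 (by linarith)
      rw [abs_of_nonneg h0, abs_of_nonpos (by linarith)]
      nlinarith
    · have a1 : Real.exp (-x) - 1 ≤ (-x) * Real.exp (-x) := by
        have := Real.add_one_le_exp x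
        have e : Real.exp (-x) * Real.exp x = 1 := by rw [← Real.exp_add]; simp
        have := Real.exp_pos (-x)
        nlinarith
      have a2 : 1 ≤ Real.exp (-x) := Real.one_le_exp (by linarith)
      have a3 : Real.exp (-x) ≤ Real.exp c := Real.exp_le_exp.2 (by linarith)
      rw [abs_of_nonpos h0, abs_of_nonneg (by linarith)]
      nlinarith
  rcases le_total |x| 1 with h3 | h3
  · refine h2.trans (mul_le_mul_of_nonneg_left ?_ (Real.exp_pos c).le)
    rcases eq_or_lt_of_le (abs_nonneg x) with h4 | h4
    · rw [← h4]; exact Real.rpow_nonneg le_rfl _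
    · calc |x| = |x| ^ (1:ℝ) := (Real.rpow_one _).symm
        _ ≤ _ := Real.rpow_le_rpow_of_exponent_ge h4 h3 hσ1
  · refine h1.trans (le_mul_of_one_le_right (Real.exp_pos c).le ?_)
    exact Real.one_le_rpow h3 hσ

lemma incr_bd (hκ : 0 ≤ κ) {η : ℝ} (hη : 0 ≤ η) {T : ℝ} {δ : ℝ} (hδ : 0 < δ)
    (hμ : ∀ i, δ ≤ κ + lam i) {u σ : ℝ} (hu : 0 ≤ u) (huT : u ≤ T) (hσ : 0 ≤ σ) (hσ1 : σ ≤ 1)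
    (i : I) : |Real.exp (-(u * (lam i + η))) - 1| ≤
      Real.exp (κ * T) * (1 + (κ + η) / δ) * (u ^ σ * (κ + lam i) ^ σ) := by
  have hm := hμ i
  have hm0 : 0 < κ + lam i := hδ.trans_le hm
  have h1 := abs_exp_sub_one_le' (x := u * (lam i + η)) (c := κ * T)
    (mul_nonneg hκ (hu.trans huT)) (by
      nlinarith [mul_nonneg hκ (sub_nonneg.2 huT), mul_nonneg hu hη, mul_nonneg hu hm0.le]) hσ hσ1
  refine h1.trans ?_
  rw [mul_assoc]
  refine mul_le_mul_of_nonneg_left ?_ (Real.exp_pos _).le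
  set C := 1 + (κ + η) / δ with hC
  have hC1 : 1 ≤ C := by rw [hC]; have : 0 ≤ (κ + η) / δ := by positivity
                         linarith
  have h2 : |u * (lam i + η)| ≤ C * (u * (κ + lam i)) := by
    rw [abs_mul, abs_of_nonneg hu]
    have h3 : |lam i + η| ≤ C * (κ + lam i) := by
      have h4 : κ + η ≤ (κ + η) / δ * (κ + lam i) := by
        rw [div_mul_eq_mul_div, le_div_iff₀ hδ]
        exact mul_le_mul_of_nonneg_left hm (by positivity)
      rw [hC, abs_le]; constructor <;> nlinarith
    nlinarith [mul_le_mul_of_nonneg_left h3 hu]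
  calc |u * (lam i + η)| ^ σ ≤ (C * (u * (κ + lam i))) ^ σ :=
        Real.rpow_le_rpow (abs_nonneg _) h2 hσ
    _ = C ^ σ * (u ^ σ * (κ + lam i) ^ σ) := by
        rw [Real.mul_rpow (by positivity) (by positivity), Real.mul_rpow hu hm0.le]
    _ ≤ C * (u ^ σ * (κ + lam i) ^ σ) := by
        refine mul_le_mul_of_nonneg_right ?_ (mul_nonneg (Real.rpow_nonneg hu _)
          (Real.rpow_nonneg hm0.le _))
        calc C ^ σ ≤ C ^ (1:ℝ) := Real.rpow_le_rpow_of_exponent_le hC1 hσ1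
          _ = C := Real.rpow_one _

lemma kint {a t0 t : ℝ} (ha1 : a < 1) :
    IntervalIntegrable (fun s => (t - s) ^ (-a)) volume t0 t := by
  have := (intervalIntegral.intervalIntegrable_rpow' (a := t - t0) (b := t - t) (r := -a)
    (by linarith)).comp_sub_left t
  simpa using this

lemma kintegral {a t0 t : ℝ} (ha1 : a < 1) :
    ∫ s in t0..t, (t - s) ^ (-a) = (t - t0) ^ (1 - a) / (1 - a) := by
  rw [intervalIntegral.integral_comp_sub_left (fun u => u ^ (-a)) t, sub_self,
    integral_rpow (Or.inl (by linarith))]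
  rw [Real.zero_rpow (by linarith), sub_zero]
  congr 1
  · congr 1; ring
  · ring

lemma conv_integrable {ν : I → ℝ} {f : ℝ → I → ℝ} {t0 t t' : ℝ} {i : I}
    (hf : IntervalIntegrable (fun s => f s i) volume t0 t) :
    IntervalIntegrable (fun s => Real.exp (-((t' - s) * ν i)) * f s i) volume t0 t :=
  hf.continuousOn_mul (by fun_prop)

lemma conv_bound (hκ : 0 ≤ κ) {η : ℝ} (hη : 0 ≤ η) {T : ℝ} (hμ : ∀ i, 0 < κ + lam i)
    {r a t0 t : ℝ} (ha : 0 ≤ a) (ha1 : a < 1) (h0 : t0 ≤ t) (hT : t - t0 ≤ T)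
    {f : ℝ → I → ℝ} {B : ℝ → ℝ} (hB : Continuous B)
    (hf : ∀ i, IntervalIntegrable (fun s => f s i) volume t0 t)
    (hfB : ∀ s ∈ Set.Ico t0 t, wle κ lam r (f s) (B s)) :
    wle κ lam (r + a) (conv (fun i => lam i + η) f t0 t)
      (Real.exp (κ * T) * ∫ s in t0..t, (t - s) ^ (-a) * B s) := by
  rw [← intervalIntegral.integral_const_mul]
  refine wle.integral hμ h0 (fun i => conv_integrable (ν := fun i => lam i + η) (hf i))
    (((kint ha1).mul_continuousOn hB.continuousOn).const_mul _) (fun s hs => ?_)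
  have h1 := hfB s ⟨hs.1.le, hs.2⟩
  have hts : 0 < t - s := by linarith [hs.2]
  rw [← mul_assoc]
  refine h1.of_abs hμ (by positivity) (fun i => ?_)
  have h2 := smooth_bd hκ hη hμ hts (T := T) (by linarith [hs.1]) ha ha1.le i
  rw [abs_mul, Real.abs_exp, Real.rpow_add (hμ i)]
  have h3 : 0 ≤ (κ + lam i) ^ r * |f s i| :=
    mul_nonneg (Real.rpow_nonneg (hμ i).le _) (abs_nonneg _)
  nlinarith [mul_le_mul_of_nonneg_right h2 h3]

lemma conv_bound_const (hκ : 0 ≤ κ) {η : ℝ} (hη : 0 ≤ η) {T : ℝ} (hμ : ∀ i, 0 < κ + lam i)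
    {r a t0 t : ℝ} (ha : 0 ≤ a) (ha1 : a < 1) (h0 : t0 ≤ t) (hT : t - t0 ≤ T)
    {f : ℝ → I → ℝ} {M : ℝ}
    (hf : ∀ i, IntervalIntegrable (fun s => f s i) volume t0 t)
    (hfB : ∀ s ∈ Set.Ico t0 t, wle κ lam r (f s) M) :
    wle κ lam (r + a) (conv (fun i => lam i + η) f t0 t)
      (Real.exp (κ * T) * ((t - t0) ^ (1 - a) / (1 - a)) * M) := by
  have := conv_bound hκ hη hμ ha ha1 h0 hT (B := fun _ => M) continuous_const hf hfB
  rw [intervalIntegral.integral_mul_const, kintegral ha1, ← mul_assoc] at this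
  exact this

lemma conv_split {ν : I → ℝ} {f : ℝ → I → ℝ} {t0 t1 t2 : ℝ} (h1 : t0 ≤ t1) (h2 : t1 ≤ t2) {i : I}
    (hf : IntervalIntegrable (fun s => f s i) volume t0 t2) :
    conv ν f t0 t2 i = Real.exp (-((t2 - t1) * ν i)) * conv ν f t0 t1 i + conv ν f t1 t2 i := by
  unfold conv
  rw [← intervalIntegral.integral_const_mul]
  have hf1 : IntervalIntegrable (fun s => f s i) volume t0 t1 :=
    hf.mono_set (by rw [Set.uIcc_of_le h1, Set.uIcc_of_le (h1.trans h2)]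
                    exact Set.Icc_subset_Icc_right h2)
  have hf2 : IntervalIntegrable (fun s => f s i) volume t1 t2 :=
    hf.mono_set (by rw [Set.uIcc_of_le h2, Set.uIcc_of_le (h1.trans h2)]
                    exact Set.Icc_subset_Icc_left h1)
  rw [← intervalIntegral.integral_add_adjacent_intervals (conv_integrable hf1)
    (conv_integrable hf2)]
  congr 1
  apply intervalIntegral.integral_congr
  intro s _
  simp only
  rw [← mul_assoc, ← Real.exp_add]
  congr 2; ring

lemma conv_holder (hκ : 0 ≤ κ) {η : ℝ} (hη : 0 ≤ η) {T : ℝ} (hT : 0 < T) {δ : ℝ} (hδ : 0 < δ)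
    (hμ : ∀ i, δ ≤ κ + lam i) {r a σ : ℝ} (ha : 0 ≤ a) (hσ : 0 ≤ σ) (haσ : a + σ < 1) :
    ∃ C : ℝ, 0 ≤ C ∧ ∀ (f : ℝ → I → ℝ) (M t1 t2 : ℝ), 0 ≤ t1 → t1 ≤ t2 → t2 ≤ T → 0 ≤ M →
      (∀ i, IntervalIntegrable (fun s => f s i) volume 0 t2) →
      (∀ s ∈ Set.Ico 0 t2, wle κ lam r (f s) M) →
      wle κ lam (r + a) (conv (fun i => lam i + η) f 0 t2 - conv (fun i => lam i + η) f 0 t1)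
        (C * M * (t2 - t1) ^ σ) := by
  have hμ' : ∀ i, 0 < κ + lam i := fun i => hδ.trans_le (hμ i)
  set D := Real.exp (κ * T) * (1 + (κ + η) / δ) with hD
  have hD0 : 0 ≤ D := by positivity
  have ha1 : 0 < 1 - a := by linarith
  have haσ1 : 0 < 1 - (a + σ) := by linarith
  refine ⟨D * (Real.exp (κ * T) * (T ^ (1 - (a + σ)) / (1 - (a + σ))))
    + Real.exp (κ * T) * (T ^ (1 - (a + σ)) / (1 - a)), by positivity, ?_⟩
  intro f M t1 t2 h1 h12 h2 hM hf hfM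
  have hf1 : ∀ i, IntervalIntegrable (fun s => f s i) volume 0 t1 := fun i =>
    (hf i).mono_set (by rw [Set.uIcc_of_le h1, Set.uIcc_of_le (h1.trans h12)]
                        exact Set.Icc_subset_Icc_right h12)
  have hf2 : ∀ i, IntervalIntegrable (fun s => f s i) volume t1 t2 := fun i =>
    (hf i).mono_set (by rw [Set.uIcc_of_le h12, Set.uIcc_of_le (h1.trans h12)]
                        exact Set.Icc_subset_Icc_left h1)
  have hd0 : 0 ≤ t2 - t1 := by linarith
  have A := conv_bound_const hκ hη hμ' (T := T) (r := r) (a := a + σ) (t0 := 0) (t := t1)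
    (by linarith) (by linarith) h1 (by linarith) hf1 (fun s hs => hfM s ⟨hs.1, hs.2.trans_le h12⟩)
  have B := conv_bound_const hκ hη hμ' (T := T) (r := r) (a := a) (t0 := t1) (t := t2)
    ha (by linarith) h12 (by linarith) hf2 (fun s hs => hfM s ⟨h1.trans hs.1, hs.2⟩)
  rw [sub_zero] at A
  have A2 : wle κ lam (r + a)
      (fun i => (Real.exp (-((t2 - t1) * (lam i + η))) - 1) * conv (fun i => lam i + η) f 0 t1 i)
      ((D * (t2 - t1) ^ σ) * (Real.exp (κ * T) * (t1 ^ (1 - (a + σ)) / (1 - (a + σ))) * M)) := by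
    refine A.of_abs hμ' (by positivity) (fun i => ?_)
    have h3 := incr_bd hκ hη hδ hμ hd0 (T := T) (by linarith) hσ (by linarith) i
    rw [abs_mul]
    have e : (κ + lam i) ^ (r + (a + σ)) = (κ + lam i) ^ (r + a) * (κ + lam i) ^ σ := by
      rw [← Real.rpow_add (hμ' i)]; congr 1; ring
    rw [e]
    have h4 : 0 ≤ (κ + lam i) ^ (r + a) * |conv (fun i => lam i + η) f 0 t1 i| :=
      mul_nonneg (Real.rpow_nonneg (hμ' i).le _) (abs_nonneg _)
    have := mul_le_mul_of_nonneg_right h3 h4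
    rw [← hD] at this
    nlinarith
  have e : conv (fun i => lam i + η) f 0 t2 - conv (fun i => lam i + η) f 0 t1
      = (fun i => (Real.exp (-((t2 - t1) * (lam i + η))) - 1) *
          conv (fun i => lam i + η) f 0 t1 i) + conv (fun i => lam i + η) f t1 t2 := by
    funext i
    simp only [Pi.add_apply, Pi.sub_apply]
    rw [conv_split h1 h12 (hf i)]; ring
  rw [e]
  refine (A2.add hμ' B).mono ?_
  have g1 : t1 ^ (1 - (a + σ)) ≤ T ^ (1 - (a + σ)) :=
    Real.rpow_le_rpow h1 (by linarith) haσ1.le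
  have g2 : (t2 - t1) ^ (1 - a) ≤ T ^ (1 - (a + σ)) * (t2 - t1) ^ σ := by
    have : (t2 - t1) ^ (1 - a) = (t2 - t1) ^ (1 - (a + σ)) * (t2 - t1) ^ σ := by
      rw [← Real.rpow_add_of_nonneg hd0 haσ1.le hσ]; congr 1; ring
    rw [this]
    exact mul_le_mul_of_nonneg_right (Real.rpow_le_rpow hd0 (by linarith) haσ1.le)
      (Real.rpow_nonneg hd0 _)
  have g3 : 0 ≤ (t2 - t1) ^ σ := Real.rpow_nonneg hd0 _
  rw [add_mul, add_mul]
  refine add_le_add ?_ ?_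
  · calc _ ≤ (D * (t2 - t1) ^ σ) * (Real.exp (κ * T) *
          (T ^ (1 - (a + σ)) / (1 - (a + σ))) * M) := by gcongr
      _ = _ := by ring
  · calc _ ≤ Real.exp (κ * T) * ((T ^ (1 - (a + σ)) * (t2 - t1) ^ σ) / (1 - a)) * M := by gcongr
      _ = _ := by ring

/-- small kernel for large exponential weight -/
lemma kernel_small {a : ℝ} (ha1 : a < 1) {C : ℝ} (hC : 0 ≤ C) :
    ∃ p : ℝ, 0 < p ∧ ∀ t, 0 ≤ t →
      C * ∫ s in (0:ℝ)..t, (t - s) ^ (-a) * Real.exp (p * s) ≤ 1 / 2 * Real.exp (p * t) := by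
  have hb : 0 < 1 - a := by linarith
  set G := Real.Gamma (1 - a)
  have hG : 0 < G := Real.Gamma_pos_of_pos hb
  set y := (1 / (2 * (C * G + 1))) ^ (1 / (1 - a)) with hy
  have hy0 : 0 < y := Real.rpow_pos_of_pos (by positivity) _
  refine ⟨1 / y, by positivity, fun t ht => ?_⟩
  have e1 : ∫ s in (0:ℝ)..t, (t - s) ^ (-a) * Real.exp (1 / y * s)
      = Real.exp (1 / y * t) * ∫ u in (0:ℝ)..t, u ^ ((1 - a) - 1) * Real.exp (-(1 / y * u)) := by
    have := intervalIntegral.integral_comp_sub_left (a := 0) (b := t)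
      (fun u => u ^ (-a) * Real.exp (1 / y * (t - u))) t
    simp only [sub_sub_cancel, sub_self, sub_zero] at this
    rw [this, ← intervalIntegral.integral_const_mul]
    apply intervalIntegral.integral_congr
    intro u _
    simp only
    rw [mul_sub, sub_eq_add_neg, Real.exp_add, show (1 - a) - 1 = -a by ring]
    ring
  have e2 := Real.integral_rpow_mul_exp_neg_mul_Ioi hb (r := 1 / y) (by positivity)
  have hint : IntegrableOn (fun u : ℝ => u ^ ((1 - a) - 1) * Real.exp (-(1 / y * u))) (Set.Ioi 0) := by
    by_contra hcon
    rw [integral_undef hcon] at e2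
    have : 0 < (1 / (1 / y)) ^ (1 - a) * Real.Gamma (1 - a) := by positivity
    linarith
  have e3 : ∫ u in (0:ℝ)..t, u ^ ((1 - a) - 1) * Real.exp (-(1 / y * u))
      ≤ (1 / (1 / y)) ^ (1 - a) * G := by
    rw [← e2, intervalIntegral.integral_of_le ht]
    refine setIntegral_mono_set hint ?_ (Set.Ioc_subset_Ioi_self).eventuallyLE
    filter_upwards [ae_restrict_mem measurableSet_Ioi] with u hu
    have : (0:ℝ) < u := hu
    simp only [Pi.zero_apply]; positivity
  have e4 : (1 / (1 / y)) ^ (1 - a) = 1 / (2 * (C * G + 1)) := by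
    rw [one_div_one_div, hy, ← Real.rpow_mul (by positivity), one_div_mul_cancel hb.ne',
      Real.rpow_one]
  rw [e1]
  rw [e4] at e3
  have hE := Real.exp_pos (1 / y * t)
  calc C * (Real.exp (1 / y * t) * _) ≤ C * (Real.exp (1 / y * t) * (1 / (2 * (C * G + 1)) * G)) := by
        gcongr
    _ = (C * G) / (C * G + 1) * (1 / 2 * Real.exp (1 / y * t)) := by field_simp
    _ ≤ 1 * (1 / 2 * Real.exp (1 / y * t)) := by
        gcongr
        rw [div_le_one (by positivity)]; linarith
    _ = _ := one_mul _

/-- right derivative of the convolution -/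
lemma conv_eq' {ν : I → ℝ} {f : ℝ → I → ℝ} (t : ℝ) (i : I) :
    conv ν f 0 t i = Real.exp (-(t * ν i)) * ∫ s in (0:ℝ)..t, Real.exp (s * ν i) * f s i := by
  unfold conv
  rw [← intervalIntegral.integral_const_mul]
  apply intervalIntegral.integral_congr
  intro s _
  simp only
  rw [← mul_assoc, ← Real.exp_add]
  congr 2; ring

lemma conv_hasDeriv {ν : I → ℝ} {f : ℝ → I → ℝ} {T t : ℝ} {i : I} (ht : t ∈ Set.Ico 0 T)
    (hf : IntervalIntegrable (fun s => f s i) volume 0 T)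
    (hc : ContinuousWithinAt (fun s => f s i) (Set.Ici t) t) :
    HasDerivWithinAt (fun t => conv ν f 0 t i) (-(ν i) * conv ν f 0 t i + f t i) (Set.Ici t) t := by
  have hg : IntervalIntegrable (fun s => Real.exp (s * ν i) * f s i) volume 0 T :=
    hf.continuousOn_mul (by fun_prop)
  have hg' : IntervalIntegrable (fun s => Real.exp (s * ν i) * f s i) volume 0 t :=
    hg.mono_set (by rw [Set.uIcc_of_le ht.1, Set.uIcc_of_le (ht.1.trans ht.2.le)]
                    exact Set.Icc_subset_Icc_right ht.2.le)
  have hgc : ContinuousWithinAt (fun s => Real.exp (s * ν i) * f s i) (Set.Ici t) t :=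
    ContinuousWithinAt.mul (by fun_prop) hc
  have hm : StronglyMeasurableAtFilter (fun s => Real.exp (s * ν i) * f s i)
      (nhdsWithin t (Set.Ioi t)) volume := by
    refine ⟨Set.Ioc t T, Ioc_mem_nhdsGT ht.2, ?_⟩
    have := hg.1.aestronglyMeasurable
    exact this.mono_measure (Measure.restrict_mono (Set.Ioc_subset_Ioc_left ht.1) le_rfl)
  have h1 := intervalIntegral.integral_hasDerivWithinAt_right hg' (s := Set.Ici t) (t := Set.Ioi t)
    hm (hgc.mono Set.Ioi_subset_Ici_self)
  have h2 : HasDerivWithinAt (fun t => Real.exp (-(t * ν i))) (Real.exp (-(t * ν i)) * (-(1 * ν i)))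
      (Set.Ici t) t := (((hasDerivAt_id t).mul_const (ν i)).neg.exp).hasDerivWithinAt
  have h3 := h2.mul h1
  have e : (fun t => conv ν f 0 t i) = ((fun t => Real.exp (-(t * ν i))) *
      fun u => ∫ s in (0:ℝ)..u, Real.exp (s * ν i) * f s i) := by
    funext t; rw [conv_eq']; rfl
  rw [e]
  refine h3.congr_deriv ?_
  rw [conv_eq', ← mul_assoc (Real.exp (-(t * ν i))) (Real.exp (t * ν i)), ← Real.exp_add]
  simp
  ring

lemma conv_continuousOn {ν : I → ℝ} {f : ℝ → I → ℝ} {T : ℝ} {i : I} (hT : 0 ≤ T)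
    (hf : IntervalIntegrable (fun s => f s i) volume 0 T) :
    ContinuousOn (fun t => conv ν f 0 t i) (Set.Icc 0 T) := by
  have hg : IntervalIntegrable (fun s => Real.exp (s * ν i) * f s i) volume 0 T :=
    hf.continuousOn_mul (by fun_prop)
  have e : (fun t => conv ν f 0 t i) = fun t => Real.exp (-(t * ν i)) *
      ∫ s in (0:ℝ)..t, Real.exp (s * ν i) * f s i := by
    funext t; rw [conv_eq']
  rw [e]
  refine ContinuousOn.mul (by fun_prop) ?_
  have := intervalIntegral.continuousOn_primitive_interval' hg Set.left_mem_uIcc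
  rwa [Set.uIcc_of_le hT] at this

end semigroup


section flo

lemma fl_le {h : ℝ} (hh : 0 < h) (s : ℝ) : fl h s ≤ s := by
  unfold fl
  have := Int.floor_le (s / h)
  rw [le_div_iff₀ hh] at this; linarith

lemma lt_fl {h : ℝ} (hh : 0 < h) (s : ℝ) : s < fl h s + h := by
  unfold fl
  have := Int.lt_floor_add_one (s / h)
  rw [div_lt_iff₀ hh] at this; linarith

lemma fl_nonneg {h : ℝ} (hh : 0 < h) {s : ℝ} (hs : 0 ≤ s) : 0 ≤ fl h s := by
  unfold fl
  have : (0:ℤ) ≤ ⌊s / h⌋ := Int.floor_nonneg.2 (by positivity)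
  have : (0:ℝ) ≤ ⌊s / h⌋ := by exact_mod_cast this
  positivity

lemma fl_eq_nat {h : ℝ} (hh : 0 < h) {s : ℝ} (hs : 0 ≤ s) : ∃ k : ℕ, fl h s = k * h := by
  have : (0:ℤ) ≤ ⌊s / h⌋ := Int.floor_nonneg.2 (by positivity)
  refine ⟨⌊s / h⌋.toNat, ?_⟩
  unfold fl
  have e : ((⌊s / h⌋.toNat : ℕ) : ℝ) = ((⌊s / h⌋.toNat : ℤ) : ℝ) := by norm_cast
  rw [e, Int.toNat_of_nonneg this, mul_comm]

lemma fl_fl {h : ℝ} (hh : 0 < h) (s : ℝ) : fl h (fl h s) = fl h s := by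
  unfold fl
  rw [mul_div_cancel_left₀ _ hh.ne', Int.floor_intCast]

lemma fl_mem {h T : ℝ} (hh : 0 < h) {s : ℝ} (hs : s ∈ Set.Icc 0 T) : fl h s ∈ Set.Icc 0 T :=
  ⟨fl_nonneg hh hs.1, (fl_le hh s).trans hs.2⟩

lemma fl_const {h : ℝ} (hh : 0 < h) {s t : ℝ} (h1 : fl h t ≤ s) (h2 : s < fl h t + h) :
    fl h s = fl h t := by
  unfold fl at *
  congr 2
  rw [Int.floor_eq_iff]
  constructor
  · rw [le_div_iff₀ hh]; linarith
  · rw [div_lt_iff₀ hh]; linarith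

lemma fl_right {h : ℝ} (hh : 0 < h) (t : ℝ) : ∀ᶠ s in nhdsWithin t (Set.Ici t), fl h s = fl h t := by
  have : Set.Ico t (fl h t + h) ∈ nhdsWithin t (Set.Ici t) := Ico_mem_nhdsGE (lt_fl hh t)
  filter_upwards [this] with s hs
  exact fl_const hh ((fl_le hh t).trans hs.1) hs.2

lemma fl_right_cont {h : ℝ} (hh : 0 < h) (g : ℝ → ℝ) (t : ℝ) :
    ContinuousWithinAt (fun s => g (fl h s)) (Set.Ici t) t := by
  have : ContinuousWithinAt (fun _ : ℝ => g (fl h t)) (Set.Ici t) t := continuousWithinAt_const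
  refine this.congr_of_eventuallyEq ?_ rfl
  filter_upwards [fl_right hh t] with s hs
  rw [hs]

lemma fl_measurable {h : ℝ} (g : ℝ → ℝ) : Measurable (fun s => g (fl h s)) := by
  have h1 : Measurable (fun s : ℝ => ⌊s / h⌋) := Int.measurable_floor.comp (by fun_prop)
  have h2 : Measurable (fun k : ℤ => g (h * k)) := measurable_of_countable _
  exact h2.comp h1

lemma fl_integrable {h : ℝ} (hh : 0 < h) (g : ℝ → ℝ) (a b : ℝ) :
    IntervalIntegrable (fun s => g (fl h s)) volume a b := by
  obtain ⟨C, hC⟩ : ∃ C : ℝ, ∀ s ∈ Set.uIcc a b, ‖g (fl h s)‖ ≤ C := by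
    have hfin : ((fun k : ℤ => ‖g (h * k)‖) '' (Set.Icc ⌊min a b / h⌋ ⌊max a b / h⌋)).Finite :=
      (Set.finite_Icc _ _).image _
    obtain ⟨C, hC⟩ := hfin.bddAbove
    refine ⟨C, fun s hs => hC ⟨⌊s / h⌋, ⟨?_, ?_⟩, rfl⟩⟩
    · exact Int.floor_le_floor (div_le_div_of_nonneg_right hs.1 hh.le)
    · exact Int.floor_le_floor (div_le_div_of_nonneg_right hs.2 hh.le)
  refine (intervalIntegrable_const (c := C)).mono_fun (fl_measurable g).aestronglyMeasurable ?_
  refine (ae_restrict_iff' measurableSet_uIoc).2 (Filter.Eventually.of_forall fun s hs => ?_)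
  exact (hC s (Set.uIoc_subset_uIcc hs)).trans (le_abs_self C)

end flo

section paths
variable {I : Type*} {κ : ℝ} {lam : I → ℝ} {r T : ℝ} {X : ℝ → I → ℝ}

lemma cw_of_metric {g : ℝ → ℝ} (h : ∀ t ∈ Set.Icc (0:ℝ) T, ∀ ε > (0:ℝ), ∃ δ > (0:ℝ),
    ∀ s ∈ Set.Icc (0:ℝ) T, |s - t| ≤ δ → |g s - g t| ≤ ε) : ContinuousOn g (Set.Icc 0 T) := by
  rw [Metric.continuousOn_iff]
  intro t ht ε hε
  obtain ⟨δ, hδ, h1⟩ := h t ht (ε / 2) (by positivity)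
  refine ⟨δ, hδ, fun s hs hst => ?_⟩
  rw [Real.dist_eq] at *
  have := h1 s hs hst.le
  linarith

lemma ContPathW.coord (hμ : ∀ i, 0 < κ + lam i) (h : ContPathW κ lam r T X) (i : I) :
    ContinuousOn (fun t => X t i) (Set.Icc 0 T) := by
  refine cw_of_metric fun t ht ε hε => ?_
  have hp : 0 < (κ + lam i) ^ (-r) := Real.rpow_pos_of_pos (hμ i) _
  obtain ⟨δ, hδ, h1⟩ := h.2 t ht (ε / (κ + lam i) ^ (-r)) (by positivity)
  refine ⟨δ, hδ, fun s hs hst => ?_⟩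
  have h2 : wle κ lam r (X s - X t) _ := ⟨(h.1 s hs).sub hμ (h.1 t ht), h1 s hs hst⟩
  have := h2.coord' hμ i
  rwa [mul_div_cancel₀ _ hp.ne'] at this

lemma ContPathW.norm (hμ : ∀ i, 0 < κ + lam i) (h : ContPathW κ lam r T X) :
    ContinuousOn (fun t => wnorm κ lam r (X t)) (Set.Icc 0 T) := by
  refine cw_of_metric fun t ht ε hε => ?_
  obtain ⟨δ, hδ, h1⟩ := h.2 t ht ε hε
  exact ⟨δ, hδ, fun s hs hst => (wnorm_triangle hμ (h.1 s hs) (h.1 t ht)).trans (h1 s hs hst)⟩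

lemma ContPathW.bdd (hμ : ∀ i, 0 < κ + lam i) (h : ContPathW κ lam r T X) :
    ∃ B : ℝ, 0 ≤ B ∧ ∀ t ∈ Set.Icc 0 T, wle κ lam r (X t) B := by
  obtain ⟨B, hB⟩ := isCompact_Icc.exists_bound_of_continuousOn (h.norm hμ)
  refine ⟨|B|, abs_nonneg _, fun t ht => ⟨h.1 t ht, ?_⟩⟩
  exact (le_abs_self _).trans ((hB t ht).trans (le_abs_self _))

lemma ContPathW.unif (hμ : ∀ i, 0 < κ + lam i) (h : ContPathW κ lam r T X) {ε : ℝ} (hε : 0 < ε) :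
    ∃ d > (0:ℝ), ∀ s ∈ Set.Icc 0 T, ∀ t ∈ Set.Icc 0 T, |s - t| ≤ d → wle κ lam r (X s - X t) ε := by
  have hD : ContinuousOn (fun p : ℝ × ℝ => wnorm κ lam r (X p.1 - X p.2))
      (Set.Icc 0 T ×ˢ Set.Icc 0 T) := by
    rw [Metric.continuousOn_iff]
    rintro ⟨s, t⟩ ⟨hs, ht⟩ ε hε
    obtain ⟨d1, hd1, h1⟩ := h.2 s hs (ε / 4) (by positivity)
    obtain ⟨d2, hd2, h2⟩ := h.2 t ht (ε / 4) (by positivity)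
    refine ⟨min d1 d2, lt_min hd1 hd2, ?_⟩
    rintro ⟨s', t'⟩ ⟨hs', ht'⟩ hd
    simp only at hs ht hs' ht' ⊢
    rw [Prod.dist_eq, max_lt_iff, Real.dist_eq, Real.dist_eq] at hd
    have a1 := h1 s' hs' (hd.1.le.trans (min_le_left _ _))
    have a2 := h2 t' ht' (hd.2.le.trans (min_le_right _ _))
    have m1 := (h.1 s' hs').sub hμ (h.1 s hs)
    have m2 := (h.1 t' ht').sub hμ (h.1 t ht)
    have b := wnorm_triangle hμ ((h.1 s' hs').sub hμ (h.1 t' ht')) ((h.1 s hs).sub hμ (h.1 t ht))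
    have c := (m1.wle.sub hμ m2.wle).2
    rw [show X s' - X s - (X t' - X t) = X s' - X t' - (X s - X t) by abel] at c
    rw [Real.dist_eq]
    linarith
  have hU := (isCompact_Icc.prod isCompact_Icc).uniformContinuousOn_of_continuous hD
  rw [Metric.uniformContinuousOn_iff] at hU
  obtain ⟨d, hd, h1⟩ := hU ε hε
  refine ⟨d / 2, by positivity, fun s hs t ht hst => ⟨(h.1 s hs).sub hμ (h.1 t ht), ?_⟩⟩
  have h2 := h1 (s, t) ⟨hs, ht⟩ (t, t) ⟨ht, ht⟩ (by
    rw [Prod.dist_eq]; simp only [dist_self]; rw [max_lt_iff, Real.dist_eq]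
    exact ⟨by linarith, hd⟩)
  simp only [sub_self] at h2
  have h3 : wnorm κ lam r (0 : I → ℝ) = 0 := by simp [wnorm]
  rw [h3, Real.dist_eq, sub_zero] at h2
  exact (le_abs_self _).trans h2.le

lemma F_cont (hμ : ∀ i, 0 < κ + lam i) {α : ℝ} {F : (I → ℝ) → I → ℝ}
    (hFmap : ∀ f, memW κ lam r f → memW κ lam (-α) (F f))
    (hFcont : ∀ f, memW κ lam r f → ∀ δ > (0:ℝ), ∃ δ' > (0:ℝ), ∀ g, memW κ lam r g →
      wnorm κ lam r (g - f) ≤ δ' → wnorm κ lam (-α) (F g - F f) ≤ δ)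
    (h : ContPathW κ lam r T X) : ContPathW κ lam (-α) T (fun t => F (X t)) := by
  refine ⟨fun t ht => hFmap _ (h.1 t ht), fun t ht ε hε => ?_⟩
  obtain ⟨d, hd, h1⟩ := hFcont (X t) (h.1 t ht) ε hε
  obtain ⟨d', hd', h2⟩ := h.2 t ht d hd
  exact ⟨d', hd', fun s hs hst => h1 _ (h.1 s hs) (h2 s hs hst)⟩

lemma ContPathW.integrable (hμ : ∀ i, 0 < κ + lam i) (h : ContPathW κ lam r T X) (hT : 0 ≤ T)
    (i : I) : IntervalIntegrable (fun t => X t i) volume 0 T :=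
  ContinuousOn.intervalIntegrable (by rw [Set.uIcc_of_le hT]; exact h.coord hμ i)

end paths

section compare
variable {I : Type*} {κ : ℝ} {lam : I → ℝ}

/-- approximate mild solution on `[0,τ]` -/
structure AS (κ : ℝ) (lam : I → ℝ) (ϱ : ℝ) (F : (I → ℝ) → I → ℝ) (o : ℝ → I → ℝ) (R τ a : ℝ)
    (y yb : ℝ → I → ℝ) : Prop where
  int : ∀ i, IntervalIntegrable (fun s => F (yb s) i) volume 0 τ
  bar : ∀ s ∈ Set.Ico 0 τ, wle κ lam ϱ (yb s) R ∧ wle κ lam ϱ (y s - yb s) a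
  eq : ∀ t ∈ Set.Icc 0 τ, wle κ lam ϱ (y t - conv lam (fun s => F (yb s)) 0 t - o t) a

/-- Lipschitz on a ball -/
def LipBall (κ : ℝ) (lam : I → ℝ) (ϱ α : ℝ) (F : (I → ℝ) → I → ℝ) (R L : ℝ) : Prop :=
  0 ≤ L ∧ ∀ v w K, wle κ lam ϱ v R → wle κ lam ϱ w R → wle κ lam ϱ (v - w) K →
    wle κ lam (-α) (F v - F w) (L * K)

lemma conv_sub {ν : I → ℝ} {f g : ℝ → I → ℝ} {t0 t : ℝ}
    (hf : ∀ i, IntervalIntegrable (fun s => f s i) volume t0 t)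
    (hg : ∀ i, IntervalIntegrable (fun s => g s i) volume t0 t) :
    conv ν f t0 t - conv ν g t0 t = conv ν (fun s => f s - g s) t0 t := by
  funext i
  simp only [conv, Pi.sub_apply]
  rw [← intervalIntegral.integral_sub (conv_integrable (hf i)) (conv_integrable (hg i))]
  apply intervalIntegral.integral_congr
  intro s _
  simp only; ring

lemma II_mono {f : ℝ → ℝ} {t τ : ℝ} (h0 : 0 ≤ t) (ht : t ≤ τ)
    (h : IntervalIntegrable f volume 0 τ) : IntervalIntegrable f volume 0 t :=
  h.mono_set (by rw [Set.uIcc_of_le h0, Set.uIcc_of_le (h0.trans ht)]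
                 exact Set.Icc_subset_Icc_right ht)

lemma AS.restrict {ϱ : ℝ} {F : (I → ℝ) → I → ℝ} {o : ℝ → I → ℝ} {R τ τ' a : ℝ}
    {y yb : ℝ → I → ℝ} (h : AS κ lam ϱ F o R τ a y yb) (h0 : 0 ≤ τ') (hτ : τ' ≤ τ) :
    AS κ lam ϱ F o R τ' a y yb :=
  ⟨fun i => II_mono h0 hτ (h.int i), fun s hs => h.bar s ⟨hs.1, hs.2.trans_le hτ⟩,
    fun t ht => h.eq t ⟨ht.1, ht.2.trans hτ⟩⟩

lemma AS.mono {ϱ : ℝ} {F : (I → ℝ) → I → ℝ} {o : ℝ → I → ℝ} {R R' τ a a' : ℝ}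
    {y yb : ℝ → I → ℝ} (h : AS κ lam ϱ F o R τ a y yb) (hR : R ≤ R') (ha : a ≤ a') :
    AS κ lam ϱ F o R' τ a' y yb :=
  ⟨h.int, fun s hs => ⟨(h.bar s hs).1.mono hR, (h.bar s hs).2.mono ha⟩,
    fun t ht => (h.eq t ht).mono ha⟩

lemma compare (hκ : 0 ≤ κ) {T : ℝ} (hμ : ∀ i, 0 < κ + lam i)
    {α ϱ : ℝ} (hαϱ : 0 ≤ α + ϱ) (hαϱ1 : α + ϱ < 1) {F : (I → ℝ) → I → ℝ} (o : ℝ → I → ℝ)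
    {R L : ℝ} (hL : LipBall κ lam ϱ α F R L) :
    ∃ K : ℝ, 0 ≤ K ∧ ∀ (τ a1 a2 : ℝ) (y yb z zb : ℝ → I → ℝ), 0 ≤ τ → τ ≤ T → 0 ≤ a1 → 0 ≤ a2 →
      AS κ lam ϱ F o R τ a1 y yb → AS κ lam ϱ F o R τ a2 z zb →
      ∀ t ∈ Set.Icc 0 τ, wle κ lam ϱ (y t - z t) (K * (a1 + a2)) := by
  obtain ⟨p, hp, hker⟩ := kernel_small (a := α + ϱ) hαϱ1 (C := Real.exp (κ * T) * L)
    (mul_nonneg (Real.exp_pos _).le hL.1)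
  refine ⟨4 * Real.exp (p * T), by positivity, ?_⟩
  intro τ a1 a2 y yb z zb hτ0 hτT ha1 ha2 hy hz
  set a := a1 + a2 with ha
  have ha0 : 0 ≤ a := by positivity
  -- one step
  have step : ∀ M : ℝ, 0 ≤ M → (∀ s ∈ Set.Ico 0 τ, wle κ lam ϱ (y s - z s) (M * Real.exp (p * s))) →
      ∀ t ∈ Set.Icc 0 τ, wle κ lam ϱ (y t - z t) ((2 * a + M / 2) * Real.exp (p * t)) := by
    intro M hM hs t ht
    have hyi := fun i => II_mono ht.1 ht.2 (hy.int i)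
    have hzi := fun i => II_mono ht.1 ht.2 (hz.int i)
    have hconv := conv_bound hκ (le_refl (0:ℝ)) hμ (T := T) (r := -α) (a := α + ϱ) (t0 := 0) (t := t)
      hαϱ hαϱ1 ht.1 (by linarith [ht.2]) (f := fun s => F (yb s) - F (zb s))
      (B := fun s => L * ((M + a) * Real.exp (p * s))) (by fun_prop)
      (fun i => (hyi i).sub (hzi i)) (fun s hs' => by
        have hs2 : s ∈ Set.Ico 0 τ := ⟨hs'.1, hs'.2.trans_le ht.2⟩
        refine (hL.2 _ _ ((M + a) * Real.exp (p * s)) (hy.bar s hs2).1 (hz.bar s hs2).1 ?_)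
        have h1 := ((hs s hs2).sub hμ (hy.bar s hs2).2).add hμ (hz.bar s hs2).2
        rw [show y s - z s - (y s - yb s) + (z s - zb s) = yb s - zb s by abel] at h1
        refine h1.mono ?_
        have : 1 ≤ Real.exp (p * s) := Real.one_le_exp (mul_nonneg hp.le hs'.1)
        nlinarith)
    simp only [add_zero] at hconv
    rw [show -α + (α + ϱ) = ϱ by ring] at hconv
    change wle κ lam ϱ (conv lam (fun s => F (yb s) - F (zb s)) 0 t) _ at hconv
    rw [← conv_sub hyi hzi] at hconv
    have h2 := ((hy.eq t ht).sub hμ (hz.eq t ht)).add hμ hconv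
    rw [show y t - conv lam (fun s => F (yb s)) 0 t - o t
      - (z t - conv lam (fun s => F (zb s)) 0 t - o t)
      + (conv lam (fun s => F (yb s)) 0 t - conv lam (fun s => F (zb s)) 0 t) = y t - z t by abel] at h2
    refine h2.mono ?_
    have h3 := hker t ht.1
    have e : ∫ s in (0:ℝ)..t, (t - s) ^ (-(α + ϱ)) * (L * ((M + a) * Real.exp (p * s)))
        = (L * (M + a)) * ∫ s in (0:ℝ)..t, (t - s) ^ (-(α + ϱ)) * Real.exp (p * s) := by
      rw [← intervalIntegral.integral_const_mul]
      apply intervalIntegral.integral_congr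
      intro s _; simp only; ring
    rw [e]
    have h4 : 1 ≤ Real.exp (p * t) := Real.one_le_exp (mul_nonneg hp.le ht.1)
    have h5 := mul_le_mul_of_nonneg_left h3 (add_nonneg hM ha0)
    calc a1 + a2 + Real.exp (κ * T) * (L * (M + a) *
          ∫ s in (0:ℝ)..t, (t - s) ^ (-(α + ϱ)) * Real.exp (p * s))
        = a + (M + a) * (Real.exp (κ * T) * L *
          ∫ s in (0:ℝ)..t, (t - s) ^ (-(α + ϱ)) * Real.exp (p * s)) := by rw [ha]; ring
      _ ≤ a + (M + a) * (1 / 2 * Real.exp (p * t)) := by linarith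
      _ ≤ _ := by nlinarith
  set M0 := R + a1 + (R + a2) with hM0
  have iter : ∀ k : ℕ, ∀ t ∈ Set.Ico 0 τ,
      wle κ lam ϱ (y t - z t) ((4 * a + |M0| / 2 ^ k) * Real.exp (p * t)) := by
    intro k
    induction k with
    | zero =>
      intro t ht
      have h1 := ((hy.bar t ht).2.add hμ (hy.bar t ht).1).sub hμ
        ((hz.bar t ht).2.add hμ (hz.bar t ht).1)
      rw [sub_add_cancel, sub_add_cancel] at h1
      refine h1.mono ?_
      have h4 : 1 ≤ Real.exp (p * t) := Real.one_le_exp (mul_nonneg hp.le ht.1)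
      have : a1 + R + (a2 + R) ≤ |M0| := le_trans (by rw [hM0]; linarith) (le_abs_self _)
      have h6 := abs_nonneg M0
      simp only [pow_zero, div_one]
      nlinarith
    | succ k ih =>
      intro t ht
      have := step (4 * a + |M0| / 2 ^ k) (by positivity) ih t ⟨ht.1, ht.2.le⟩
      refine this.mono (le_of_eq ?_)
      rw [pow_succ]; field_simp; ring
  have fin : ∀ t ∈ Set.Ico 0 τ, wle κ lam ϱ (y t - z t) (4 * a * Real.exp (p * t)) := by
    intro t ht
    refine ⟨(iter 0 t ht).1, ?_⟩
    have hlim : Filter.Tendsto (fun k : ℕ => (4 * a + |M0| / 2 ^ k) * Real.exp (p * t)) Filter.atTop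
        (nhds ((4 * a + 0) * Real.exp (p * t))) := by
      refine ((tendsto_const_nhds.add ?_).mul_const _)
      have := (tendsto_pow_atTop_nhds_zero_of_lt_one (r := (1/2:ℝ)) (by norm_num)
        (by norm_num)).const_mul |M0|
      simp only [mul_zero] at this
      refine this.congr fun k => ?_
      rw [one_div, inv_pow, div_eq_mul_inv]
    rw [add_zero] at hlim
    exact ge_of_tendsto' hlim fun k => (iter k t ht).2
  intro t ht
  have := step (4 * a) (by positivity) fin t ht
  refine this.mono ?_
  have h1 : Real.exp (p * t) ≤ Real.exp (p * T) := Real.exp_le_exp.2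
    (mul_le_mul_of_nonneg_left (ht.2.trans hτT) hp.le)
  nlinarith

end compare


/-- projection on the coordinates in `S` -/
def prj {I : Type*} [DecidableEq I] (S : Finset I) (v : I → ℝ) : I → ℝ :=
  fun i => if i ∈ S then v i else 0

/-- the deterministic hypotheses -/
structure Hyp {I : Type*} (η κ : ℝ) (lam : I → ℝ) (δ T ϑ c θ ε α φ γ ρ ϱ χ : ℝ)
    (F : (I → ℝ) → I → ℝ) (ℍ : ℕ → Finset I) (φhat Φ : (I → ℝ) → ℝ) (h : ℕ → ℝ) : Prop where
  hη : 0 ≤ η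
  hκ : 0 ≤ κ
  hδ : 0 < δ
  hμ : ∀ i, δ ≤ κ + lam i
  hν : ∀ i, δ ≤ η + lam i
  hT : 0 < T
  hϑ : 0 < ϑ
  hc : 0 < c
  hθ : 0 ≤ θ
  hε : 0 ≤ ε
  hα0 : 0 ≤ α
  hα1 : α ≤ 1 / 2
  hφ0 : 0 ≤ φ
  hφ1 : φ < 1
  hγ0 : 0 < γ
  hγ1 : γ < 1
  hρα : -α ≤ ρ
  hρϱ : ρ < ϱ
  hϱα : ϱ < 1 - α
  hϱγ : ϱ < 1 - γ
  hχ0 : 0 < χ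
  hχ1 : χ * (1 + ϑ) ≤ ϱ - ρ
  hχ2 : χ * (1 + 2 * ϑ) ≤ 1 - α - ρ
  hFmap : ∀ f, memW κ lam ϱ f → memW κ lam (-α) (F f)
  hFcont : ∀ f, memW κ lam ϱ f → ∀ δ > (0:ℝ), ∃ δ' > (0:ℝ), ∀ g, memW κ lam ϱ g →
      wnorm κ lam ϱ (g - f) ≤ δ' → wnorm κ lam (-α) (F g - F f) ≤ δ
  hspec : ∀ C : ℝ, ∀ᶠ m in Filter.atTop, ∀ i ∉ ℍ m, C ≤ lam i
  hφhat : ∀ f, 0 ≤ φhat f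
  hΦ : ∀ f, 0 ≤ Φ f
  hFH : ∀ n : ℕ, ∀ v : I → ℝ, (∀ i ∉ ℍ n, v i = 0) → memW κ lam 0 (F v)
  hFγ : ∀ n : ℕ, ∀ v : I → ℝ, (∀ i ∉ ℍ n, v i = 0) →
      wnorm κ lam (-γ) (F v) ≤ c * (2 * ε + wnorm κ lam 0 v ^ 2)
  hcoer : ∀ n : ℕ, ∀ v w : I → ℝ, (∀ i ∉ ℍ n, v i = 0) → (∀ i ∉ ℍ n, w i = 0) →
      ∑ i ∈ ℍ n, v i * F (v + w) i ≤
        φhat w * wnorm κ lam 0 v ^ 2 + φ * (∑ i ∈ ℍ n, (η + lam i) * v i ^ 2) + Φ w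
  hFlip : ∀ n : ℕ, ∀ v w : I → ℝ, (∀ i ∉ ℍ n, v i = 0) → (∀ i ∉ ℍ n, w i = 0) →
      wnorm κ lam (-α) (F v - F w) ≤
        θ * (1 + wnorm κ lam ρ v ^ ϑ + wnorm κ lam ρ w ^ ϑ) * wnorm κ lam ρ (v - w)
  hh : ∀ n, h n ∈ Set.Ioc 0 T
  hhlim : Filter.Tendsto h Filter.atTop (nhds 0)

namespace Hyp
variable {I : Type*} {η κ : ℝ} {lam : I → ℝ} {δ T ϑ c θ ε α φ γ ρ ϱ χ : ℝ}
    {F : (I → ℝ) → I → ℝ} {ℍ : ℕ → Finset I} {φhat Φ : (I → ℝ) → ℝ} {h : ℕ → ℝ}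

lemma μpos (D : Hyp η κ lam δ T ϑ c θ ε α φ γ ρ ϱ χ F ℍ φhat Φ h) (i : I) : 0 < κ + lam i :=
  D.hδ.trans_le (D.hμ i)

lemma ev_mem (D : Hyp η κ lam δ T ϑ c θ ε α φ γ ρ ϱ χ F ℍ φhat Φ h) (i : I) :
    ∀ᶠ n in Filter.atTop, i ∈ ℍ n := by
  filter_upwards [D.hspec (lam i + 1)] with n hn
  by_contra hi
  have := hn i hi
  linarith

lemma F_wle (D : Hyp η κ lam δ T ϑ c θ ε α φ γ ρ ϱ χ F ℍ φhat Φ h) (n : ℕ) {v w : I → ℝ}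
    (hv : ∀ i ∉ ℍ n, v i = 0) (hw : ∀ i ∉ ℍ n, w i = 0) {A B K : ℝ}
    (hA : wle κ lam ρ v A) (hB : wle κ lam ρ w B) (hK : wle κ lam ρ (v - w) K) :
    wle κ lam (-α) (F v - F w) (θ * (1 + A ^ ϑ + B ^ ϑ) * K) := by
  refine ⟨(D.hFmap _ (memW_fin ϱ (ℍ n) hv)).sub D.μpos (D.hFmap _ (memW_fin ϱ (ℍ n) hw)), ?_⟩
  refine (D.hFlip n v w hv hw).trans ?_
  have h1 := Real.rpow_le_rpow (wnorm_nonneg' ρ v) hA.2 D.hϑ.le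
  have h2 := Real.rpow_le_rpow (wnorm_nonneg' ρ w) hB.2 D.hϑ.le
  have h3 := wnorm_nonneg' (κ := κ) (lam := lam) ρ (v - w)
  have h4 := D.hθ
  have h5 := Real.rpow_nonneg hA.nonneg ϑ
  have h6 := Real.rpow_nonneg hB.nonneg ϑ
  gcongr
  exact hK.2

variable [DecidableEq I]

lemma prj_supp (S : Finset I) (v : I → ℝ) : ∀ i ∉ S, prj S v i = 0 := by
  intro i hi; simp [prj, hi]

lemma prj_wle (D : Hyp η κ lam δ T ϑ c θ ε α φ γ ρ ϱ χ F ℍ φhat Φ h) (S : Finset I) {v : I → ℝ}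
    {r K : ℝ} (hv : wle κ lam r v K) : wle κ lam r (prj S v) K :=
  hv.dom D.μpos (fun i => by unfold prj; split_ifs <;> simp)

lemma prj_sub (S : Finset I) (v w : I → ℝ) : prj S v - prj S w = prj S (v - w) := by
  funext i; simp only [prj, Pi.sub_apply]; split_ifs <;> simp

lemma prj_tendsto (D : Hyp η κ lam δ T ϑ c θ ε α φ γ ρ ϱ χ F ℍ φhat Φ h) {v : I → ℝ} {r : ℝ}
    (hv : memW κ lam r v) {e : ℝ} (he : 0 < e) :
    ∀ᶠ n in Filter.atTop, wle κ lam r (prj (ℍ n) v - v) e := by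
  have h1 := hv
  unfold memW at h1
  rw [summable_iff_vanishing_norm] at h1
  obtain ⟨S, hS⟩ := h1 (e ^ 2) (by positivity)
  have h2 : ∀ᶠ n in Filter.atTop, ∀ i ∈ S, i ∈ ℍ n :=
    (Filter.eventually_all_finset S).2 fun i _ => D.ev_mem i
  filter_upwards [h2] with n hn
  rw [wle_iff D.μpos he.le]
  intro U
  have h3 := hS (U \ ℍ n) (by
    rw [Finset.disjoint_left]; intro i hi hiS
    exact (Finset.mem_sdiff.1 hi).2 (hn i hiS))
  have h4 : ∑ i ∈ U, ((κ + lam i) ^ r * (prj (ℍ n) v - v) i) ^ 2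
      = ∑ i ∈ U \ ℍ n, (κ + lam i) ^ (2 * r) * v i ^ 2 := by
    rw [← Finset.sum_subset (Finset.sdiff_subset (s := U) (t := ℍ n))]
    · refine Finset.sum_congr rfl fun i hi => ?_
      rw [wterm D.μpos]
      simp [prj, (Finset.mem_sdiff.1 hi).2]
    · intro i hi hi2
      have : i ∈ ℍ n := by by_contra hc; exact hi2 (Finset.mem_sdiff.2 ⟨hi, hc⟩)
      simp [prj, this]
  rw [h4]
  exact (le_abs_self _).trans h3.le

lemma F_coord_tendsto (D : Hyp η κ lam δ T ϑ c θ ε α φ γ ρ ϱ χ F ℍ φhat Φ h) {v : I → ℝ}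
    (hv : memW κ lam ϱ v) (i : I) :
    Filter.Tendsto (fun n => F (prj (ℍ n) v) i) Filter.atTop (nhds (F v i)) := by
  rw [Metric.tendsto_atTop']
  intro e he
  have hp : 0 < (κ + lam i) ^ (- -α) := Real.rpow_pos_of_pos (D.μpos i) _
  obtain ⟨d, hd, h1⟩ := D.hFcont v hv (e / 2 / (κ + lam i) ^ (- -α)) (by positivity)
  obtain ⟨N, hN⟩ := Filter.eventually_atTop.1 (D.prj_tendsto hv hd)
  refine ⟨N, fun n hn => ?_⟩
  have hm := memW_fin (κ := κ) (lam := lam) ϱ (ℍ n) (prj_supp (ℍ n) v)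
  have h2 := h1 (prj (ℍ n) v) hm (hN n hn.le).2
  have h3 : wle κ lam (-α) (F (prj (ℍ n) v) - F v) _ :=
    ⟨(D.hFmap _ hm).sub D.μpos (D.hFmap _ hv), h2⟩
  have h4 := h3.coord' D.μpos i
  rw [mul_div_cancel₀ _ hp.ne'] at h4
  rw [Real.dist_eq]
  simp only [Pi.sub_apply] at h4
  linarith

lemma lip (D : Hyp η κ lam δ T ϑ c θ ε α φ γ ρ ϱ χ F ℍ φhat Φ h) {R : ℝ} (hR : 0 ≤ R) :
    ∃ L, LipBall κ lam ϱ α F R L := by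
  set E := δ ^ (ρ - ϱ)
  have hE : 0 ≤ E := Real.rpow_nonneg D.hδ.le _
  have hθ := D.hθ
  refine ⟨θ * (1 + (E * R) ^ ϑ + (E * R) ^ ϑ) * E, by positivity, ?_⟩
  intro v w K hv hw hK
  refine wle.lim D.μpos (f := fun n => F (prj (ℍ n) v) - F (prj (ℍ n) w))
    (Filter.Eventually.of_forall fun n => ?_)
    (fun i => (D.F_coord_tendsto hv.1 i).sub (D.F_coord_tendsto hw.1 i))
  have h1 := D.F_wle n (prj_supp (ℍ n) v) (prj_supp (ℍ n) w)
    ((D.prj_wle (ℍ n) hv).embed D.hδ D.hμ D.hρϱ.le) ((D.prj_wle (ℍ n) hw).embed D.hδ D.hμ D.hρϱ.le)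
    (K := E * K) (by
      rw [prj_sub]
      exact (D.prj_wle (ℍ n) hK).embed D.hδ D.hμ D.hρϱ.le)
  refine h1.mono (le_of_eq ?_)
  simp only [E]; ring

lemma F_bdd (D : Hyp η κ lam δ T ϑ c θ ε α φ γ ρ ϱ χ F ℍ φhat Φ h) {R : ℝ} (hR : 0 ≤ R) :
    ∃ M, 0 ≤ M ∧ ∀ v, wle κ lam ϱ v R → wle κ lam (-α) (F v) M := by
  classical
  obtain ⟨L, hL⟩ := D.lip hR
  have hL0 := hL.1
  have h0 := D.hFmap 0 (wle_zero D.μpos ϱ hR).1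
  refine ⟨L * R + wnorm κ lam (-α) (F 0), add_nonneg (by positivity) (wnorm_nonneg' _ _),
    fun v hv => ?_⟩
  have h1 := (hL.2 v 0 R hv (wle_zero D.μpos ϱ hR) (by simpa using hv)).add D.μpos h0.wle
  rwa [sub_add_cancel] at h1

lemma sol_AS (D : Hyp η κ lam δ T ϑ c θ ε α φ γ ρ ϱ χ F ℍ φhat Φ h) {o X : ℝ → I → ℝ}
    (hX : ContPathW κ lam ϱ T X) {R : ℝ} (hR : ∀ t ∈ Set.Icc 0 T, wle κ lam ϱ (X t) R)
    (heq : ∀ t ∈ Set.Icc 0 T, ∀ i, X t i = conv lam (fun s => F (X s)) 0 t i + o t i) :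
    AS κ lam ϱ F o R T 0 X X := by
  refine ⟨fun i => (F_cont D.μpos D.hFmap D.hFcont hX).integrable D.μpos D.hT.le i,
    fun s hs => ⟨hR s ⟨hs.1, hs.2.le⟩, ?_⟩, fun t ht => ?_⟩
  · rw [sub_self]; exact wle_zero D.μpos _ le_rfl
  · have : X t - conv lam (fun s => F (X s)) 0 t - o t = 0 := by
      funext i
      simp only [Pi.sub_apply, Pi.zero_apply]
      rw [heq t ht i]; ring
    rw [this]; exact wle_zero D.μpos _ le_rfl

lemma unique (D : Hyp η κ lam δ T ϑ c θ ε α φ γ ρ ϱ χ F ℍ φhat Φ h) {o X Z : ℝ → I → ℝ}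
    (hX : ContPathW κ lam ϱ T X) (hZ : ContPathW κ lam ϱ T Z)
    (heX : ∀ t ∈ Set.Icc 0 T, ∀ i, X t i = conv lam (fun s => F (X s)) 0 t i + o t i)
    (heZ : ∀ t ∈ Set.Icc 0 T, ∀ i, Z t i = conv lam (fun s => F (Z s)) 0 t i + o t i) :
    ∀ t ∈ Set.Icc 0 T, X t = Z t := by
  classical
  obtain ⟨B1, hB1, h1⟩ := hX.bdd D.μpos
  obtain ⟨B2, hB2, h2⟩ := hZ.bdd D.μpos
  have hR : 0 ≤ max B1 B2 := hB1.trans (le_max_left _ _)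
  obtain ⟨L, hL⟩ := D.lip hR
  obtain ⟨K, hK, hcmp⟩ := compare D.hκ (T := T) D.μpos (α := α) (ϱ := ϱ)
    (by linarith [D.hρα, D.hρϱ]) (by linarith [D.hϱα]) o hL
  intro t ht
  have h3 := hcmp T 0 0 X X Z Z D.hT.le le_rfl le_rfl le_rfl
    (D.sol_AS hX (fun t ht => (h1 t ht).mono (le_max_left _ _)) heX)
    (D.sol_AS hZ (fun t ht => (h2 t ht).mono (le_max_right _ _)) heZ) t ht
  rw [add_zero, mul_zero] at h3
  exact sub_eq_zero.1 (h3.zero_of D.μpos)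

end Hyp


lemma int_hasDeriv {f : ℝ → ℝ} {T t : ℝ} (ht : t ∈ Set.Ico 0 T)
    (hf : IntervalIntegrable f volume 0 T) (hc : ContinuousWithinAt f (Set.Ici t) t) :
    HasDerivWithinAt (fun t => ∫ s in (0:ℝ)..t, f s) (f t) (Set.Ici t) t := by
  have := conv_hasDeriv (I := Unit) (ν := fun _ => 0) (f := fun s _ => f s) (i := ()) ht hf hc
  simpa [conv] using this

lemma int_cont {f : ℝ → ℝ} {T : ℝ} (hT : 0 ≤ T)
    (hf : IntervalIntegrable f volume 0 T) :
    ContinuousOn (fun t => ∫ s in (0:ℝ)..t, f s) (Set.Icc 0 T) := by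
  have := conv_continuousOn (I := Unit) (ν := fun _ => 0) (f := fun s _ => f s) (i := ()) hT hf
  simpa [conv] using this

lemma gron {T h b C : ℝ} (hT : 0 < T) (hh : 0 < h) (hb : 0 ≤ b) (hC : 0 ≤ C) {p W1 W2 : ℝ → ℝ}
    (hp : ∀ u, 0 ≤ p u) (hW1 : ∀ u, 0 ≤ W1 u) (hW2 : ∀ u ∈ Set.Icc 0 T, 0 ≤ W2 u)
    (hW2c : ContinuousOn W2 (Set.Icc 0 T)) {E E' : ℝ → ℝ} (hE0 : E 0 = 0)
    (hEc : ContinuousOn E (Set.Icc 0 T))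
    (hE : ∀ t ∈ Set.Ico 0 T, HasDerivWithinAt E (E' t) (Set.Ici t) t)
    (hE' : ∀ t ∈ Set.Ico 0 T, E' t ≤ (2 * p (fl h t) + b) * E t + C * (W1 (fl h t) + W2 t)) :
    ∀ t ∈ Set.Icc 0 T, E t ≤ Real.exp (b * T) * C * ∫ r in (0:ℝ)..T,
      Real.exp (∫ u in r..T, 2 * p (fl h u)) * (W1 (fl h r) + W2 r) := by
  have hpi : ∀ a b, IntervalIntegrable (fun u => 2 * p (fl h u)) volume a b :=
    fun a b => fl_integrable hh (fun u => 2 * p u) a b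
  set A : ℝ → ℝ := fun t => ∫ u in (0:ℝ)..t, 2 * p (fl h u) with hA
  have hAc : ContinuousOn A (Set.Icc 0 T) := int_cont hT.le (hpi 0 T)
  have hAd : ∀ t ∈ Set.Ico 0 T, HasDerivWithinAt A (2 * p (fl h t)) (Set.Ici t) t := fun t ht =>
    int_hasDeriv ht (hpi 0 T) (fl_right_cont hh (fun u => 2 * p u) t)
  set w : ℝ → ℝ := fun s => W1 (fl h s) + W2 s with hw
  have hw0 : ∀ s ∈ Set.Icc 0 T, 0 ≤ w s := fun s hs => add_nonneg (hW1 _) (hW2 s hs)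
  have hui : Set.uIcc 0 T = Set.Icc 0 T := Set.uIcc_of_le hT.le
  have hwi : IntervalIntegrable w volume 0 T :=
    (fl_integrable hh W1 0 T).add (ContinuousOn.intervalIntegrable (by rw [hui]; exact hW2c))
  have hgi : IntervalIntegrable (fun s => Real.exp (-A s) * w s) volume 0 T := by
    refine hwi.continuousOn_mul ?_
    rw [hui]; exact Real.continuous_exp.comp_continuousOn hAc.neg
  have hrc : ∀ t ∈ Set.Ico 0 T, ∀ g : ℝ → ℝ, ContinuousOn g (Set.Icc 0 T) →
      ContinuousWithinAt g (Set.Ici t) t := by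
    intro t ht g hg
    refine (hg t ⟨ht.1, ht.2.le⟩).mono_of_mem_nhdsWithin ?_
    exact Filter.mem_of_superset (Icc_mem_nhdsGE ht.2) (Set.Icc_subset_Icc_left ht.1)
  have hgc : ∀ t ∈ Set.Ico 0 T, ContinuousWithinAt (fun s => Real.exp (-A s) * w s) (Set.Ici t) t := by
    intro t ht
    refine ((hrc t ht _ hAc).neg.rexp).mul ?_
    exact (fl_right_cont hh W1 t).add (hrc t ht _ hW2c)
  have key := image_le_of_deriv_right_le_deriv_boundary (a := 0) (b := T)
    (f := fun t => Real.exp (-A t - b * t) * E t)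
    (f' := fun t => Real.exp (-A t - b * t) * (-(2 * p (fl h t)) - b) * E t
      + Real.exp (-A t - b * t) * E' t)
    (B := fun t => C * ∫ s in (0:ℝ)..t, Real.exp (-A s) * w s)
    (B' := fun t => C * (Real.exp (-A t) * w t))
    (by
      refine ContinuousOn.mul (Real.continuous_exp.comp_continuousOn
        (hAc.neg.sub (by fun_prop))) hEc)
    (by
      intro t ht
      have h1 : HasDerivWithinAt (fun t => -A t - b * t) (-(2 * p (fl h t)) - b) (Set.Ici t) t := by
        have := (hAd t ht).neg.sub ((hasDerivWithinAt_id t (Set.Ici t)).const_mul b)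
        rw [mul_one] at this; exact this
      exact h1.exp.mul (hE t ht))
    (by simp [hE0])
    ((int_cont hT.le hgi).const_smul C)
    (by
      intro t ht
      exact (int_hasDeriv ht hgi (hgc t ht)).const_mul C)
    (by
      intro t ht
      have h1 := hE' t ht
      have h2 : Real.exp (-A t - b * t) ≤ Real.exp (-A t) := by
        apply Real.exp_le_exp.2; have := mul_nonneg hb ht.1; linarith
      have h3 := mul_nonneg hC (hw0 t ⟨ht.1, ht.2.le⟩)
      have h4 := Real.exp_pos (-A t - b * t)
      have h5 : Real.exp (-A t - b * t) * (-(2 * p (fl h t)) - b) * E t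
          + Real.exp (-A t - b * t) * E' t ≤ Real.exp (-A t - b * t) * (C * w t) := by
        have : E' t - (2 * p (fl h t) + b) * E t ≤ C * w t := by simp only [hw]; linarith
        calc _ = Real.exp (-A t - b * t) * (E' t - (2 * p (fl h t) + b) * E t) := by ring
          _ ≤ _ := by gcongr
      calc _ ≤ _ := h5
        _ ≤ Real.exp (-A t) * (C * w t) := by gcongr
        _ = _ := by ring)
  intro t ht
  have h1 := key ht
  have hAmono : A t ≤ A T := by
    have : A T - A t = ∫ u in t..T, 2 * p (fl h u) := by
      simp only [hA]; exact intervalIntegral.integral_interval_sub_left (hpi _ _) (hpi _ _)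
    have h2 : 0 ≤ ∫ u in t..T, 2 * p (fl h u) :=
      intervalIntegral.integral_nonneg ht.2 fun u _ => by have := hp (fl h u); linarith
    linarith
  have hg0 : ∀ s ∈ Set.Icc 0 T, 0 ≤ Real.exp (-A s) * w s := fun s hs =>
    mul_nonneg (Real.exp_pos _).le (hw0 s hs)
  have h2 : (∫ s in (0:ℝ)..t, Real.exp (-A s) * w s) ≤ ∫ s in (0:ℝ)..T, Real.exp (-A s) * w s := by
    apply intervalIntegral.integral_mono_interval le_rfl ht.1 ht.2 _ hgi
    filter_upwards [ae_restrict_mem measurableSet_Ioc] with s hs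
    exact hg0 s ⟨hs.1.le, hs.2⟩
  have h20 : 0 ≤ ∫ s in (0:ℝ)..T, Real.exp (-A s) * w s :=
    intervalIntegral.integral_nonneg hT.le hg0
  have h3 : (∫ r in (0:ℝ)..T, Real.exp (∫ u in r..T, 2 * p (fl h u)) * (W1 (fl h r) + W2 r))
      = Real.exp (A T) * ∫ s in (0:ℝ)..T, Real.exp (-A s) * w s := by
    rw [← intervalIntegral.integral_const_mul]
    refine intervalIntegral.integral_congr fun r _ => ?_
    have : (∫ u in r..T, 2 * p (fl h u)) = A T - A r := by
      simp only [hA]; exact (intervalIntegral.integral_interval_sub_left (hpi _ _) (hpi _ _)).symm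
    simp only [this, hw]
    rw [← mul_assoc, ← Real.exp_add, sub_eq_add_neg]
  rw [h3]
  have h4 : E t = Real.exp (A t + b * t) * (Real.exp (-A t - b * t) * E t) := by
    rw [← mul_assoc, ← Real.exp_add]; simp
  rw [h4]
  calc _ ≤ Real.exp (A t + b * t) * (C * ∫ s in (0:ℝ)..t, Real.exp (-A s) * w s) := by gcongr
    _ ≤ Real.exp (A T + b * T) * (C * ∫ s in (0:ℝ)..T, Real.exp (-A s) * w s) := by
        have : 0 ≤ ∫ s in (0:ℝ)..t, Real.exp (-A s) * w s :=
          intervalIntegral.integral_nonneg ht.1 fun s hs => hg0 s ⟨hs.1, hs.2.trans ht.2⟩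
        have h5 := ht.2
        gcongr
    _ = _ := by rw [Real.exp_add]; ring


section
variable {I : Type*} [DecidableEq I]

/-- the forcing step function of the scheme -/
noncomputable def stepG (κ : ℝ) (lam : I → ℝ) (ϱ χ : ℝ) (F : (I → ℝ) → I → ℝ) (S : Finset I) (h : ℝ)
    (x o : ℝ → I → ℝ) : ℝ → I → ℝ := fun s =>
  if wnorm κ lam ϱ (x (fl h s)) + wnorm κ lam ϱ (o (fl h s)) ≤ h ^ (-χ)
    then prj S (F (x (fl h s))) else 0

/-- the pathwise numerical scheme -/
structure Sch (κ : ℝ) (lam : I → ℝ) (T ϱ χ : ℝ) (F : (I → ℝ) → I → ℝ) (S : Finset I) (h : ℝ)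
    (x o : ℝ → I → ℝ) : Prop where
  ocont : ContPathW κ lam ϱ T o
  osupp : ∀ t ∈ Set.Icc 0 T, ∀ i ∉ S, o t i = 0
  eq : ∀ t ∈ Set.Icc 0 T, ∀ i, x t i = conv lam (stepG κ lam ϱ χ F S h x o) 0 t i + o t i

/-- the correction convolution -/
noncomputable def qc (η : ℝ) (lam : I → ℝ) (o : ℝ → I → ℝ) (t : ℝ) : I → ℝ :=
  conv (fun i => lam i + η) (fun s i => η * o s i) 0 t

variable {κ : ℝ} {lam : I → ℝ} {T ϱ χ : ℝ} {F : (I → ℝ) → I → ℝ} {S : Finset I} {h : ℝ}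
    {x o : ℝ → I → ℝ}

lemma stepG_int (hh : 0 < h) (i : I) (a b : ℝ) :
    IntervalIntegrable (fun s => stepG κ lam ϱ χ F S h x o s i) volume a b :=
  fl_integrable hh (fun u => (if wnorm κ lam ϱ (x u) + wnorm κ lam ϱ (o u) ≤ h ^ (-χ)
    then prj S (F (x u)) else 0) i) a b

lemma stepG_rc (hh : 0 < h) (i : I) (t : ℝ) :
    ContinuousWithinAt (fun s => stepG κ lam ϱ χ F S h x o s i) (Set.Ici t) t :=
  fl_right_cont hh (fun u => (if wnorm κ lam ϱ (x u) + wnorm κ lam ϱ (o u) ≤ h ^ (-χ)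
    then prj S (F (x u)) else 0) i) t

lemma stepG_supp (s : ℝ) (i : I) (hi : i ∉ S) : stepG κ lam ϱ χ F S h x o s i = 0 := by
  unfold stepG prj; split_ifs <;> simp [hi]

lemma conv_supp {ν : I → ℝ} {f : ℝ → I → ℝ} {t0 t : ℝ} (ht : t0 ≤ t) {i : I}
    (hf : ∀ s ∈ Set.Icc t0 t, f s i = 0) : conv ν f t0 t i = 0 := by
  unfold conv
  rw [intervalIntegral.integral_congr (g := fun _ => 0)]
  · simp
  · intro s hs
    rw [Set.uIcc_of_le ht] at hs
    simp [hf s hs]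

lemma Sch.ysupp (_hs : Sch κ lam T ϱ χ F S h x o) {t : ℝ} (ht : t ∈ Set.Icc 0 T) :
    ∀ i ∉ S, conv lam (stepG κ lam ϱ χ F S h x o) 0 t i = 0 := fun i hi =>
  conv_supp ht.1 fun s _ => stepG_supp s i hi

lemma Sch.xsupp (hs : Sch κ lam T ϱ χ F S h x o) {t : ℝ} (ht : t ∈ Set.Icc 0 T) :
    ∀ i ∉ S, x t i = 0 := fun i hi => by
  rw [hs.eq t ht, hs.ysupp ht i hi, hs.osupp t ht i hi, add_zero]

lemma Sch.qsupp (hs : Sch κ lam T ϱ χ F S h x o) (η : ℝ) {t : ℝ} (ht : t ∈ Set.Icc 0 T) :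
    ∀ i ∉ S, qc η lam o t i = 0 := fun i hi =>
  conv_supp ht.1 fun s hs2 => by
    rw [hs.osupp s ⟨hs2.1, hs2.2.trans ht.2⟩ i hi, mul_zero]

lemma Sch.oint (hμ : ∀ i, 0 < κ + lam i) (hs : Sch κ lam T ϱ χ F S h x o) (η : ℝ) {t : ℝ}
    (ht : t ∈ Set.Icc 0 T) (i : I) :
    IntervalIntegrable (fun s => η * o s i) volume 0 t :=
  ((hs.ocont.integrable hμ (ht.1.trans ht.2) i).mono_set (by
    rw [Set.uIcc_of_le ht.1, Set.uIcc_of_le (ht.1.trans ht.2)]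
    exact Set.Icc_subset_Icc_right ht.2)).const_mul η

lemma conv_bound0 (hκ : 0 ≤ κ) {T : ℝ} (hμ : ∀ i, 0 < κ + lam i) {r a t0 t : ℝ} (ha : 0 ≤ a)
    (ha1 : a < 1) (h0 : t0 ≤ t) (hT : t - t0 ≤ T) {f : ℝ → I → ℝ} {M : ℝ}
    (hf : ∀ i, IntervalIntegrable (fun s => f s i) volume t0 t)
    (hfB : ∀ s ∈ Set.Ico t0 t, wle κ lam r (f s) M) :
    wle κ lam (r + a) (conv lam f t0 t) (Real.exp (κ * T) * ((t - t0) ^ (1 - a) / (1 - a)) * M) := by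
  have := conv_bound_const hκ le_rfl hμ ha ha1 h0 hT hf hfB
  simpa only [add_zero] using this

end

namespace Hyp
variable {I : Type*} {η κ : ℝ} {lam : I → ℝ} {δ T ϑ c θ ε α φ γ ρ ϱ χ : ℝ}
    {F : (I → ℝ) → I → ℝ} {ℍ : ℕ → Finset I} {φhat Φ : (I → ℝ) → ℝ} {h : ℕ → ℝ} [DecidableEq I]

set_option maxHeartbeats 1600000 in
lemma active_est (D : Hyp η κ lam δ T ϑ c θ ε α φ γ ρ ϱ χ F ℍ φhat Φ h) {B : ℝ} (hB : 0 ≤ B) :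
    ∃ C3, 0 ≤ C3 ∧ ∀ (n : ℕ) (x o : ℝ → I → ℝ), h n ≤ 1 → Sch κ lam T ϱ χ F (ℍ n) (h n) x o →
      (∀ t ∈ Set.Icc 0 T, wle κ lam ϱ (o t) B) → ∀ t ∈ Set.Ico 0 T,
      wnorm κ lam ϱ (x (fl (h n) t)) + wnorm κ lam ϱ (o (fl (h n) t)) ≤ h n ^ (-χ) →
      wle κ lam (-α) (F (x (fl (h n) t)) -
        F (conv lam (stepG κ lam ϱ χ F (ℍ n) (h n) x o) 0 t + qc η lam o t +
          (o (fl (h n) t) - qc η lam o (fl (h n) t)))) C3 := by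
  have hμ := D.μpos
  have hκ := D.hκ
  have hη := D.hη
  have hδ := D.hδ
  have hθ := D.hθ
  have hϑ := D.hϑ
  have hσ0 : 0 < ϱ - ρ := by linarith [D.hρϱ]
  have hσ1 : ϱ - ρ < 1 := by linarith [D.hϱα, D.hρα]
  have hb1 : α + ρ < 1 := by linarith [D.hϱα, D.hρϱ]
  have hb0 : 0 ≤ α + ρ := by linarith [D.hρα]
  obtain ⟨Cq, hCq, hq⟩ := conv_holder (κ := κ) (lam := lam) D.hκ D.hη D.hT D.hδ D.hμ (r := ρ)
    (a := 0) (σ := ϱ - ρ) le_rfl hσ0.le (by linarith)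
  set E := δ ^ (ρ - ϱ) with hE
  have hE0 : 0 ≤ E := Real.rpow_nonneg hδ.le _
  set D2 := Real.exp (κ * T) * (1 + κ / δ) with hD2
  have hD20 : 0 ≤ D2 := by positivity
  set N0 := wnorm κ lam (-α) (F 0) with hN0
  have hN00 : 0 ≤ N0 := wnorm_nonneg' _ _
  set K6 := Real.exp (κ * T) / (1 - (α + ρ)) * (N0 + θ * (1 + E ^ ϑ) * E) with hK6
  have hK60 : 0 ≤ K6 := by
    have : 0 < 1 - (α + ρ) := by linarith
    positivity
  set C8 := D2 + K6 + Cq * (η * (E * B)) with hC8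
  have hC80 : 0 ≤ C8 := by positivity
  refine ⟨θ * (1 + E ^ ϑ + (E + C8) ^ ϑ) * C8, by positivity, ?_⟩
  intro n x o hn1 hs ho t ht hact
  have hhp := (D.hh n).1
  set hn := h n with hhn
  set H := hn ^ (-χ) with hH
  have hH1 : 1 ≤ H := Real.one_le_rpow_of_pos_of_le_one_of_nonpos hhp hn1 (by linarith [D.hχ0])
  have hH0 : 0 < H := by linarith
  have ht' : t ∈ Set.Icc 0 T := ⟨ht.1, ht.2.le⟩
  set t0 := fl hn t with ht0
  have ht0m : t0 ∈ Set.Icc 0 T := fl_mem hhp ht'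
  have ht0t : t0 ≤ t := fl_le hhp t
  have htt0 : t - t0 ≤ hn := by have := lt_fl hhp t; linarith
  have htt00 : 0 ≤ t - t0 := by linarith
  have htT : t - t0 ≤ T := by linarith [ht.2, ht0m.1]
  set g := stepG κ lam ϱ χ F (ℍ n) hn x o with hg
  set y := conv lam g 0 with hy
  have hmx : memW κ lam ϱ (x t0) := memW_fin ϱ (ℍ n) (hs.xsupp ht0m)
  have hmo : memW κ lam ϱ (o t0) := hs.ocont.1 t0 ht0m
  have hxH : wle κ lam ϱ (x t0) H := ⟨hmx, by
    have := wnorm_nonneg' (κ := κ) (lam := lam) ϱ (o t0); linarith⟩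
  have hyH : wle κ lam ϱ (y t0) H := by
    have : y t0 = x t0 - o t0 := by funext i; simp [hs.eq t0 ht0m i, hy, hg]
    rw [this]
    exact ((hmx.wle).sub hμ hmo.wle).mono hact
  have hxρ : wle κ lam ρ (x t0) (E * H) := hxH.embed hδ D.hμ D.hρϱ.le
  -- F(x t0) bound
  have h0s : ∀ i ∉ ℍ n, (0 : I → ℝ) i = 0 := fun i _ => rfl
  have hFx : wle κ lam (-α) (F (x t0)) ((N0 + θ * (1 + E ^ ϑ) * E) * (H ^ (1 + ϑ))) := by
    have h1 := D.F_wle n (hs.xsupp ht0m) h0s hxρ (wle_zero hμ ρ le_rfl) (by simpa using hxρ)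
    have h2 : wle κ lam (-α) (F 0) N0 := (D.hFmap 0 (memW_fin ϱ (ℍ n) h0s)).wle
    have h3 := h1.add hμ h2
    rw [sub_add_cancel] at h3
    refine h3.mono ?_
    rw [Real.zero_rpow hϑ.ne', add_zero, Real.mul_rpow hE0 hH0.le]
    have e1 : H ^ (1 + ϑ) = H * H ^ ϑ := by rw [Real.rpow_add hH0, Real.rpow_one]
    have e2 : 1 ≤ H ^ ϑ := Real.one_le_rpow hH1 hϑ.le
    rw [e1]
    have e3 : 1 ≤ H * H ^ ϑ := by nlinarith
    have e4 : 0 ≤ E ^ ϑ := Real.rpow_nonneg hE0 _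
    calc θ * (1 + E ^ ϑ * H ^ ϑ) * (E * H) + N0
        ≤ θ * (H ^ ϑ + E ^ ϑ * H ^ ϑ) * (E * H) + N0 * (H * H ^ ϑ) := by
          gcongr
          nlinarith
      _ = _ := by ring
  have hgc : ∀ s ∈ Set.Ico t0 t, wle κ lam (-α) (g s) ((N0 + θ * (1 + E ^ ϑ) * E) * (H ^ (1 + ϑ))) := by
    intro s hs2
    have e : fl hn s = t0 := fl_const hhp hs2.1 (hs2.2.trans (lt_fl hhp t))
    have : g s = prj (ℍ n) (F (x t0)) := by
      simp only [hg, stepG]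
      rw [e, if_pos hact]
    rw [this]
    exact D.prj_wle _ hFx
  have hII := conv_bound0 hκ (T := T) hμ hb0 hb1 ht0t htT (fun i => stepG_int hhp i t0 t) hgc
  -- powers
  have p1 : hn ^ (ϱ - ρ) * H ≤ H ^ (-ϑ) := by
    rw [hH, ← Real.rpow_add hhp, ← Real.rpow_mul hhp.le]
    apply Real.rpow_le_rpow_of_exponent_ge hhp hn1
    have := D.hχ1; nlinarith
  have p1' : hn ^ (ϱ - ρ) ≤ H ^ (-ϑ) := by
    refine le_trans ?_ p1
    exact le_mul_of_one_le_right (Real.rpow_nonneg hhp.le _) hH1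
  have p2 : hn ^ (1 - (α + ρ)) * H ^ (1 + ϑ) ≤ H ^ (-ϑ) := by
    rw [hH, ← Real.rpow_mul hhp.le, ← Real.rpow_add hhp, ← Real.rpow_mul hhp.le]
    apply Real.rpow_le_rpow_of_exponent_ge hhp hn1
    have := D.hχ2; nlinarith
  have hHϑ : 0 ≤ H ^ (-ϑ) := Real.rpow_nonneg hH0.le _
  have hyinc : wle κ lam ρ (y t - y t0) ((D2 + K6) * H ^ (-ϑ)) := by
    have e1 : y t - y t0 = (fun i => (Real.exp (-((t - t0) * lam i)) - 1) * y t0 i) + conv lam g t0 t := by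
      funext i
      have := conv_split (ν := lam) ht0m.1 ht0t (stepG_int (κ := κ) (lam := lam) (ϱ := ϱ) (χ := χ)
        (F := F) (S := ℍ n) (x := x) (o := o) hhp i 0 t)
      simp only [Pi.sub_apply, Pi.add_apply, hy, hg]
      rw [this]; ring
    rw [e1]
    have e2 : wle κ lam ρ (fun i => (Real.exp (-((t - t0) * lam i)) - 1) * y t0 i)
        ((D2 * (t - t0) ^ (ϱ - ρ)) * H) := by
      refine wle.of_abs hμ hyH (mul_nonneg hD20 (Real.rpow_nonneg htt00 _)) fun i => ?_
      have h1 := incr_bd (lam := lam) hκ (le_refl (0:ℝ)) hδ D.hμ htt00 htT hσ0.le hσ1.le i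
      simp only [add_zero] at h1
      rw [abs_mul]
      calc _ ≤ (κ + lam i) ^ ρ * ((D2 * ((t - t0) ^ (ϱ - ρ) * (κ + lam i) ^ (ϱ - ρ))) * |y t0 i|) := by
            have := Real.rpow_nonneg (hμ i).le ρ
            gcongr
        _ = D2 * (t - t0) ^ (ϱ - ρ) * (((κ + lam i) ^ ρ * (κ + lam i) ^ (ϱ - ρ)) * |y t0 i|) := by ring
        _ = _ := by rw [← Real.rpow_add (hμ i)]; congr 4; ring
    have e3 : -α + (α + ρ) = ρ := by ring
    rw [e3] at hII
    refine (e2.add hμ hII).mono ?_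
    have f1 : (t - t0) ^ (ϱ - ρ) ≤ hn ^ (ϱ - ρ) := Real.rpow_le_rpow htt00 htt0 hσ0.le
    have f2 : (t - t0) ^ (1 - (α + ρ)) ≤ hn ^ (1 - (α + ρ)) :=
      Real.rpow_le_rpow htt00 htt0 (by linarith)
    have f3 : 0 < 1 - (α + ρ) := by linarith
    have f4 : 0 ≤ N0 + θ * (1 + E ^ ϑ) * E := by positivity
    calc _ ≤ D2 * hn ^ (ϱ - ρ) * H + Real.exp (κ * T) * (hn ^ (1 - (α + ρ)) / (1 - (α + ρ))) *
          ((N0 + θ * (1 + E ^ ϑ) * E) * H ^ (1 + ϑ)) := by gcongr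
      _ = D2 * (hn ^ (ϱ - ρ) * H) + K6 * (hn ^ (1 - (α + ρ)) * H ^ (1 + ϑ)) := by
          simp only [hK6]; field_simp
      _ ≤ D2 * H ^ (-ϑ) + K6 * H ^ (-ϑ) := by gcongr
      _ = _ := by ring
  have hqinc : wle κ lam ρ (qc η lam o t - qc η lam o t0) (Cq * (η * (E * B)) * H ^ (-ϑ)) := by
    have := hq (fun s i => η * o s i) (η * (E * B)) t0 t ht0m.1 ht0t ht.2.le (by positivity)
      (fun i => hs.oint hμ η ht' i) (fun s hs2 => by
        have h1 := ((ho s ⟨hs2.1, (hs2.2.trans ht.2).le⟩).embed hδ D.hμ D.hρϱ.le).smul hμ η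
        rw [abs_of_nonneg hη] at h1
        exact h1)
    rw [add_zero] at this
    refine this.mono ?_
    have f1 : (t - t0) ^ (ϱ - ρ) ≤ hn ^ (ϱ - ρ) := Real.rpow_le_rpow htt00 htt0 hσ0.le
    gcongr
    exact f1.trans p1'
  set z := y t + qc η lam o t + (o t0 - qc η lam o t0) with hz
  have hzx : z - x t0 = (y t - y t0) + (qc η lam o t - qc η lam o t0) := by
    funext i
    simp only [hz, Pi.sub_apply, Pi.add_apply, hs.eq t0 ht0m i]
    simp only [hy, hg]; ring
  have hzxw : wle κ lam ρ (z - x t0) (C8 * H ^ (-ϑ)) := by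
    rw [hzx]; exact (hyinc.add hμ hqinc).mono (le_of_eq (by simp only [hC8]; ring))
  have hzs : ∀ i ∉ ℍ n, z i = 0 := by
    intro i hi
    simp only [hz, Pi.add_apply, Pi.sub_apply, hs.osupp t0 ht0m i hi, hs.qsupp η ht' i hi,
      hs.qsupp η ht0m i hi, hy]
    have := hs.ysupp ht' i hi
    simp only [hg]
    simp [this]
  have hzw : wle κ lam ρ z ((E + C8) * H) := by
    have h1 := hzxw.add hμ hxρ
    rw [sub_add_cancel] at h1
    refine h1.mono ?_
    have h2 : H ^ (-ϑ) ≤ H := by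
      have h3 : H ^ (-ϑ) ≤ 1 := Real.rpow_le_one_of_one_le_of_nonpos hH1 (by linarith)
      linarith
    nlinarith [mul_le_mul_of_nonneg_left h2 hC80]
  have hfin := D.F_wle n (hs.xsupp ht0m) hzs hxρ hzw (hzxw.symm hμ)
  refine hfin.mono ?_
  rw [Real.mul_rpow hE0 hH0.le, Real.mul_rpow (by positivity) hH0.le, Real.rpow_neg hH0.le]
  have e2 : 1 ≤ H ^ ϑ := Real.one_le_rpow hH1 hϑ.le
  have e5 : 0 ≤ E ^ ϑ := Real.rpow_nonneg hE0 _
  have e6 : 0 ≤ (E + C8) ^ ϑ := Real.rpow_nonneg (by positivity) _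
  calc _ ≤ θ * (H ^ ϑ + E ^ ϑ * H ^ ϑ + (E + C8) ^ ϑ * H ^ ϑ) * (C8 * (H ^ ϑ)⁻¹) := by gcongr
    _ = _ := by
      have : H ^ ϑ ≠ 0 := by positivity
      field_simp

end Hyp


namespace Hyp
variable {I : Type*} {η κ : ℝ} {lam : I → ℝ} {δ T ϑ c θ ε α φ γ ρ ϱ χ : ℝ}
    {F : (I → ℝ) → I → ℝ} {ℍ : ℕ → Finset I} {φhat Φ : (I → ℝ) → ℝ} {h : ℕ → ℝ} [DecidableEq I]

lemma cs_est (D : Hyp η κ lam δ T ϑ c θ ε α φ γ ρ ϱ χ F ℍ φhat Φ h) {C3 : ℝ} (S : Finset I)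
    {v d : I → ℝ} (hd : wle κ lam (-α) d C3) :
    ∑ i ∈ S, v i * d i ≤ (1 - φ) * (∑ i ∈ S, (η + lam i) * v i ^ 2)
      + C3 ^ 2 * (δ ^ (2 * α - 1) * (1 + κ / δ)) / (1 - φ) := by
  have hφ : 0 < 1 - φ := by linarith [D.hφ1]
  set C9 := δ ^ (2 * α - 1) * (1 + κ / δ) with hC9
  have hδ := D.hδ
  have hκ := D.hκ
  have hC9p : 0 < C9 := by positivity
  have h1 := hd.fin D.μpos S
  have h2 : ∀ i ∈ S, v i * d i ≤ (1 - φ) * ((η + lam i) * v i ^ 2)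
      + C9 / (1 - φ) * ((κ + lam i) ^ (-α) * d i) ^ 2 := by
    intro i _
    have hμ := D.μpos i
    set m := (κ + lam i) ^ α with hm
    have hmp : 0 < m := Real.rpow_pos_of_pos hμ _
    have e1 : (κ + lam i) ^ (-α) = m⁻¹ := Real.rpow_neg hμ.le _
    have e2 : m ^ 2 ≤ C9 * (η + lam i) := by
      have : m ^ 2 = (κ + lam i) * (κ + lam i) ^ (2 * α - 1) := by
        rw [hm, ← Real.rpow_natCast, ← Real.rpow_mul hμ.le]
        nth_rewrite 2 [← Real.rpow_one (κ + lam i)]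
        rw [← Real.rpow_add hμ]; congr 1; push_cast; ring
      rw [this]
      have a1 : (κ + lam i) ^ (2 * α - 1) ≤ δ ^ (2 * α - 1) :=
        Real.rpow_le_rpow_of_nonpos hδ (D.hμ i) (by linarith [D.hα1])
      have a2 : κ + lam i ≤ (1 + κ / δ) * (η + lam i) := by
        have b1 : κ / δ * δ ≤ κ / δ * (η + lam i) := by
          have := D.hν i; gcongr
        rw [div_mul_cancel₀ _ hδ.ne'] at b1
        have := D.hη; nlinarith
      calc _ ≤ ((1 + κ / δ) * (η + lam i)) * δ ^ (2 * α - 1) := by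
            have := D.hν i
            gcongr
            exact hμ.le.trans a2
        _ = _ := by rw [hC9]; ring
    rw [e1]
    have e3 : v i * d i = (m * v i) * (m⁻¹ * d i) := by field_simp
    rw [e3]
    set p := m * v i
    set r := m⁻¹ * d i
    have e4 : p ^ 2 / C9 ≤ (η + lam i) * v i ^ 2 := by
      rw [div_le_iff₀ hC9p]; simp only [p, mul_pow]; nlinarith [sq_nonneg (v i)]
    have e5 : p * r ≤ (1 - φ) * (p ^ 2 / C9) + C9 / (1 - φ) * r ^ 2 := by
      have : 0 ≤ ((1 - φ) * p - C9 * r) ^ 2 := sq_nonneg _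
      have e6 : (1 - φ) * (p ^ 2 / C9) + C9 / (1 - φ) * r ^ 2 - 2 * (p * r)
         = ((1 - φ) * p - C9 * r) ^ 2 / (C9 * (1 - φ)) := by field_simp; ring
      have e7 : 0 ≤ ((1 - φ) * p - C9 * r) ^ 2 / (C9 * (1 - φ)) := by positivity
      have e8 : 0 ≤ (1 - φ) * (p ^ 2 / C9) + C9 / (1 - φ) * r ^ 2 := by positivity
      linarith
    nlinarith
  refine (Finset.sum_le_sum h2).trans ?_
  rw [Finset.sum_add_distrib, ← Finset.mul_sum, ← Finset.mul_sum]
  have h3 : C9 / (1 - φ) * ∑ i ∈ S, ((κ + lam i) ^ (-α) * d i) ^ 2 ≤ C9 / (1 - φ) * C3 ^ 2 := by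
    gcongr
  have h4 : C3 ^ 2 * C9 / (1 - φ) = C9 / (1 - φ) * C3 ^ 2 := by ring
  linarith

set_option maxHeartbeats 1000000 in
lemma energy (D : Hyp η κ lam δ T ϑ c θ ε α φ γ ρ ϱ χ F ℍ φhat Φ h) {B : ℝ} (hB : 0 ≤ B) :
    ∃ C11, 0 ≤ C11 ∧ ∀ (n : ℕ) (x o : ℝ → I → ℝ), h n ≤ 1 → Sch κ lam T ϱ χ F (ℍ n) (h n) x o →
      (∀ t ∈ Set.Icc 0 T, wle κ lam ϱ (o t) B) → ∀ Ic : ℝ, 0 ≤ Ic → ∀ t ∈ Set.Icc 0 T,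
      ∑ i ∈ ℍ n, (conv lam (stepG κ lam ϱ χ F (ℍ n) (h n) x o) 0 t i + qc η lam o t i) ^ 2 ≤
       C11 * ∫ r in (0:ℝ)..T,
        Real.exp (∫ u in r..T, 2 * φhat (o (fl (h n) u) - qc η lam o (fl (h n) u))) *
          (1 + Φ (o (fl (h n) r) - qc η lam o (fl (h n) r)) + Ic +
            wnorm κ lam 0 (o r - qc η lam o r) ^ 2) := by
  obtain ⟨C3, hC3, hact⟩ := D.active_est hB
  have hφ : 0 < 1 - φ := by linarith [D.hφ1]
  have hδ := D.hδ
  have hκ := D.hκ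
  have hη := D.hη
  have hμ := D.μpos
  set C10 := C3 ^ 2 * (δ ^ (2 * α - 1) * (1 + κ / δ)) / (1 - φ) with hC10
  have hC100 : 0 ≤ C10 := by positivity
  refine ⟨Real.exp (3 * η * T) * (2 + η + 2 * C10), by positivity, ?_⟩
  intro n x o hn1 hs ho Ic hIc
  have hhp := (D.hh n).1
  set g := stepG κ lam ϱ χ F (ℍ n) (h n) x o with hg
  set y := conv lam g 0 with hy
  set q := qc η lam o with hq
  set OO : ℝ → I → ℝ := fun t => o t - q t with hOO
  have hTI : T ∈ Set.Icc 0 T := ⟨D.hT.le, le_rfl⟩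
  have hOs : ∀ t ∈ Set.Icc 0 T, ∀ i ∉ ℍ n, OO t i = 0 := by
    intro t ht i hi
    simp only [hOO, Pi.sub_apply, hs.osupp t ht i hi, hq, hs.qsupp η ht i hi, sub_zero]
  have hyc : ∀ i, ContinuousOn (fun t => y t i) (Set.Icc 0 T) := fun i =>
    conv_continuousOn D.hT.le (stepG_int hhp i 0 T)
  have hqcn : ∀ i, ContinuousOn (fun t => q t i) (Set.Icc 0 T) := fun i =>
    conv_continuousOn (f := fun s i => η * o s i) D.hT.le (hs.oint hμ η hTI i)
  have hoc := fun i => hs.ocont.coord hμ i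
  have hrc : ∀ t ∈ Set.Ico 0 T, ∀ g : ℝ → ℝ, ContinuousOn g (Set.Icc 0 T) →
      ContinuousWithinAt g (Set.Ici t) t := by
    intro t ht g hg
    refine (hg t ⟨ht.1, ht.2.le⟩).mono_of_mem_nhdsWithin ?_
    exact Filter.mem_of_superset (Icc_mem_nhdsGE ht.2) (Set.Icc_subset_Icc_left ht.1)
  have hyd : ∀ t ∈ Set.Ico 0 T, ∀ i, HasDerivWithinAt (fun t => y t i) (-lam i * y t i + g t i)
      (Set.Ici t) t := fun t ht i => conv_hasDeriv ht (stepG_int hhp i 0 T) (stepG_rc hhp i t)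
  have hqd : ∀ t ∈ Set.Ico 0 T, ∀ i, HasDerivWithinAt (fun t => q t i)
      (-(lam i + η) * q t i + η * o t i) (Set.Ici t) t := fun t ht i =>
    conv_hasDeriv (f := fun s i => η * o s i) ht (hs.oint hμ η hTI i)
      (hrc t ht _ ((hoc i).const_smul η))
  have key := gron (T := T) (h := h n) (b := 3 * η) (C := 2 + η + 2 * C10) D.hT hhp (by positivity)
    (by positivity) (p := fun u => φhat (OO u)) (W1 := fun u => 1 + Φ (OO u) + Ic)
    (W2 := fun u => wnorm κ lam 0 (OO u) ^ 2) (fun u => D.hφhat _)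
    (fun u => by have := D.hΦ (OO u); positivity) (fun u _ => sq_nonneg _)
    (by
      refine ContinuousOn.congr (f := fun u => ∑ i ∈ ℍ n, OO u i ^ 2) ?_ fun u hu =>
        wnorm_fin_zero (ℍ n) (hOs u hu)
      exact continuousOn_finsetSum _ fun i _ => ((hoc i).sub (hqcn i)).pow 2)
    (E := fun t => ∑ i ∈ ℍ n, (y t i + q t i) ^ 2)
    (E' := fun t => ∑ i ∈ ℍ n, 2 * ((y t i + q t i) *
      ((-lam i * y t i + g t i) + (-(lam i + η) * q t i + η * o t i))))
    (by simp [hy, hq, qc, conv])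
    (continuousOn_finsetSum _ fun i _ => ((hyc i).add (hqcn i)).pow 2)
    (by
      intro t ht
      refine HasDerivWithinAt.fun_sum fun i _ => ?_
      have := ((hyd t ht i).add (hqd t ht i)).pow 2
      refine this.congr_deriv ?_
      simp; ring)
    (by
      intro t ht
      have ht' : t ∈ Set.Icc 0 T := ⟨ht.1, ht.2.le⟩
      set v : I → ℝ := fun i => y t i + q t i with hv
      have hvs : ∀ i ∉ ℍ n, v i = 0 := by
        intro i hi
        have := hs.ysupp ht' i hi
        simp only [hv, hq, hs.qsupp η ht' i hi, hy, hg, this, add_zero]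
      set En := ∑ i ∈ ℍ n, v i ^ 2 with hEn
      set N := ∑ i ∈ ℍ n, (η + lam i) * v i ^ 2 with hN
      set w2 := wnorm κ lam 0 (OO t) ^ 2 with hw2
      have hw2' : w2 = ∑ i ∈ ℍ n, OO t i ^ 2 := wnorm_fin_zero (ℍ n) (hOs t ht')
      have hEn0 : 0 ≤ En := Finset.sum_nonneg fun i _ => sq_nonneg _
      have hN0 : 0 ≤ N := Finset.sum_nonneg fun i _ =>
        mul_nonneg (hδ.le.trans (D.hν i)) (sq_nonneg _)
      have hw20 : 0 ≤ w2 := sq_nonneg _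
      have hp0 := D.hφhat (OO (fl (h n) t))
      have hP0 := D.hΦ (OO (fl (h n) t))
      have hvg : ∑ i ∈ ℍ n, v i * g t i ≤ φhat (OO (fl (h n) t)) * En + N
          + Φ (OO (fl (h n) t)) + C10 := by
        have ht0m : fl (h n) t ∈ Set.Icc 0 T := fl_mem hhp ht'
        by_cases ha : wnorm κ lam ϱ (x (fl (h n) t)) + wnorm κ lam ϱ (o (fl (h n) t)) ≤ h n ^ (-χ)
        · have h1 := hact n x o hn1 hs ho t ht ha
          have h2 := D.cs_est (ℍ n) (v := v) h1
          have h3 := D.hcoer n v (OO (fl (h n) t)) hvs (hOs _ ht0m)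
          rw [wnorm_fin_zero (ℍ n) hvs] at h3
          have h4 : ∑ i ∈ ℍ n, v i * g t i = ∑ i ∈ ℍ n, v i * F (v + OO (fl (h n) t)) i +
             ∑ i ∈ ℍ n, v i * (F (x (fl (h n) t)) - F (v + OO (fl (h n) t))) i := by
            rw [← Finset.sum_add_distrib]
            refine Finset.sum_congr rfl fun i hi => ?_
            simp only [hg, stepG, if_pos ha, prj, if_pos hi, Pi.sub_apply]
            ring
          rw [h4]
          have h5 : v + OO (fl (h n) t) = y t + q t + (o (fl (h n) t) - q (fl (h n) t)) := rfl
          rw [← h5] at h2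
          linarith
        · have : ∑ i ∈ ℍ n, v i * g t i = 0 := by
            refine Finset.sum_eq_zero fun i _ => ?_
            simp only [hg, stepG, if_neg ha, Pi.zero_apply, mul_zero]
          rw [this]; positivity
      have hmid : ∑ i ∈ ℍ n, v i * x t i ≤ 3 / 2 * En + 1 / 2 * w2 := by
        rw [hEn, hw2', Finset.mul_sum, Finset.mul_sum, ← Finset.sum_add_distrib]
        refine Finset.sum_le_sum fun i _ => ?_
        have : x t i = v i + OO t i := by
          rw [hs.eq t ht' i]; simp only [hv, hOO, Pi.sub_apply, hy, hg]; ring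
        rw [this]; nlinarith [sq_nonneg (v i - OO t i)]
      have hE' : ∑ i ∈ ℍ n, 2 * ((y t i + q t i) *
          ((-lam i * y t i + g t i) + (-(lam i + η) * q t i + η * o t i)))
          = 2 * (-N + η * ∑ i ∈ ℍ n, v i * x t i + ∑ i ∈ ℍ n, v i * g t i) := by
        rw [hN, ← Finset.sum_neg_distrib, Finset.mul_sum, ← Finset.sum_add_distrib,
          ← Finset.sum_add_distrib, Finset.mul_sum]
        refine Finset.sum_congr rfl fun i _ => ?_
        rw [hs.eq t ht' i]
        simp only [hv, hy, hg]; ring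
      rw [hE']
      have hm2 := mul_le_mul_of_nonneg_left hmid hη
      have n1 : 0 ≤ C10 * Φ (OO (fl (h n) t)) := by positivity
      have n2 : 0 ≤ C10 * Ic := by positivity
      have n3 : 0 ≤ C10 * w2 := by positivity
      have n4 : 0 ≤ η * Φ (OO (fl (h n) t)) := by positivity
      have n5 : 0 ≤ η * Ic := by positivity
      nlinarith)
  intro t ht
  have := key t ht
  exact this

end Hyp


namespace Hyp
variable {I : Type*} {η κ : ℝ} {lam : I → ℝ} {δ T ϑ c θ ε α φ γ ρ ϱ χ : ℝ}
    {F : (I → ℝ) → I → ℝ} {ℍ : ℕ → Finset I} {φhat Φ : (I → ℝ) → ℝ} {h : ℕ → ℝ} [DecidableEq I]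

set_option maxHeartbeats 1000000 in
lemma apriori (D : Hyp η κ lam δ T ϑ c θ ε α φ γ ρ ϱ χ F ℍ φhat Φ h) {B : ℝ} (hB : 0 ≤ B) (C0 : ℝ) :
    ∃ R, 0 ≤ R ∧ ∀ (n : ℕ) (x o : ℝ → I → ℝ), h n ≤ 1 → Sch κ lam T ϱ χ F (ℍ n) (h n) x o →
      (∀ t ∈ Set.Icc 0 T, wle κ lam ϱ (o t) B) → ∀ Ic : ℝ, 0 ≤ Ic →
      ∫ r in (0:ℝ)..T,
        Real.exp (∫ u in r..T, 2 * φhat (o (fl (h n) u) - qc η lam o (fl (h n) u))) *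
          (1 + Φ (o (fl (h n) r) - qc η lam o (fl (h n) r)) + Ic +
            wnorm κ lam 0 (o r - qc η lam o r) ^ 2) ≤ C0 → ∀ t ∈ Set.Icc 0 T,
      wle κ lam ϱ (x t) R := by
  obtain ⟨C11, hC11, hen⟩ := D.energy hB
  have hδ := D.hδ
  have hκ := D.hκ
  have hη := D.hη
  have hμ := D.μpos
  have hT := D.hT
  have hc := D.hc
  have hε := D.hε
  set Rv := Real.sqrt (C11 * max C0 0) with hRv
  have hRv0 : 0 ≤ Rv := Real.sqrt_nonneg _
  set Bq := B + Real.exp (κ * T) * T * (η * B) with hBq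
  have hBq0 : 0 ≤ Bq := by positivity
  set Rx := Rv + δ ^ (0 - ϱ) * Bq with hRx
  have hRx0 : 0 ≤ Rx := by positivity
  set M := c * (2 * ε + Rx ^ 2) with hM
  have hM0 : 0 ≤ M := by positivity
  have main : ∀ (n : ℕ) (x o : ℝ → I → ℝ), h n ≤ 1 → Sch κ lam T ϱ χ F (ℍ n) (h n) x o →
      (∀ t ∈ Set.Icc 0 T, wle κ lam ϱ (o t) B) → ∀ Ic : ℝ, 0 ≤ Ic →
      ∫ r in (0:ℝ)..T,
        Real.exp (∫ u in r..T, 2 * φhat (o (fl (h n) u) - qc η lam o (fl (h n) u))) *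
          (1 + Φ (o (fl (h n) r) - qc η lam o (fl (h n) r)) + Ic +
            wnorm κ lam 0 (o r - qc η lam o r) ^ 2) ≤ C0 → ∀ t ∈ Set.Icc 0 T,
      ∃ v w, x t = v + w ∧ wle κ lam 0 v Rv ∧ wle κ lam ϱ w Bq := by
    intro n x o hn1 hs ho Ic hIc hint t ht
    have h1 := hen n x o hn1 hs ho Ic hIc t ht
    refine ⟨conv lam (stepG κ lam ϱ χ F (ℍ n) (h n) x o) 0 t + qc η lam o t,
      o t - qc η lam o t, ?_, ?_, ?_⟩
    · funext i; simp only [Pi.add_apply, Pi.sub_apply, hs.eq t ht i]; ring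
    · have hsup : ∀ i ∉ ℍ n,
        (conv lam (stepG κ lam ϱ χ F (ℍ n) (h n) x o) 0 t + qc η lam o t) i = 0 := by
        intro i hi
        simp only [Pi.add_apply, hs.ysupp ht i hi, hs.qsupp η ht i hi, add_zero]
      refine ⟨memW_fin 0 (ℍ n) hsup, ?_⟩
      apply Real.le_sqrt_of_sq_le
      rw [wnorm_fin_zero (ℍ n) hsup]
      refine h1.trans ?_
      exact mul_le_mul_of_nonneg_left (hint.trans (le_max_left _ _)) hC11
    · have h2 := conv_bound_const (lam := lam) hκ hη (T := T) hμ (r := ϱ) (a := 0) (t0 := 0) (t := t)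
        le_rfl one_pos ht.1 (by linarith [ht.2]) (f := fun s i => η * o s i) (M := η * B)
        (fun i => hs.oint hμ η ht i) (fun s hs2 => by
          have h1 := (ho s ⟨hs2.1, (hs2.2.le.trans ht.2)⟩).smul hμ η
          rw [abs_of_nonneg hη] at h1
          exact h1)
      rw [add_zero] at h2
      refine (wle.sub hμ (ho t ht) h2).mono ?_
      simp only [sub_zero, div_one, Real.rpow_one, hBq]
      have := ht.2
      gcongr
  by_cases hϱ : ϱ ≤ 0
  · refine ⟨δ ^ (ϱ - 0) * Rv + Bq, by positivity, ?_⟩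
    intro n x o hn1 hs ho Ic hIc hint t ht
    obtain ⟨v, w, e, hv, hw⟩ := main n x o hn1 hs ho Ic hIc hint t ht
    rw [e]
    exact (hv.embed hδ D.hμ hϱ).add hμ hw
  · push Not at hϱ
    have ha0 : 0 ≤ γ + ϱ := by linarith [D.hγ0]
    have ha1 : γ + ϱ < 1 := by linarith [D.hϱγ]
    have ha2 : 0 < 1 - (γ + ϱ) := by linarith
    refine ⟨Real.exp (κ * T) * (T ^ (1 - (γ + ϱ)) / (1 - (γ + ϱ))) * M + B, by positivity, ?_⟩
    intro n x o hn1 hs ho Ic hIc hint t ht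
    have hhp := (D.hh n).1
    have hx : ∀ s ∈ Set.Icc 0 T, wle κ lam (-γ) (F (x s)) M := by
      intro s hs2
      obtain ⟨v, w, e, hv, hw⟩ := main n x o hn1 hs ho Ic hIc hint s hs2
      have h1 : wle κ lam 0 (x s) Rx := by
        rw [e]; exact hv.add hμ (hw.embed hδ D.hμ hϱ.le)
      refine ⟨((D.hFH n _ (hs.xsupp hs2)).wle.embed hδ D.hμ (by linarith [D.hγ0])).1, ?_⟩
      refine (D.hFγ n _ (hs.xsupp hs2)).trans ?_
      have h3 := wnorm_nonneg' (κ := κ) (lam := lam) 0 (x s)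
      have h4 := h1.2
      rw [hM]
      gcongr
    have hy := conv_bound0 (lam := lam) hκ (T := T) hμ ha0 ha1 ht.1 (by linarith [ht.2])
      (f := stepG κ lam ϱ χ F (ℍ n) (h n) x o) (r := -γ) (M := M)
      (fun i => stepG_int hhp i 0 t) (fun s hs2 => by
        unfold stepG
        split_ifs
        · exact D.prj_wle _ (hx _ (fl_mem hhp ⟨hs2.1, hs2.2.le.trans ht.2⟩))
        · exact wle_zero hμ _ hM0)
    have e : -γ + (γ + ϱ) = ϱ := by ring
    rw [e] at hy
    have e2 : x t = conv lam (stepG κ lam ϱ χ F (ℍ n) (h n) x o) 0 t + o t := by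
      funext i; simp only [Pi.add_apply, hs.eq t ht i]
    rw [e2]
    refine (hy.add hμ (ho t ht)).mono ?_
    have h5 : (t - 0) ^ (1 - (γ + ϱ)) ≤ T ^ (1 - (γ + ϱ)) := by
      apply Real.rpow_le_rpow <;> linarith [ht.1, ht.2]
    gcongr

end Hyp


/-- pathwise data -/
structure PW {I : Type*} [DecidableEq I] (κ : ℝ) (lam : I → ℝ) (T ϱ χ : ℝ)
    (F : (I → ℝ) → I → ℝ) (ℍ : ℕ → Finset I) (h : ℕ → ℝ) (o : ℝ → I → ℝ) (os xs : ℕ → ℝ → I → ℝ) :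
    Prop where
  sch : ∀ n, Sch κ lam T ϱ χ F (ℍ n) (h n) (xs n) (os n)
  ocont : ContPathW κ lam ϱ T o
  oconv : ∀ e > (0:ℝ), ∀ᶠ n in Filter.atTop, ∀ t ∈ Set.Icc 0 T, wle κ lam ϱ (o t - os n t) e

namespace Hyp
variable {I : Type*} {η κ : ℝ} {lam : I → ℝ} {δ T ϑ c θ ε α φ γ ρ ϱ χ : ℝ}
    {F : (I → ℝ) → I → ℝ} {ℍ : ℕ → Finset I} {φhat Φ : (I → ℝ) → ℝ} {h : ℕ → ℝ} [DecidableEq I]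
    {o : ℝ → I → ℝ} {os xs : ℕ → ℝ → I → ℝ}

lemma os_bdd (D : Hyp η κ lam δ T ϑ c θ ε α φ γ ρ ϱ χ F ℍ φhat Φ h)
    (W : PW κ lam T ϱ χ F ℍ h o os xs) : ∃ B, 0 ≤ B ∧ ∀ᶠ n in Filter.atTop,
      ∀ t ∈ Set.Icc 0 T, wle κ lam ϱ (os n t) B := by
  obtain ⟨B, hB, h1⟩ := W.ocont.bdd D.μpos
  refine ⟨B + 1, by positivity, ?_⟩
  filter_upwards [W.oconv 1 one_pos] with n hn t ht
  have := (h1 t ht).sub D.μpos (hn t ht)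
  rwa [sub_sub_cancel] at this

set_option maxHeartbeats 1000000 in
lemma sch_AS (D : Hyp η κ lam δ T ϑ c θ ε α φ γ ρ ϱ χ F ℍ φhat Φ h)
    (W : PW κ lam T ϱ χ F ℍ h o os xs) {R : ℝ} (hR : 0 ≤ R) {e : ℝ} (he : 0 < e) :
    ∀ᶠ n in Filter.atTop, ∀ τ ∈ Set.Icc 0 T,
      (∀ s ∈ Set.Ico 0 τ, wle κ lam ϱ (xs n (fl (h n) s)) R) →
      AS κ lam ϱ F o R τ e (xs n) (fun s => xs n (fl (h n) s)) := by
  have hμ := D.μpos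
  have hκ := D.hκ
  obtain ⟨M, hM, hF⟩ := D.F_bdd hR
  obtain ⟨B, hB, hoB⟩ := D.os_bdd W
  set σ := (1 - α - ϱ) / 2 with hσ
  have hσ0 : 0 < σ := by have := D.hϱα; simp only [hσ]; linarith
  have ha0 : 0 ≤ α + ϱ := by linarith [D.hρα, D.hρϱ]
  have ha1 : α + ϱ + σ < 1 := by have := D.hϱα; simp only [hσ]; linarith
  obtain ⟨Ch, hCh, hhol⟩ := conv_holder (κ := κ) (lam := lam) D.hκ (le_refl 0) D.hT D.hδ D.hμ
    (r := -α) (a := α + ϱ) (σ := σ) ha0 hσ0.le ha1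
  simp only [add_zero] at hhol
  have ea : -α + (α + ϱ) = ϱ := by ring
  have eb : -α + (α + ϱ + σ) = ϱ + σ := by ring
  rw [ea] at hhol
  set Ct := Real.exp (κ * T) * (T ^ (1 - (α + ϱ + σ)) / (1 - (α + ϱ + σ))) * M with hCt
  have hCt0 : 0 ≤ Ct := by
    have : 0 < 1 - (α + ϱ + σ) := by linarith
    have := D.hT
    positivity
  obtain ⟨d, hd, hunif⟩ := W.ocont.unif hμ (show 0 < e / 4 by positivity)
  -- tail cutoff
  obtain ⟨Λ, hΛ0, hΛ⟩ : ∃ Λ : ℝ, 0 < Λ ∧ Λ ^ (-σ) * Ct ≤ e / 2 := by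
    have h1 : Filter.Tendsto (fun x : ℝ => x ^ (-σ) * Ct) Filter.atTop (nhds (0 * Ct)) :=
      (tendsto_rpow_neg_atTop hσ0).mul_const Ct
    rw [zero_mul] at h1
    have h2 := (h1.eventually_le_const (show (0:ℝ) < e / 2 by positivity)).and
      (Filter.eventually_gt_atTop (0:ℝ))
    obtain ⟨Λ, h3, h4⟩ := h2.exists
    exact ⟨Λ, h4, h3⟩
  have hlim : Filter.Tendsto h Filter.atTop (nhdsWithin 0 (Set.Ioi 0)) :=
    tendsto_nhdsWithin_iff.2 ⟨D.hhlim, Filter.Eventually.of_forall fun n => (D.hh n).1⟩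
  have hbig : ∀ᶠ n in Filter.atTop, R + B ≤ h n ^ (-χ) :=
    ((tendsto_rpow_neg_nhdsGT_zero (y := -χ) (by linarith [D.hχ0])).comp hlim).eventually_ge_atTop _
  have hhd : ∀ᶠ n in Filter.atTop, h n ≤ d := D.hhlim.eventually_le_const hd
  have hhσ : ∀ᶠ n in Filter.atTop, Ch * M * h n ^ σ ≤ e / 4 := by
    have h1 : Filter.Tendsto (fun n => Ch * M * h n ^ σ) Filter.atTop (nhds (Ch * M * 0 ^ σ)) :=
      (D.hhlim.rpow_const (Or.inr hσ0.le)).const_mul _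
    rw [Real.zero_rpow hσ0.ne', mul_zero] at h1
    exact h1.eventually_le_const (by positivity)
  filter_upwards [hoB, hbig, hhd, hhσ, W.oconv (e / 4) (by positivity), D.hspec Λ] with n hoB hbig
    hhd hhσ hocv htail τ hτ hxR
  have hs := W.sch n
  have hhp := (D.hh n).1
  set x := xs n with hx
  set g := stepG κ lam ϱ χ F (ℍ n) (h n) x (os n) with hg
  have hgact : ∀ s ∈ Set.Ico 0 τ, g s = prj (ℍ n) (F (x (fl (h n) s))) := by
    intro s hs2
    have h1 := (hxR s hs2).2
    have h2 := (hoB (fl (h n) s) (fl_mem hhp ⟨hs2.1, hs2.2.le.trans hτ.2⟩)).2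
    simp only [hg, stepG]
    rw [if_pos (by linarith)]
  have hFM : ∀ s ∈ Set.Ico 0 τ, wle κ lam (-α) (F (x (fl (h n) s))) M := fun s hs2 => hF _ (hxR s hs2)
  have hgM : ∀ s ∈ Set.Ico 0 τ, wle κ lam (-α) (g s) M := fun s hs2 => by
    rw [hgact s hs2]; exact D.prj_wle _ (hFM s hs2)
  have hxe : ∀ t ∈ Set.Icc 0 T, x t = conv lam g 0 t + os n t := fun t ht => by
    funext i; simp only [Pi.add_apply, hs.eq t ht i]; rfl
  have hFi : ∀ i a b, IntervalIntegrable (fun s => F (x (fl (h n) s)) i) volume a b :=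
    fun i a b => fl_integrable hhp (fun u => F (x u) i) a b
  refine ⟨fun i => hFi i 0 τ, fun s hs2 => ⟨hxR s hs2, ?_⟩, fun t ht => ?_⟩
  · have hsT : s ∈ Set.Icc 0 T := ⟨hs2.1, hs2.2.le.trans hτ.2⟩
    have hfT := fl_mem hhp hsT
    have hfs := fl_le hhp s
    have hsf := lt_fl hhp s
    have h1 := hhol g M (fl (h n) s) s hfT.1 hfs hsT.2 hM (fun i => stepG_int hhp i 0 s)
      (fun u hu => hgM u ⟨hu.1, hu.2.trans hs2.2⟩)
    have h2 := hunif s hsT _ hfT (by rw [abs_of_nonneg (by linarith)]; linarith)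
    have h3 := (((h1.sub hμ (hocv s hsT)).add hμ h2).add hμ (hocv _ hfT))
    have e1 : x s - x (fl (h n) s) = conv lam g 0 s - conv lam g 0 (fl (h n) s) - (o s - os n s)
        + (o s - o (fl (h n) s)) + (o (fl (h n) s) - os n (fl (h n) s)) := by
      rw [hxe s hsT, hxe _ hfT]; abel
    rw [e1]
    refine h3.mono ?_
    have h4 : (s - fl (h n) s) ^ σ ≤ h n ^ σ :=
      Real.rpow_le_rpow (by linarith) (by linarith) hσ0.le
    have h5 : Ch * M * (s - fl (h n) s) ^ σ ≤ Ch * M * h n ^ σ := by gcongr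
    linarith
  · have htT : t ∈ Set.Icc 0 T := ⟨ht.1, ht.2.trans hτ.2⟩
    have h1 := conv_bound0 (lam := lam) hκ (T := T) hμ (r := -α) (a := α + ϱ + σ) (by linarith) ha1
      ht.1 (by linarith [htT.2]) (f := fun s => F (x (fl (h n) s))) (M := M)
      (fun i => hFi i 0 t) (fun s hs2 => hFM s ⟨hs2.1, hs2.2.trans_le ht.2⟩)
    rw [eb] at h1
    set f := conv lam (fun s => F (x (fl (h n) s))) 0 t with hf
    have h2 : wle κ lam (ϱ + σ) f Ct := by
      refine h1.mono ?_
      have : 0 < 1 - (α + ϱ + σ) := by linarith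
      have h5 : (t - 0) ^ (1 - (α + ϱ + σ)) ≤ T ^ (1 - (α + ϱ + σ)) := by
        apply Real.rpow_le_rpow <;> linarith [ht.1, htT.2]
      rw [hCt]
      gcongr
    have h3 : conv lam g 0 t = prj (ℍ n) f := by
      funext i
      by_cases hi : i ∈ ℍ n
      · simp only [prj, if_pos hi, hf, conv]
        refine intervalIntegral.integral_congr_Ioo_of_le ht.1 fun s hs2 => ?_
        simp only [hgact s ⟨hs2.1.le, hs2.2.trans_le ht.2⟩, prj, if_pos hi]
      · simp only [prj, if_neg hi]
        exact hs.ysupp htT i hi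
    have h4 : wle κ lam ϱ (prj (ℍ n) f - f) (Λ ^ (-σ) * Ct) := by
      refine wle.of_abs hμ h2 (Real.rpow_nonneg hΛ0.le _) fun i => ?_
      by_cases hi : i ∈ ℍ n
      · simp only [Pi.sub_apply, prj, if_pos hi, sub_self, abs_zero, mul_zero]
        have := Real.rpow_nonneg (hμ i).le (ϱ + σ)
        positivity
      · simp only [Pi.sub_apply, prj, if_neg hi, zero_sub, abs_neg]
        have h5 : Λ ≤ κ + lam i := by linarith [htail i hi]
        have h6 : (κ + lam i) ^ (-σ) ≤ Λ ^ (-σ) :=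
          Real.rpow_le_rpow_of_nonpos hΛ0 h5 (by linarith)
        have h7 : (κ + lam i) ^ ϱ = (κ + lam i) ^ (-σ) * (κ + lam i) ^ (ϱ + σ) := by
          rw [← Real.rpow_add (hμ i)]; congr 1; ring
        have h8 := Real.rpow_nonneg (hμ i).le (ϱ + σ)
        rw [h7, mul_assoc]
        gcongr
    have h5 := h4.sub hμ (hocv t htT)
    have e1 : x t - f - o t = prj (ℍ n) f - f - (o t - os n t) := by
      rw [hxe t htT, h3]; abel
    rw [e1]
    exact h5.mono (by linarith)

end Hyp


lemma contPathW_fin {I : Type*} {κ : ℝ} {lam : I → ℝ} {r T : ℝ} {X : ℝ → I → ℝ} (S : Finset I)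
    (hs : ∀ t ∈ Set.Icc 0 T, ∀ i ∉ S, X t i = 0)
    (hc : ∀ i, ContinuousOn (fun t => X t i) (Set.Icc 0 T)) : ContPathW κ lam r T X := by
  refine ⟨fun t ht => memW_fin r S (hs t ht), fun t ht ε hε => ?_⟩
  have h1 : ContinuousOn (fun s => Real.sqrt (∑ i ∈ S, (κ + lam i) ^ (2 * r) * (X s i - X t i) ^ 2))
      (Set.Icc 0 T) := by
    refine Real.continuous_sqrt.comp_continuousOn (continuousOn_finsetSum _ fun i _ => ?_)
    exact continuousOn_const.mul (((hc i).sub continuousOn_const).pow 2)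
  rw [Metric.continuousOn_iff] at h1
  obtain ⟨d, hd, h2⟩ := h1 t ht ε hε
  refine ⟨d / 2, by positivity, fun s hs2 hst => ?_⟩
  have h3 := h2 s hs2 (by rw [Real.dist_eq]; linarith)
  rw [wnorm_fin r S (f := X s - X t) (fun i hi => by simp [hs s hs2 i hi, hs t ht i hi])]
  rw [Real.dist_eq] at h3
  simp only [sub_self, ne_eq, OfNat.ofNat_ne_zero, not_false_eq_true, zero_pow, mul_zero,
    Finset.sum_const_zero, Real.sqrt_zero, sub_zero, abs_of_nonneg (Real.sqrt_nonneg _)] at h3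
  exact h3.le

namespace Hyp
variable {I : Type*} {η κ : ℝ} {lam : I → ℝ} {δ T ϑ c θ ε α φ γ ρ ϱ χ : ℝ}
    {F : (I → ℝ) → I → ℝ} {ℍ : ℕ → Finset I} {φhat Φ : (I → ℝ) → ℝ} {h : ℕ → ℝ} [DecidableEq I]
    {o : ℝ → I → ℝ} {os xs : ℕ → ℝ → I → ℝ}

lemma sch_cont (D : Hyp η κ lam δ T ϑ c θ ε α φ γ ρ ϱ χ F ℍ φhat Φ h) {n : ℕ} {x o : ℝ → I → ℝ}
    (hs : Sch κ lam T ϱ χ F (ℍ n) (h n) x o) : ContPathW κ lam ϱ T x := by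
  refine contPathW_fin (ℍ n) (fun t ht => hs.xsupp ht) fun i => ?_
  refine ContinuousOn.congr ?_ (fun t ht => hs.eq t ht i)
  exact (conv_continuousOn D.hT.le (stepG_int (D.hh n).1 i 0 T)).add (hs.ocont.coord D.μpos i)

set_option maxHeartbeats 1000000 in
lemma sub_limit (D : Hyp η κ lam δ T ϑ c θ ε α φ γ ρ ϱ χ F ℍ φhat Φ h)
    (W : PW κ lam T ϱ χ F ℍ h o os xs) {R : ℝ} (hR : 0 ≤ R)
    (hb : ∃ᶠ n in Filter.atTop, ∀ t ∈ Set.Icc 0 T, wle κ lam ϱ (xs n t) R) :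
    ∃ X : ℝ → I → ℝ, ContPathW κ lam ϱ T X ∧ (∀ t ∈ Set.Icc 0 T, wle κ lam ϱ (X t) R) ∧
      ∀ t ∈ Set.Icc 0 T, ∀ i, X t i = conv lam (fun s => F (X s)) 0 t i + o t i := by
  have hμ := D.μpos
  have hκ := D.hκ
  obtain ⟨L, hL⟩ := D.lip hR
  have ha0 : 0 ≤ α + ϱ := by linarith [D.hρα, D.hρϱ]
  have ha1 : α + ϱ < 1 := by linarith [D.hϱα]
  obtain ⟨K, hK, hcmp⟩ := compare D.hκ (T := T) D.μpos ha0 ha1 o hL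
  obtain ⟨ψ, hψ, hψR⟩ := Filter.extraction_of_frequently_atTop hb
  have hAS : ∀ e > 0, ∀ᶠ k in Filter.atTop,
      AS κ lam ϱ F o R T e (xs (ψ k)) (fun s => xs (ψ k) (fl (h (ψ k)) s)) := by
    intro e he
    filter_upwards [hψ.tendsto_atTop.eventually (D.sch_AS W hR he)] with k hk
    refine hk T ⟨D.hT.le, le_rfl⟩ fun s hs => hψR k _ ?_
    exact fl_mem (D.hh _).1 ⟨hs.1, hs.2.le⟩
  set z := fun k => xs (ψ k) with hz
  have hcau : ∀ e > 0, ∃ N, ∀ k ≥ N, ∀ l ≥ N, ∀ t ∈ Set.Icc 0 T, wle κ lam ϱ (z k t - z l t) e := by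
    intro e he
    obtain ⟨N, hN⟩ := Filter.eventually_atTop.1 (hAS (e / (2 * (K + 1))) (by positivity))
    refine ⟨N, fun k hk l hl t ht => ?_⟩
    have := hcmp T _ _ _ _ _ _ D.hT.le le_rfl (by positivity) (by positivity) (hN k hk) (hN l hl) t ht
    refine this.mono ?_
    have e1 : K * (e / (2 * (K + 1)) + e / (2 * (K + 1))) = K / (K + 1) * e := by field_simp; ring
    rw [e1]
    have : K / (K + 1) ≤ 1 := by rw [div_le_one (by positivity)]; linarith
    nlinarith
  have hex : ∀ t ∈ Set.Icc 0 T, ∀ i, ∃ l, Filter.Tendsto (fun k => z k t i) Filter.atTop (nhds l) := by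
    intro t ht i
    apply cauchySeq_tendsto_of_complete
    rw [Metric.cauchySeq_iff]
    intro e he
    have hp : 0 < (κ + lam i) ^ (-ϱ) := Real.rpow_pos_of_pos (hμ i) _
    obtain ⟨N, hN⟩ := hcau (e / 2 / (κ + lam i) ^ (-ϱ)) (by positivity)
    refine ⟨N, fun k hk l hl => ?_⟩
    have h1 := (hN k hk l hl t ht).coord' hμ i
    rw [mul_div_cancel₀ _ hp.ne'] at h1
    rw [Real.dist_eq]
    simp only [Pi.sub_apply] at h1
    linarith
  choose! X hX using hex
  have hconv : ∀ e > 0, ∃ N, ∀ k ≥ N, ∀ t ∈ Set.Icc 0 T, wle κ lam ϱ (z k t - X t) e := by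
    intro e he
    obtain ⟨N, hN⟩ := hcau e he
    refine ⟨N, fun k hk t ht => ?_⟩
    refine wle.lim hμ (f := fun l => z k t - z l t) ?_ fun i => ?_
    · filter_upwards [Filter.eventually_ge_atTop N] with l hl using hN k hk l hl t ht
    · exact (tendsto_const_nhds).sub (hX t ht i)
  have hXR : ∀ t ∈ Set.Icc 0 T, wle κ lam ϱ (X t) R := fun t ht =>
    wle.lim hμ (f := fun l => z l t) (Filter.Eventually.of_forall fun k => hψR k t ht) (hX t ht)
  have hXc : ContPathW κ lam ϱ T X := by
    refine ⟨fun t ht => (hXR t ht).1, fun t ht e he => ?_⟩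
    obtain ⟨N, hN⟩ := hconv (e / 3) (by positivity)
    have hzc := D.sch_cont (W.sch (ψ N))
    obtain ⟨d, hd, h1⟩ := hzc.2 t ht (e / 3) (by positivity)
    refine ⟨d, hd, fun s hs hst => ?_⟩
    have h2 : wle κ lam ϱ (z N s - z N t) (e / 3) :=
      ⟨(hzc.1 s hs).sub hμ (hzc.1 t ht), h1 s hs hst⟩
    have h3 := (h2.sub hμ (hN N le_rfl s hs)).add hμ (hN N le_rfl t ht)
    have e1 : X s - X t = z N s - z N t - (z N s - X s) + (z N t - X t) := by abel
    rw [e1]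
    exact h3.2.trans (by linarith)
  refine ⟨X, hXc, hXR, fun t ht i => ?_⟩
  have hFX := F_cont hμ D.hFmap D.hFcont hXc
  set G := Real.exp (κ * T) * ((t - 0) ^ (1 - (α + ϱ)) / (1 - (α + ϱ))) with hG
  have hG0 : 0 ≤ G := by
    have h1 : 0 < 1 - (α + ϱ) := by linarith
    have h2 : 0 ≤ t - 0 := by linarith [ht.1]
    positivity
  have hL0 := hL.1
  have hest : ∀ e > 0, wle κ lam ϱ (X t - conv lam (fun s => F (X s)) 0 t - o t)
      ((2 + G * (L * 2)) * e) := by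
    intro e he
    obtain ⟨N, hN⟩ := hconv e he
    obtain ⟨k, hk, hkN⟩ := ((hAS e he).and (Filter.eventually_ge_atTop N)).exists
    have h1 := hk.eq t ht
    have h2 := conv_bound0 (lam := lam) hκ (T := T) hμ (r := -α) (a := α + ϱ) ha0 ha1 ht.1
      (by linarith [ht.2]) (f := fun s => F (z k (fl (h (ψ k)) s)) - F (X s)) (M := L * (e + e))
      (fun i => (II_mono ht.1 ht.2 (hk.int i)).sub (II_mono ht.1 ht.2 (hFX.integrable hμ D.hT.le i)))
      (fun s hs => by
        have hs' : s ∈ Set.Icc 0 T := ⟨hs.1, hs.2.le.trans ht.2⟩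
        have b := hk.bar s ⟨hs.1, hs.2.trans_le ht.2⟩
        refine hL.2 _ _ _ b.1 (hXR s hs') ?_
        have b3 := (b.2.symm hμ).add hμ (hN k hkN s hs')
        have e4 : z k (fl (h (ψ k)) s) - X s
            = (z k (fl (h (ψ k)) s) - z k s) + (z k s - X s) := by abel
        rw [e4]
        convert b3 using 1)
    rw [← conv_sub (fun i => II_mono ht.1 ht.2 (hk.int i))
      (fun i => II_mono ht.1 ht.2 (hFX.integrable hμ D.hT.le i))] at h2
    have e3 : -α + (α + ϱ) = ϱ := by ring
    rw [e3] at h2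
    have h3 := (h1.sub hμ (hN k hkN t ht)).add hμ h2
    have e1 : X t - conv lam (fun s => F (X s)) 0 t - o t
      = xs (ψ k) t - conv lam (fun s => F (xs (ψ k) (fl (h (ψ k)) s))) 0 t - o t - (z k t - X t)
       + (conv lam (fun s => F (z k (fl (h (ψ k)) s))) 0 t - conv lam (fun s => F (X s)) 0 t) := by
      simp only [hz]; abel
    rw [e1]
    refine h3.mono (le_of_eq ?_)
    simp only [hG]; ring
  have hfin : wle κ lam ϱ (X t - conv lam (fun s => F (X s)) 0 t - o t) 0 := by
    refine wle.of_forall hμ fun e he => ?_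
    have hpos : 0 < 2 + G * (L * 2) := by positivity
    refine (hest (e / (2 + G * (L * 2))) (by positivity)).mono (le_of_eq ?_)
    field_simp; ring
  have := congrFun (hfin.zero_of hμ) i
  simp only [Pi.sub_apply, Pi.zero_apply] at this
  linarith

lemma full_limit (D : Hyp η κ lam δ T ϑ c θ ε α φ γ ρ ϱ χ F ℍ φhat Φ h)
    (W : PW κ lam T ϱ χ F ℍ h o os xs) {R : ℝ} (hR : 0 ≤ R) {X : ℝ → I → ℝ}
    (hXc : ContPathW κ lam ϱ T X) (hXR : ∀ t ∈ Set.Icc 0 T, wle κ lam ϱ (X t) R)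
    (hXe : ∀ t ∈ Set.Icc 0 T, ∀ i, X t i = conv lam (fun s => F (X s)) 0 t i + o t i)
    {e : ℝ} (he : 0 < e) :
    ∀ᶠ n in Filter.atTop, ∀ t ∈ Set.Icc 0 T, wle κ lam ϱ (X t - xs n t) e := by
  have hμ := D.μpos
  have ha0 : 0 ≤ α + ϱ := by linarith [D.hρα, D.hρϱ]
  have ha1 : α + ϱ < 1 := by linarith [D.hϱα]
  have hR1 : 0 ≤ R + 1 := by linarith
  obtain ⟨L, hL⟩ := D.lip hR1
  obtain ⟨K, hK, hcmp⟩ := compare D.hκ (T := T) D.μpos ha0 ha1 o hL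
  set m := min e 1 with hm
  have hm0 : 0 < m := lt_min he one_pos
  have hASX := (D.sol_AS hXc hXR hXe).mono (show R ≤ R + 1 by linarith) le_rfl
  filter_upwards [D.sch_AS W hR1 (show 0 < m / (K + 1) by positivity)] with n hn
  have hhp := (D.hh n).1
  have hKm : K * (0 + m / (K + 1)) ≤ m := by
    have e1 : K * (0 + m / (K + 1)) = K / (K + 1) * m := by field_simp; ring
    rw [e1]
    have : K / (K + 1) ≤ 1 := by rw [div_le_one (by positivity)]; linarith
    nlinarith
  have key : ∀ k : ℕ, ∀ s ∈ Set.Icc 0 T, s ≤ k * h n → wle κ lam ϱ (X s - xs n s) m := by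
    intro k
    induction k with
    | zero =>
      intro s hs hs0
      have h0 : s = 0 := le_antisymm (by simpa using hs0) hs.1
      subst h0
      have h1 := hn 0 hs (fun u hu => absurd hu.2 (not_lt.2 hu.1))
      exact (hcmp 0 _ _ _ _ _ _ le_rfl hs.2 le_rfl (by positivity) (hASX.restrict le_rfl hs.2) h1 0
        ⟨le_rfl, le_rfl⟩).mono hKm
    | succ k ih =>
      intro s hs hsk
      have h1 := hn s hs (fun u hu => by
        have huT : u ∈ Set.Icc 0 T := ⟨hu.1, hu.2.le.trans hs.2⟩
        have hfT := fl_mem hhp huT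
        obtain ⟨j, hj⟩ := fl_eq_nat hhp hu.1
        have hjk : j ≤ k := by
          have h2 : (j:ℝ) * h n < (k + 1 : ℕ) * h n := by
            rw [← hj]; exact (fl_le hhp u).trans_lt (hu.2.trans_le hsk)
          have h3 : (j:ℝ) < (k + 1 : ℕ) := lt_of_mul_lt_mul_right h2 hhp.le
          have : j < k + 1 := by exact_mod_cast h3
          omega
        have h4 := ih _ hfT (by rw [hj]; gcongr)
        have h5 := (hXR _ hfT).sub hμ h4
        rw [sub_sub_cancel] at h5
        exact h5.mono (by have := min_le_right e 1; linarith))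
      exact (hcmp s _ _ _ _ _ _ hs.1 hs.2 le_rfl (by positivity) (hASX.restrict hs.1 hs.2) h1 s
        ⟨hs.1, le_rfl⟩).mono hKm
  intro t ht
  obtain ⟨k, hk⟩ := exists_nat_ge (t / h n)
  rw [div_le_iff₀ hhp] at hk
  exact (key k t ht hk).mono (min_le_left _ _)

/-- the pathwise theorem -/
lemma pathwise (D : Hyp η κ lam δ T ϑ c θ ε α φ γ ρ ϱ χ F ℍ φhat Φ h)
    (W : PW κ lam T ϱ χ F ℍ h o os xs) {Ic : ℕ → ℝ} (hIc : ∀ m, 0 ≤ Ic m) (C0 : ℝ)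
    (hint : ∃ᶠ m in Filter.atTop, ∫ r in (0:ℝ)..T,
        Real.exp (∫ u in r..T, 2 * φhat (os m (fl (h m) u) - qc η lam (os m) (fl (h m) u))) *
          (1 + Φ (os m (fl (h m) r) - qc η lam (os m) (fl (h m) r)) + Ic m +
            wnorm κ lam 0 (os m r - qc η lam (os m) r) ^ 2) ≤ C0) :
    ∃ X : ℝ → I → ℝ, ContPathW κ lam ϱ T X ∧
      (∀ t ∈ Set.Icc 0 T, ∀ i, X t i = conv lam (fun s => F (X s)) 0 t i + o t i) ∧
      ∀ e > 0, ∀ᶠ n in Filter.atTop, ∀ t ∈ Set.Icc 0 T, wle κ lam ϱ (X t - xs n t) e := by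
  obtain ⟨B, hB, hoB⟩ := D.os_bdd W
  obtain ⟨R, hR, hap⟩ := D.apriori hB C0
  have hb : ∃ᶠ n in Filter.atTop, ∀ t ∈ Set.Icc 0 T, wle κ lam ϱ (xs n t) R := by
    refine (hint.and_eventually (hoB.and (D.hhlim.eventually_le_const one_pos))).mono ?_
    rintro n ⟨h1, h2, h3⟩
    exact hap n (xs n) (os n) h3 (W.sch n) h2 (Ic n) (hIc n) h1
  obtain ⟨X, h1, h2, h3⟩ := D.sub_limit W hR hb
  exact ⟨X, h1, h3, fun e he => D.full_limit W hR h1 h2 h3 he⟩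

end Hyp


section prob
variable {Ω : Type*} [MeasurableSpace Ω] {P : Measure Ω} [IsProbabilityMeasure P]

lemma ae_of_outer {A S : Set Ω} (hA : P A = 1) (hS : MeasurableSet S)
    (h : ∀ᵐ ω ∂P, ω ∈ A → ω ∈ S) : ∀ᵐ ω ∂P, ω ∈ S := by
  have h1 : P A ≤ P S := measure_mono_ae h
  rw [hA] at h1
  have h2 : P S = 1 := le_antisymm prob_le_one h1
  exact (mem_ae_iff_prob_eq_one hS).2 h2

lemma prob_one_of_ae {S : Set Ω} (h : ∀ᵐ ω ∂P, ω ∈ S) : P S = 1 := by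
  have h1 : S =ᵐ[P] Set.univ := Filter.eventuallyEq_univ.2 h
  rw [measure_congr h1]
  exact measure_univ
end prob

namespace Hyp
variable {I : Type*} {η κ : ℝ} {lam : I → ℝ} {δ T ϑ c θ ε α φ γ ρ ϱ χ : ℝ}
    {F : (I → ℝ) → I → ℝ} {ℍ : ℕ → Finset I} {φhat Φ : (I → ℝ) → ℝ} {h : ℕ → ℝ} [DecidableEq I]
    {Ω : Type*} [MeasurableSpace Ω]

lemma Fext_cont (D : Hyp η κ lam δ T ϑ c θ ε α φ γ ρ ϱ χ F ℍ φhat Φ h) (S : Finset I) (i : I) :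
    Continuous (fun a : S → ℝ => F (fun j => if hj : j ∈ S then a ⟨j, hj⟩ else 0) i) := by
  set E : (S → ℝ) → I → ℝ := fun a j => if hj : j ∈ S then a ⟨j, hj⟩ else 0 with hE
  have hEs : ∀ a, ∀ j ∉ S, E a j = 0 := fun a j hj => by simp [hE, hj]
  have hEm : ∀ a, memW κ lam ϱ (E a) := fun a => memW_fin ϱ S (hEs a)
  rw [continuous_iff_continuousAt]
  intro b
  have hW : Filter.Tendsto (fun a => wnorm κ lam ϱ (E a - E b)) (nhds b) (nhds 0) := by
    have h1 : ∀ a, wnorm κ lam ϱ (E a - E b)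
        = Real.sqrt (∑ j ∈ S, (κ + lam j) ^ (2 * ϱ) * (E a j - E b j) ^ 2) := fun a => by
      rw [wnorm_fin ϱ S (fun j hj => by simp [hEs a j hj, hEs b j hj])]; rfl
    have h2 : Continuous (fun a => wnorm κ lam ϱ (E a - E b)) := by
      simp only [h1]
      refine Real.continuous_sqrt.comp (continuous_finsetSum _ fun j hj => ?_)
      simp only [hE, hj, dif_pos]
      fun_prop
    have h3 := h2.tendsto b
    have h4 : wnorm κ lam ϱ (E b - E b) = 0 := by rw [h1]; simp
    rwa [h4] at h3
  rw [ContinuousAt, Metric.tendsto_nhds]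
  intro e he
  have hp : 0 < (κ + lam i) ^ (- -α) := Real.rpow_pos_of_pos (D.μpos i) _
  obtain ⟨d, hd, h1⟩ := D.hFcont (E b) (hEm b) (e / 2 / (κ + lam i) ^ (- -α)) (by positivity)
  filter_upwards [hW.eventually_le_const hd] with a ha
  have h3 : wle κ lam (-α) (F (E a) - F (E b)) _ :=
    ⟨(D.hFmap _ (hEm a)).sub D.μpos (D.hFmap _ (hEm b)), h1 _ (hEm a) ha⟩
  have h4 := h3.coord' D.μpos i
  rw [mul_div_cancel₀ _ hp.ne'] at h4
  rw [Real.dist_eq]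
  simp only [Pi.sub_apply] at h4
  linarith

lemma Fprj_meas (D : Hyp η κ lam δ T ϑ c θ ε α φ γ ρ ϱ χ F ℍ φhat Φ h) (S : Finset I) (i : I)
    {Z : Ω → I → ℝ} (hZ : ∀ i, Measurable fun ω => Z ω i) :
    Measurable fun ω => F (prj S (Z ω)) i := by
  have h1 := (D.Fext_cont S i).measurable.comp
    (measurable_pi_lambda (fun ω (j : S) => Z ω j) fun j => hZ j)
  have h2 : (fun ω => F (prj S (Z ω)) i) = (fun a : S → ℝ =>
      F (fun j => if hj : j ∈ S then a ⟨j, hj⟩ else 0) i) ∘ fun ω j => Z ω ↑j := by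
    funext ω
    simp only [Function.comp]
    rfl
  rw [h2]
  exact h1

lemma F_meas (D : Hyp η κ lam δ T ϑ c θ ε α φ γ ρ ϱ χ F ℍ φhat Φ h) (i : I)
    {Z : Ω → I → ℝ} (hZ : ∀ i, Measurable fun ω => Z ω i) (hm : ∀ ω, memW κ lam ϱ (Z ω)) :
    Measurable fun ω => F (Z ω) i :=
  measurable_of_tendsto_metrizable (fun n => D.Fprj_meas (ℍ n) i hZ)
    (tendsto_pi_nhds.2 fun ω => D.F_coord_tendsto (hm ω) i)

/-- clamping to `[0,T]` -/
noncomputable def clamp (T s : ℝ) : ℝ := max 0 (min T s)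

lemma clamp_mem (hT : 0 ≤ T) (s : ℝ) : clamp T s ∈ Set.Icc 0 T :=
  ⟨le_max_left _ _, max_le hT (min_le_left _ _)⟩

lemma clamp_eq {s : ℝ} (hs : s ∈ Set.Icc 0 T) : clamp T s = s := by
  unfold clamp; rw [min_eq_right hs.2, max_eq_right hs.1]

lemma clamp_cont : Continuous (clamp T) := by unfold clamp; fun_prop

lemma comp_clamp (hT : 0 ≤ T) {f : ℝ → ℝ} (hf : ContinuousOn f (Set.Icc 0 T)) :
    Continuous fun s => f (clamp T s) :=
  hf.comp_continuous clamp_cont (clamp_mem hT)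

lemma conv_meas (D : Hyp η κ lam δ T ϑ c θ ε α φ γ ρ ϱ χ F ℍ φhat Φ h) (i : I)
    {Z : ℝ → Ω → I → ℝ} (hZ : IsProcW T Z) (hc : ∀ ω, ContPathW κ lam ϱ T fun t => Z t ω)
    {t : ℝ} (ht : t ∈ Set.Icc 0 T) :
    Measurable fun ω => conv lam (fun s => F (Z s ω)) 0 t i := by
  have hT := D.hT.le
  have h1 : Measurable (Function.uncurry fun (s : ℝ) (ω : Ω) => F (Z (clamp T s) ω) i) :=
    measurable_uncurry_of_continuous_of_measurable
      (fun ω => comp_clamp hT (f := fun s => F (Z s ω) i)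
        ((F_cont D.μpos D.hFmap D.hFcont (hc ω)).coord D.μpos i))
      (fun s => D.F_meas i (hZ _ (clamp_mem hT s)) fun ω => (hc ω).1 _ (clamp_mem hT s))
  have h2 : Measurable (fun p : Ω × ℝ =>
      Real.exp (-((t - p.2) * lam i)) * F (Z (clamp T p.2) p.1) i) :=
    (by fun_prop : Measurable fun p : Ω × ℝ => Real.exp (-((t - p.2) * lam i))).mul
      (h1.comp measurable_swap)
  have h3 := (h2.stronglyMeasurable.integral_prod_right'
    (ν := volume.restrict (Set.Ioc 0 t))).measurable
  convert h3 using 2 with ω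
  unfold conv
  rw [intervalIntegral.integral_of_le ht.1]
  refine setIntegral_congr_fun measurableSet_Ioc fun s hs => ?_
  simp only [clamp_eq (T := T) ⟨hs.1.le, hs.2.trans ht.2⟩]

lemma step_meas (D : Hyp η κ lam δ T ϑ c θ ε α φ γ ρ ϱ χ F ℍ φhat Φ h) (i : I) (S : Finset I)
    {x o : ℝ → Ω → I → ℝ} (hx : IsProcW T x) (ho : IsProcW T o) {k : ℝ} (hk : 0 < k)
    (hos : ∀ t ∈ Set.Icc 0 T, ∀ ω, ∀ i ∉ S, o t ω i = 0)
    {t : ℝ} (ht : t ∈ Set.Icc 0 T) :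
    Measurable fun ω => conv lam (stepG κ lam ϱ χ F S k (fun u => prj S (x u ω))
      (fun u => o u ω)) 0 t i := by
  set K : ℤ → Ω → ℝ := fun z ω => if k * z ∈ Set.Icc 0 T then
    (if wnorm κ lam ϱ (prj S (x (k * z) ω)) + wnorm κ lam ϱ (o (k * z) ω) ≤ k ^ (-χ) then
      prj S (F (prj S (x (k * z) ω))) i else 0) else 0 with hK
  have h1 : ∀ z, Measurable (K z) := by
    intro z
    by_cases hz : k * z ∈ Set.Icc 0 T
    · simp only [hK, hz, if_true]
      have w1 : Measurable fun ω => wnorm κ lam ϱ (prj S (x (k * z) ω)) := by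
        simp only [wnorm_fin ϱ S (prj_supp S (x (k * z) _))]
        refine (Finset.measurable_sum _ fun j hj => ?_).sqrt
        simp only [prj, hj, if_true]
        exact ((hx _ hz j).pow_const 2).const_mul _
      have w2 : Measurable fun ω => wnorm κ lam ϱ (o (k * z) ω) := by
        have e : ∀ ω, wnorm κ lam ϱ (o (k * z) ω) = _ := fun ω => wnorm_fin ϱ S (hos _ hz ω)
        simp only [e]
        exact (Finset.measurable_sum _ fun j hj => ((ho _ hz j).pow_const 2).const_mul _).sqrt
      refine Measurable.ite (measurableSet_le (w1.add w2) measurable_const) ?_ measurable_const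
      by_cases hi : i ∈ S
      · simp only [prj, hi, if_true]
        exact D.Fprj_meas S i (hx _ hz)
      · simp only [prj, hi, if_false]; exact measurable_const
    · simp only [hK, hz, if_false]; exact measurable_const
  have h2 : Measurable fun p : ℤ × Ω => K p.1 p.2 := measurable_from_prod_countable_right h1
  have h3 : Measurable (fun p : Ω × ℝ =>
      Real.exp (-((t - p.2) * lam i)) * K ⌊p.2 / k⌋ p.1) := by
    refine (by fun_prop : Measurable fun p : Ω × ℝ => Real.exp (-((t - p.2) * lam i))).mul ?_
    exact h2.comp ((Int.measurable_floor.comp (measurable_snd.div_const k)).prodMk measurable_fst)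
  have h4 := (h3.stronglyMeasurable.integral_prod_right'
    (ν := volume.restrict (Set.Ioc 0 t))).measurable
  convert h4 using 2 with ω
  unfold conv
  rw [intervalIntegral.integral_of_le ht.1]
  refine setIntegral_congr_fun measurableSet_Ioc fun s hs => ?_
  have hm := fl_mem hk (T := T) (s := s) ⟨hs.1.le, hs.2.trans ht.2⟩
  unfold fl at hm
  simp only [hK, hm, if_true, stepG, fl]
  congr 1
  exact ite_apply _ _ _ _

/-- mild solutions satisfy the equation at all times almost surely -/
lemma mild_ae [Countable I] (D : Hyp η κ lam δ T ϑ c θ ε α φ γ ρ ϱ χ F ℍ φhat Φ h)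
    {P : Measure Ω} [IsProbabilityMeasure P] {O Z : ℝ → Ω → I → ℝ} (hO : IsProcW T O)
    (hOc : ∀ ω, ContPathW κ lam ϱ T fun t => O t ω) (hZ : IsMildSolP P κ lam ϱ T F O Z) :
    ∀ᵐ ω ∂P, ∀ t ∈ Set.Icc 0 T, ∀ i, Z t ω i = conv lam (fun s => F (Z s ω)) 0 t i + O t ω i := by
  obtain ⟨hp, hc, he⟩ := hZ
  have hT := D.hT.le
  have h1 : ∀ q : ℚ, ∀ᵐ ω ∂P, ∀ i, Z (clamp T q) ω i
      = conv lam (fun s => F (Z s ω)) 0 (clamp T q) i + O (clamp T q) ω i := by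
    intro q
    have hq := clamp_mem hT (q : ℝ)
    refine ae_of_outer (he _ hq) ?_ (Filter.Eventually.of_forall fun ω hω => hω)
    have h5 : MeasurableSet (⋂ i, {ω | Z (clamp T q) ω i
      = conv lam (fun s => F (Z s ω)) 0 (clamp T q) i + O (clamp T q) ω i}) :=
      MeasurableSet.iInter fun i => measurableSet_eq_fun (hp _ hq i)
        ((D.conv_meas i hp hc hq).add (hO _ hq i))
    have h6 : (⋂ i, {ω | Z (clamp T q) ω i
        = conv lam (fun s => F (Z s ω)) 0 (clamp T q) i + O (clamp T q) ω i})
        = {ω | ∀ i, Z (clamp T q) ω i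
        = conv lam (fun s => F (Z s ω)) 0 (clamp T q) i + O (clamp T q) ω i} :=
      Set.setOf_forall _ |>.symm
    rw [h6] at h5
    exact h5
  filter_upwards [ae_all_iff.2 h1] with ω hω t ht i
  have hFc := (F_cont D.μpos D.hFmap D.hFcont (hc ω))
  have c1 := comp_clamp hT ((hc ω).coord D.μpos i)
  have c2 := comp_clamp hT ((conv_continuousOn (ν := lam) hT (hFc.integrable D.μpos hT i)).add
    ((hOc ω).coord D.μpos i))
  have h2 := Continuous.ext_on Rat.denseRange_cast c1 c2 (by
    rintro _ ⟨q, rfl⟩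
    exact hω q i)
  have h3 := congrFun h2 t
  simpa [clamp_eq ht] using h3

end Hyp


theorem stmt3 {I : Type*} [Countable I] [DecidableEq I]
    (η κ : ℝ) (lam : I → ℝ) (hη : 0 ≤ η) (hκ : 0 ≤ κ)
    (hinf : ∃ δ > (0:ℝ), ∀ i, -(min η κ) + δ ≤ lam i)
    (T ϑ c θ ε α φ γ ρ ϱ χ : ℝ)
    (hT : 0 < T) (hϑ : 0 < ϑ) (hc : 0 < c) (hθ : 0 ≤ θ) (hε : 0 ≤ ε)
    (hα : α ∈ Set.Icc (0:ℝ) (1/2)) (hφ : φ ∈ Set.Ico (0:ℝ) 1) (hγ : γ ∈ Set.Ioo (0:ℝ) 1)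
    (hρ : ρ ∈ Set.Ico (-α) (1 - max α γ)) (hϱ : ϱ ∈ Set.Ioo ρ (1 - max α γ))
    (hχ : χ ∈ Set.Ioc 0 (min ((ϱ - ρ) / (1 + ϑ)) ((1 - α - ρ) / (1 + 2 * ϑ))))
    (F : (I → ℝ) → I → ℝ)
    -- `F ∈ C(H_ϱ, H_{-α})`:
    (hFmap : ∀ f, memW κ lam ϱ f → memW κ lam (-α) (F f))
    (hFcont : ∀ f, memW κ lam ϱ f → ∀ δ > (0:ℝ), ∃ δ' > (0:ℝ), ∀ g, memW κ lam ϱ g →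
      wnorm κ lam ϱ (g - f) ≤ δ' → wnorm κ lam (-α) (F g - F f) ≤ δ)
    (ℍ : ℕ → Finset I)
    -- `liminf_m inf({λ_i : i ∈ I∖ℍ_m} ∪ {∞}) = ∞`:
    (hspec : ∀ C : ℝ, ∀ᶠ m in Filter.atTop, ∀ i ∉ ℍ m, C ≤ lam i)
    (φhat Φ : (I → ℝ) → ℝ) (hφhat : ∀ f, 0 ≤ φhat f) (hΦ : ∀ f, 0 ≤ Φ f)
    (hFH : ∀ n : ℕ, ∀ v : I → ℝ, (∀ i ∉ ℍ n, v i = 0) → memW κ lam 0 (F v))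
    (hFγ : ∀ n : ℕ, ∀ v : I → ℝ, (∀ i ∉ ℍ n, v i = 0) →
      wnorm κ lam (-γ) (F v) ≤ c * (2 * ε + wnorm κ lam 0 v ^ 2))
    (hcoer : ∀ n : ℕ, ∀ v w : I → ℝ, (∀ i ∉ ℍ n, v i = 0) → (∀ i ∉ ℍ n, w i = 0) →
      ∑ i ∈ ℍ n, v i * F (v + w) i ≤
        φhat w * wnorm κ lam 0 v ^ 2 + φ * (∑ i ∈ ℍ n, (η + lam i) * v i ^ 2) + Φ w)
    (hFlip : ∀ n : ℕ, ∀ v w : I → ℝ, (∀ i ∉ ℍ n, v i = 0) → (∀ i ∉ ℍ n, w i = 0) →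
      wnorm κ lam (-α) (F v - F w) ≤
        θ * (1 + wnorm κ lam ρ v ^ ϑ + wnorm κ lam ρ w ^ ϑ) * wnorm κ lam ρ (v - w))
    (h : ℕ → ℝ) (hh : ∀ n, h n ∈ Set.Ioc 0 T)
    (hhlim : Filter.Tendsto h Filter.atTop (nhds 0))
    {Ω : Type*} [MeasurableSpace Ω] (P : Measure Ω) [IsProbabilityMeasure P]
    (𝒳 : ℕ → ℝ → Ω → I → ℝ) (h𝒳proc : ∀ n, IsProcW T (𝒳 n))
    (𝒪 : ℕ → ℝ → Ω → I → ℝ) (O : ℝ → Ω → I → ℝ)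
    (h𝒪proc : ∀ n, IsProcW T (𝒪 n))
    (h𝒪cont : ∀ n ω, ContPathW κ lam ϱ T fun t => 𝒪 n t ω)
    (hOproc : IsProcW T O)
    (hOcont : ∀ ω, ContPathW κ lam ϱ T fun t => O t ω)
    (𝕏 𝕆 : ℕ → ℝ → Ω → I → ℝ)
    (h𝕏 : ∀ n : ℕ, ∀ t ∈ Set.Icc (0:ℝ) T, ∀ ω, ∀ i, 𝕏 n t ω i =
      (∫ s in (0:ℝ)..t,
        if wnorm κ lam ϱ (𝒳 n (fl (h n) s) ω) + wnorm κ lam ϱ (𝒪 n (fl (h n) s) ω)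
            ≤ h n ^ (-χ)
        then (if i ∈ ℍ n then Real.exp (-((t - s) * lam i)) * F (𝒳 n (fl (h n) s) ω) i
          else 0)
        else 0) + 𝒪 n t ω i)
    (h𝒪supp : ∀ n : ℕ, ∀ t ∈ Set.Icc (0:ℝ) T, ∀ ω, ∀ i ∉ ℍ n, 𝒪 n t ω i = 0)
    (h𝕆 : ∀ n : ℕ, ∀ t ∈ Set.Icc (0:ℝ) T, ∀ ω, ∀ i, 𝕆 n t ω i = 𝒪 n t ω i -
      ∫ s in (0:ℝ)..t, Real.exp (-((t - s) * η)) *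
        (Real.exp (-((t - s) * lam i)) * (η * 𝒪 n s ω i)))
    (h𝕏𝒳 : ∀ n : ℕ, ∀ t ∈ Set.Icc (0:ℝ) T, P {ω | 𝕏 n t ω = 𝒳 n t ω} = 1)
    (Ω₀ : Set Ω) (hΩ₀m : MeasurableSet Ω₀) (hΩ₀ : P Ω₀ = 1)
    (hΩ₀liminf : ∀ ω ∈ Ω₀, ∃ C : ℝ, ∃ᶠ m in Filter.atTop,
      ∫ r in (0:ℝ)..T,
        Real.exp (∫ u in r..T, 2 * φhat (𝕆 m (fl (h m) u) ω)) *
          (1 + Φ (𝕆 m (fl (h m) r) ω) +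
            (∫ u in (0:ℝ)..T, wnorm κ lam ϱ (𝒪 m u ω) ^ (4 + 4 * ϑ)) +
            wnorm κ lam 0 (𝕆 m r ω) ^ 2) ≤ C)
    (hΩ₀conv : ∀ ω ∈ Ω₀, ∀ δ > (0:ℝ), ∀ᶠ m in Filter.atTop, ∀ t ∈ Set.Icc (0:ℝ) T,
      wnorm κ lam ϱ (O t ω - 𝒪 m t ω) ≤ δ) :
    -- (i) existence and uniqueness up to indistinguishability, and
    -- (ii) almost sure uniform convergence of the scheme:
    ∃ X : ℝ → Ω → I → ℝ, IsMildSolP P κ lam ϱ T F O X ∧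
      (∀ Z : ℝ → Ω → I → ℝ, IsMildSolP P κ lam ϱ T F O Z →
        P {ω | ∀ t ∈ Set.Icc (0:ℝ) T, X t ω = Z t ω} = 1) ∧
      ∃ Ω₁ : Set Ω, MeasurableSet Ω₁ ∧ P Ω₁ = 1 ∧
        ∀ ω ∈ Ω₁, ∀ δ > (0:ℝ), ∀ᶠ n in Filter.atTop, ∀ t ∈ Set.Icc (0:ℝ) T,
          wnorm κ lam ϱ (X t ω - 𝕏 n t ω) ≤ δ := by
  obtain ⟨δ, hδ, hinf⟩ := hinf
  have D : Hyp η κ lam δ T ϑ c θ ε α φ γ ρ ϱ χ F ℍ φhat Φ h :=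
    { hη := hη, hκ := hκ, hδ := hδ
      hμ := fun i => by linarith [hinf i, min_le_right η κ]
      hν := fun i => by linarith [hinf i, min_le_left η κ]
      hT := hT, hϑ := hϑ, hc := hc, hθ := hθ, hε := hε, hα0 := hα.1, hα1 := hα.2
      hφ0 := hφ.1, hφ1 := hφ.2, hγ0 := hγ.1, hγ1 := hγ.2, hρα := hρ.1, hρϱ := hϱ.1
      hϱα := by linarith [hϱ.2, le_max_left α γ]
      hϱγ := by linarith [hϱ.2, le_max_right α γ]
      hχ0 := hχ.1
      hχ1 := (le_div_iff₀ (by linarith)).1 (hχ.2.trans (min_le_left _ _))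
      hχ2 := (le_div_iff₀ (by linarith)).1 (hχ.2.trans (min_le_right _ _))
      hFmap := hFmap, hFcont := hFcont, hspec := hspec, hφhat := hφhat, hΦ := hΦ
      hFH := hFH, hFγ := hFγ, hcoer := hcoer, hFlip := hFlip, hh := hh, hhlim := hhlim }
  have hμ := D.μpos
  -- the measurable version of the scheme
  set Y : ℕ → ℝ → Ω → I → ℝ := fun n t ω i =>
    conv lam (stepG κ lam ϱ χ F (ℍ n) (h n) (fun u => prj (ℍ n) (𝒳 n u ω))
      (fun u => 𝒪 n u ω)) 0 t i + 𝒪 n t ω i with hY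
  have hYm : ∀ n, ∀ t ∈ Set.Icc 0 T, ∀ i, Measurable fun ω => Y n t ω i := fun n t ht i =>
    (D.step_meas i (ℍ n) (h𝒳proc n) (h𝒪proc n) (hh n).1 (h𝒪supp n) ht).add (h𝒪proc n t ht i)
  have hXs : ∀ n, ∀ t ∈ Set.Icc 0 T, ∀ ω, ∀ i ∉ ℍ n, 𝕏 n t ω i = 0 := by
    intro n t ht ω i hi
    rw [h𝕏 n t ht ω i, h𝒪supp n t ht ω i hi]
    simp [hi]
  have hXX : ∀ n ω, ∀ t ∈ Set.Icc 0 T, ∀ i, 𝕏 n t ω i =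
      conv lam (stepG κ lam ϱ χ F (ℍ n) (h n) (fun u => 𝒳 n u ω) (fun u => 𝒪 n u ω)) 0 t i
        + 𝒪 n t ω i := by
    intro n ω t ht i
    rw [h𝕏 n t ht ω i]
    congr 1
    unfold conv
    refine intervalIntegral.integral_congr fun s _ => ?_
    simp only [stepG]
    split_ifs <;> simp_all [prj]
  have hcg : ∀ n, ∀ o x x' : ℝ → I → ℝ, (∀ s ∈ Set.Icc 0 T, x (fl (h n) s) = x' (fl (h n) s)) →
      ∀ t ∈ Set.Icc 0 T, ∀ i,
      conv lam (stepG κ lam ϱ χ F (ℍ n) (h n) x o) 0 t i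
        = conv lam (stepG κ lam ϱ χ F (ℍ n) (h n) x' o) 0 t i := by
    intro n o x x' hx t ht i
    unfold conv
    refine intervalIntegral.integral_congr fun s hs => ?_
    rw [Set.uIcc_of_le ht.1] at hs
    simp only [stepG, hx s ⟨hs.1, hs.2.trans ht.2⟩]
  set G1 : ℕ → ℤ → Set Ω := fun n z => {ω | h n * z ∈ Set.Icc 0 T →
    ∀ i ∉ ℍ n, 𝒳 n (h n * z) ω i = 0} with hG1
  set G2 : ℕ → ℤ → Set Ω := fun n z => {ω | h n * z ∈ Set.Icc 0 T →
    ∀ i, Y n (h n * z) ω i = 𝒳 n (h n * z) ω i} with hG2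
  have hG1m : ∀ n z, MeasurableSet (G1 n z) := by
    intro n z
    by_cases hz : h n * z ∈ Set.Icc 0 T
    · have : G1 n z = ⋂ i, ⋂ (_ : i ∉ ℍ n), {ω | 𝒳 n (h n * z) ω i = 0} := by
        ext ω; simp only [hG1, hz, Set.mem_setOf_eq, Set.mem_iInter, forall_true_left]
      rw [this]
      exact MeasurableSet.iInter fun i => MeasurableSet.iInter fun _ =>
        measurableSet_eq_fun (h𝒳proc n _ hz i) measurable_const
    · have : G1 n z = Set.univ := by ext ω; simp only [hG1, hz, Set.mem_setOf_eq, false_imp_iff,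
        Set.mem_univ]
      rw [this]; exact MeasurableSet.univ
  have hG2m : ∀ n z, MeasurableSet (G2 n z) := by
    intro n z
    by_cases hz : h n * z ∈ Set.Icc 0 T
    · have : G2 n z = ⋂ i, {ω | Y n (h n * z) ω i = 𝒳 n (h n * z) ω i} := by
        ext ω; simp only [hG2, hz, Set.mem_setOf_eq, Set.mem_iInter, forall_true_left]
      rw [this]
      exact MeasurableSet.iInter fun i =>
        measurableSet_eq_fun (hYm n _ hz i) (h𝒳proc n _ hz i)
    · have : G2 n z = Set.univ := by ext ω; simp only [hG2, hz, Set.mem_setOf_eq, false_imp_iff,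
        Set.mem_univ]
      rw [this]; exact MeasurableSet.univ
  have hG1a : ∀ᵐ ω ∂P, ∀ n z, ω ∈ G1 n z := by
    refine ae_all_iff.2 fun n => ae_all_iff.2 fun z => ?_
    by_cases hz : h n * z ∈ Set.Icc 0 T
    · refine ae_of_outer (h𝕏𝒳 n _ hz) (hG1m n z) (Filter.Eventually.of_forall fun ω hω _ i hi => ?_)
      have hω' : 𝕏 n (h n * z) ω = 𝒳 n (h n * z) ω := hω
      rw [← hω']
      exact hXs n _ hz ω i hi
    · exact Filter.Eventually.of_forall fun ω hz' => absurd hz' hz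
  have hYX : ∀ ω, (∀ n z, ω ∈ G1 n z) → ∀ n, ∀ t ∈ Set.Icc 0 T, ∀ i, 𝕏 n t ω i = Y n t ω i := by
    intro ω hω n t ht i
    rw [hXX n ω t ht i, hcg n _ _ (fun u => prj (ℍ n) (𝒳 n u ω)) ?_ t ht i]
    intro s hs
    have hm := fl_mem (hh n).1 hs
    funext j
    simp only [prj]
    split_ifs with hj
    · rfl
    · exact hω n ⌊s / h n⌋ hm j hj
  have hG2a : ∀ᵐ ω ∂P, ∀ n z, ω ∈ G2 n z := by
    refine ae_all_iff.2 fun n => ae_all_iff.2 fun z => ?_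
    by_cases hz : h n * z ∈ Set.Icc 0 T
    · refine ae_of_outer (h𝕏𝒳 n _ hz) (hG2m n z) ?_
      filter_upwards [hG1a] with ω h1 hω _ i
      have hω' : 𝕏 n (h n * z) ω = 𝒳 n (h n * z) ω := hω
      rw [← hω']
      exact (hYX ω h1 n _ hz i).symm
    · exact Filter.Eventually.of_forall fun ω hz' => absurd hz' hz
  set Ω₁ : Set Ω := Ω₀ ∩ ((⋂ n, ⋂ z, G1 n z) ∩ (⋂ n, ⋂ z, G2 n z)) with hΩ₁
  have hΩ₁m : MeasurableSet Ω₁ := hΩ₀m.inter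
    ((MeasurableSet.iInter fun n => MeasurableSet.iInter fun z => hG1m n z).inter
      (MeasurableSet.iInter fun n => MeasurableSet.iInter fun z => hG2m n z))
  have hΩ₁a : ∀ᵐ ω ∂P, ω ∈ Ω₁ := by
    filter_upwards [(mem_ae_iff_prob_eq_one hΩ₀m).2 hΩ₀, hG1a, hG2a] with ω h0 h1 h2
    exact ⟨h0, Set.mem_iInter₂.2 h1, Set.mem_iInter₂.2 h2⟩
  have hpath : ∀ ω ∈ Ω₁, ∃ X : ℝ → I → ℝ, ContPathW κ lam ϱ T X ∧
      (∀ t ∈ Set.Icc 0 T, ∀ i, X t i = conv lam (fun s => F (X s)) 0 t i + O t ω i) ∧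
      ∀ e > 0, ∀ᶠ n in Filter.atTop, ∀ t ∈ Set.Icc 0 T, wle κ lam ϱ (X t - 𝕏 n t ω) e := by
    rintro ω ⟨h0, h1, h2⟩
    have h1' := Set.mem_iInter₂.1 h1
    have h2' := Set.mem_iInter₂.1 h2
    have W : PW κ lam T ϱ χ F ℍ h (fun t => O t ω) (fun n t => 𝒪 n t ω) (fun n t => 𝕏 n t ω) := by
      refine ⟨fun n => ⟨h𝒪cont n ω, fun t ht => h𝒪supp n t ht ω, fun t ht i => ?_⟩, hOcont ω, ?_⟩
      · rw [hXX n ω t ht i, hcg n _ _ (fun u => 𝕏 n u ω) ?_ t ht i]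
        intro s hs
        have hm := fl_mem (hh n).1 hs
        funext j
        exact ((hYX ω h1' n _ hm j).trans (h2' n ⌊s / h n⌋ hm j)).symm
      · intro e he
        filter_upwards [hΩ₀conv ω h0 e he] with n hn t ht
        exact ⟨((hOcont ω).1 t ht).sub hμ ((h𝒪cont n ω).1 t ht), hn t ht⟩
    obtain ⟨C, hC⟩ := hΩ₀liminf ω h0
    have hOq : ∀ n, ∀ t ∈ Set.Icc 0 T, 𝕆 n t ω = 𝒪 n t ω - qc η lam (fun s => 𝒪 n s ω) t := by
      intro n t ht
      funext i
      rw [h𝕆 n t ht ω i]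
      simp only [Pi.sub_apply, qc, conv]
      congr 1
      refine intervalIntegral.integral_congr fun s _ => ?_
      rw [← mul_assoc, ← Real.exp_add]
      congr 2
      ring
    refine D.pathwise W (Ic := fun m => ∫ u in (0:ℝ)..T, wnorm κ lam ϱ (𝒪 m u ω) ^ (4 + 4 * ϑ))
      (fun m => intervalIntegral.integral_nonneg hT.le fun u _ =>
        Real.rpow_nonneg (wnorm_nonneg' _ _) _) C ?_
    refine hC.mono fun m hm => le_of_eq_of_le (intervalIntegral.integral_congr fun r hr => ?_) hm
    rw [Set.uIcc_of_le hT.le] at hr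
    have e1 : (∫ u in r..T, 2 * φhat (𝒪 m (fl (h m) u) ω
        - qc η lam (fun s => 𝒪 m s ω) (fl (h m) u)))
        = ∫ u in r..T, 2 * φhat (𝕆 m (fl (h m) u) ω) := by
      refine intervalIntegral.integral_congr fun u hu => ?_
      rw [Set.uIcc_of_le hr.2] at hu
      simp only [hOq m _ (fl_mem (hh m).1 ⟨hr.1.trans hu.1, hu.2⟩)]
    simp only [e1, hOq m _ (fl_mem (hh m).1 hr), hOq m _ hr]
  choose! X0 hX0 using hpath
  classical
  set X : ℝ → Ω → I → ℝ := fun t ω => if ω ∈ Ω₁ then X0 ω t else 0 with hX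
  have hXon : ∀ ω ∈ Ω₁, ∀ t, X t ω = X0 ω t := fun ω hω t => by simp [hX, hω]
  have hXoff : ∀ ω ∉ Ω₁, ∀ t, X t ω = 0 := fun ω hω t => by simp [hX, hω]
  have hXc : ∀ ω, ContPathW κ lam ϱ T fun t => X t ω := by
    intro ω
    by_cases hω : ω ∈ Ω₁
    · simp only [hXon ω hω]; exact (hX0 ω hω).1
    · simp only [hXoff ω hω]
      refine ⟨fun t _ => memW_fin ϱ ∅ (by simp), fun t _ e he => ⟨1, one_pos, fun s _ _ => ?_⟩⟩
      rw [wnorm_fin ϱ ∅ (by simp)]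
      simpa using he.le
  have hXe : ∀ ω ∈ Ω₁, ∀ t ∈ Set.Icc 0 T, ∀ i,
      X t ω i = conv lam (fun s => F (X s ω)) 0 t i + O t ω i := by
    intro ω hω
    simp only [hXon ω hω]
    exact (hX0 ω hω).2.1
  have hXp : IsProcW T X := by
    intro t ht i
    refine measurable_of_tendsto_metrizable
      (f := fun n => Ω₁.indicator fun ω => Y n t ω i) (fun n => (hYm n t ht i).indicator hΩ₁m)
      (tendsto_pi_nhds.2 fun ω => ?_)
    by_cases hω : ω ∈ Ω₁
    · simp only [Set.indicator_of_mem hω, hXon ω hω]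
      have h1' := Set.mem_iInter₂.1 hω.2.1
      rw [Metric.tendsto_nhds]
      intro e he
      have hp : 0 < (κ + lam i) ^ (-ϱ) := Real.rpow_pos_of_pos (hμ i) _
      filter_upwards [(hX0 ω hω).2.2 (e / 2 / (κ + lam i) ^ (-ϱ)) (by positivity)] with n hn
      have h4 := (hn t ht).coord' hμ i
      rw [mul_div_cancel₀ _ hp.ne', Pi.sub_apply, hYX ω h1' n t ht i, abs_sub_comm] at h4
      rw [Real.dist_eq]
      linarith
    · simp only [Set.indicator_of_notMem hω, hXoff ω hω]
      exact tendsto_const_nhds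
  refine ⟨X, ⟨hXp, hXc, fun t ht => prob_one_of_ae ?_⟩, fun Z hZ => prob_one_of_ae ?_,
    Ω₁, hΩ₁m, prob_one_of_ae hΩ₁a, fun ω hω e he => ?_⟩
  · filter_upwards [hΩ₁a] with ω hω
    exact hXe ω hω t ht
  · filter_upwards [hΩ₁a, D.mild_ae hOproc hOcont hZ] with ω hω hz
    exact D.unique (hXc ω) (hZ.2.1 ω) (hXe ω hω) hz
  · filter_upwards [(hX0 ω hω).2.2 e he] with n hn t ht
    rw [hXon ω hω]
    exact (hn t ht).2
end
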